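/- arXiv:2004.10526 — 3 statements merged into one kernel-verified Lean document; each statement's English description precedes it below -/
import Mathlib

section
/- Let n > 3 be an odd integer. Then, modulo [n]·Φ_n(q)^3, the following q-congruence of rational functions holds: Σ_{k=0}^{n-1} [3k-3] · ((q;q^2)_k · (q^{-3};q^2)_k^2 / ((q;q)_k^2 · (q^2;q^2)_k)) · q^{(7k-k^2)/2} ≡ [n]·q^{-(n+3)/2} - ((1+q)/q)·[n]^3 - ((1+q^3)/(1+q+q^2)^2)·[n]^3 + ((n^2-1)(1-q)^2/24)·[n]^3·q^{-(n+3)/2}. -/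
open Finset Polynomial

/-- The variable `q`, viewed as a rational function over `ℚ`. -/
noncomputable def q : RatFunc ℚ := RatFunc.X

/-- The q-shifted factorial `(a; b)_n = (1-a)(1-ab)⋯(1-ab^{n-1})`. -/
noncomputable def qpoch (a b : RatFunc ℚ) (n : ℕ) : RatFunc ℚ :=
  ∏ i ∈ Finset.range n, (1 - a * b ^ i)

/-- The q-integer `[m] = (1-q^m)/(1-q)` (for an arbitrary integer `m`). -/
noncomputable def qint (m : ℤ) : RatFunc ℚ := (1 - q ^ m) / (1 - q)

/-- The q-integer `[n] = 1 + q + ⋯ + q^{n-1}` as a polynomial. -/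
noncomputable def qintPoly (n : ℕ) : Polynomial ℚ := ∑ i ∈ Finset.range n, Polynomial.X ^ i

/-- The central q-binomial coefficient `[2k choose k] = (q;q)_{2k}/(q;q)_k^2`. -/
noncomputable def qcb (k : ℕ) : RatFunc ℚ := qpoch q q (2 * k) / (qpoch q q k) ^ 2

/-- Two rational functions are congruent modulo a polynomial `P` iff `P` divides the
numerator of the reduced form of their difference. -/
def ratCongr (A B : RatFunc ℚ) (P : Polynomial ℚ) : Prop := P ∣ (A - B).num

section QIdentities

variable {K : Type*} [Field K]

/-- The product `(x;x)_k`. -/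
def fullProd (x : K) (k : ℕ) : K := ∏ i ∈ range k, (1 - x ^ (i + 1))

/-- The product `(x;x²)_k`. -/
def oddProd (x : K) (k : ℕ) : K := ∏ i ∈ range k, (1 - x ^ (2 * i + 1))

/-- The product `(x²;x²)_k`. -/
def evenProd (x : K) (k : ℕ) : K := ∏ i ∈ range k, (1 - x ^ (2 * i + 2))

/-- The product `(a;x²)_k`. -/
def stepProd (x a : K) (k : ℕ) : K := ∏ i ∈ range k, (1 - a * x ^ (2 * i))

lemma fullProd_succ (x : K) (k : ℕ) : fullProd x (k + 1) = fullProd x k * (1 - x ^ (k + 1)) :=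
  prod_range_succ _ _

lemma oddProd_succ (x : K) (k : ℕ) : oddProd x (k + 1) = oddProd x k * (1 - x ^ (2 * k + 1)) :=
  prod_range_succ _ _

lemma evenProd_succ (x : K) (k : ℕ) :
    evenProd x (k + 1) = evenProd x k * (1 - x ^ (2 * k + 2)) :=
  prod_range_succ _ _

lemma stepProd_succ (x a : K) (k : ℕ) :
    stepProd x a (k + 1) = stepProd x a k * (1 - a * x ^ (2 * k)) :=
  prod_range_succ _ _

lemma stepProd_succ_left (x a : K) (k : ℕ) :
    stepProd x a (k + 1) = (1 - a) * stepProd x (a * x ^ 2) k := by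
  rw [stepProd, prod_range_succ', mul_comm]
  congr 1
  · simp
  · exact prod_congr rfl fun i _ => by ring

lemma fullProd_two_mul (x : K) (k : ℕ) : fullProd x (2 * k) = oddProd x k * evenProd x k := by
  induction k with
  | zero => simp [fullProd, oddProd, evenProd]
  | succ k ih =>
    rw [show 2 * (k + 1) = 2 * k + 1 + 1 by ring, fullProd_succ, fullProd_succ, ih, oddProd_succ,
      evenProd_succ]
    ring

lemma fullProd_ne_zero {x : K} (hx : ∀ m : ℕ, 0 < m → 1 - x ^ m ≠ 0) (k : ℕ) :
    fullProd x k ≠ 0 :=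
  prod_ne_zero_iff.2 fun _ _ => hx _ (by omega)

lemma oddProd_ne_zero {x : K} (hx : ∀ m : ℕ, 0 < m → 1 - x ^ m ≠ 0) (k : ℕ) :
    oddProd x k ≠ 0 :=
  prod_ne_zero_iff.2 fun _ _ => hx _ (by omega)

lemma evenProd_ne_zero {x : K} (hx : ∀ m : ℕ, 0 < m → 1 - x ^ m ≠ 0) (k : ℕ) :
    evenProd x k ≠ 0 :=
  prod_ne_zero_iff.2 fun _ _ => hx _ (by omega)

lemma choose_two_succ (k : ℕ) : (k + 1).choose 2 = k.choose 2 + k := by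
  rw [Nat.choose_succ_succ' k 1, Nat.choose_one_right, add_comm]

/-- The summand of the quadratic basic hypergeometric series with parameter `a`. -/
def quadTerm (x a : K) (k : ℕ) : K :=
  (1 - a * x ^ (3 * k)) * oddProd x k * stepProd x a k ^ 2 /
    (evenProd x k * fullProd x k ^ 2 * (a ^ k * x ^ k.choose 2))

/-- The boundary term that comes with the shift `a ↦ a x²` in the sum of `quadTerm`. -/
def shiftBoundary (x a : K) (N : ℕ) : K :=
  (1 + a * x ^ (N + 1)) * oddProd x (N + 1) * stepProd x (a * x ^ 2) N ^ 2 /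
    (evenProd x N * fullProd x N ^ 2 * (a ^ N * x ^ N.choose 2 * x ^ (2 * N)))

lemma sum_quadTerm_shift {x a : K} (hx0 : x ≠ 0) (ha : a ≠ 0)
    (hx : ∀ m : ℕ, 0 < m → 1 - x ^ m ≠ 0) (N : ℕ) :
    ∑ k ∈ range (N + 1), quadTerm x (a * x ^ 2) k =
      x * ∑ k ∈ range (N + 1), quadTerm x a k + shiftBoundary x a N := by
  induction N with
  | zero =>
    simp [quadTerm, shiftBoundary, oddProd, evenProd, fullProd, stepProd]
    ring
  | succ N ih =>
    rw [sum_range_succ, ih, sum_range_succ _ (N + 1)]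
    have step : quadTerm x (a * x ^ 2) (N + 1) + shiftBoundary x a N =
        x * quadTerm x a (N + 1) + shiftBoundary x a (N + 1) := by
      have h1 := evenProd_ne_zero hx N
      have h2 := fullProd_ne_zero hx N
      have h3 : 1 - x ^ (2 * N + 2) ≠ 0 := hx _ (by omega)
      have h4 : 1 - x ^ (N + 1) ≠ 0 := hx _ (by omega)
      simp only [quadTerm, shiftBoundary, choose_two_succ, stepProd_succ_left x a,
        oddProd_succ x (N + 1), stepProd_succ x (a * x ^ 2), evenProd_succ, fullProd_succ]
      generalize oddProd x (N + 1) = A at *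
      generalize stepProd x (a * x ^ 2) N = B at *
      generalize evenProd x N = C at *
      generalize fullProd x N = D at *
      have e1 : x ^ (2 * N + 2) = (x ^ N) ^ 2 * x ^ 2 := by ring
      have e2 : x ^ (N + 1) = x ^ N * x := by ring
      have e3 : x ^ (3 * (N + 1)) = (x ^ N) ^ 3 * x ^ 3 := by ring
      have e4 : x ^ (N + 1 + 1) = x ^ N * x ^ 2 := by ring
      have e5 : x ^ (2 * N) = (x ^ N) ^ 2 := by ring
      have e6 : x ^ (2 * (N + 1) + 1) = (x ^ N) ^ 2 * x ^ 3 := by ring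
      have e7 : x ^ (2 * (N + 1)) = (x ^ N) ^ 2 * x ^ 2 := by ring
      have e8 : x ^ (N.choose 2 + N) = x ^ N.choose 2 * x ^ N := by ring
      have e9 : (a * x ^ 2) ^ (N + 1) = a ^ N * a * (x ^ N) ^ 2 * x ^ 2 := by ring
      have e10 : a ^ (N + 1) = a ^ N * a := by ring
      rw [e1] at h3
      rw [e2] at h4
      rw [e1, e2, e3, e4, e5, e6, e7, e8, e9, e10]
      have hX : x ^ N ≠ 0 := pow_ne_zero _ hx0
      have hA : a ^ N ≠ 0 := pow_ne_zero _ ha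
      have hc : x ^ N.choose 2 ≠ 0 := pow_ne_zero _ hx0
      generalize x ^ N.choose 2 = Z at *
      generalize x ^ N = X at *
      generalize a ^ N = Y at *
      obtain ⟨u, hu⟩ : ∃ u, u = 1 - X ^ 2 * x ^ 2 := ⟨_, rfl⟩
      obtain ⟨v, hv⟩ : ∃ v, v = 1 - X * x := ⟨_, rfl⟩
      rw [← hu] at h3 ⊢
      rw [← hv] at h4 ⊢
      field_simp
      rw [hu, hv]
      ring
    linear_combination step

/-- The summand obtained from `quadTerm x x` after removing a pole, indexed from its first
nonzero term. -/
def residueTerm (x : K) (j r : ℕ) : K :=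
  (-1) ^ j * x ^ (2 * j.choose 2) * (1 - x ^ (3 * (2 * j + r) + 1)) * oddProd x (2 * j + r) *
    oddProd x (3 * j + r) * oddProd x (j + r) /
    (evenProd x (2 * j + r) * fullProd x (4 * j + r) * fullProd x r *
      x ^ (2 * j + r + 1).choose 2)

/-- The boundary term that comes with the shift `j ↦ j + 1` in the sum of `residueTerm`. -/
def residueBoundary (x : K) (j r : ℕ) : K :=
  (-1) ^ j * x ^ (2 * j.choose 2) * (1 + x ^ (2 * j + 1)) * (1 - x ^ (2 * j + r + 1)) *
    oddProd x (2 * j + r + 1) * oddProd x (3 * j + r + 1) * oddProd x (j + r) /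
    (evenProd x (2 * j + r) * fullProd x r * fullProd x (4 * j + r + 2) *
      x ^ (2 * j + r + 1).choose 2)

lemma residueTerm_zero_add_one {x : K} (hx0 : x ≠ 0) (hx : ∀ m : ℕ, 0 < m → 1 - x ^ m ≠ 0)
    (j : ℕ) : residueTerm x j 0 + residueTerm x j 1 = residueBoundary x j 1 := by
  have h1 := evenProd_ne_zero hx (2 * j)
  have h2 := fullProd_ne_zero hx (4 * j)
  have h3 : 1 - x ^ (2 * (2 * j) + 2) ≠ 0 := hx _ (by omega)
  have h4 : 1 - x ^ (4 * j + 1) ≠ 0 := hx _ (by omega)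
  have h5 : 1 - x ^ (4 * j + 3) ≠ 0 := hx _ (by omega)
  have h6 : 1 - x ^ 1 ≠ 0 := hx 1 one_pos
  have hf : fullProd x 0 = 1 := by simp [fullProd]
  simp only [residueTerm, residueBoundary, add_zero, evenProd_succ, oddProd_succ, fullProd_succ,
    choose_two_succ, hf, zero_add]
  have e1 : x ^ (3 * (2 * j) + 1) = (x ^ j) ^ 6 * x := by ring
  have e2 : x ^ ((2 * j).choose 2 + 2 * j) = x ^ (2 * j).choose 2 * (x ^ j) ^ 2 := by ring
  have e3 : x ^ ((2 * j).choose 2 + 2 * j + (2 * j + 1)) =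
    x ^ (2 * j).choose 2 * (x ^ j) ^ 4 * x := by ring
  have e4 : x ^ (3 * (2 * j + 1) + 1) = (x ^ j) ^ 6 * x ^ 4 := by ring
  have e5 : x ^ (2 * (2 * j) + 1) = (x ^ j) ^ 4 * x := by ring
  have e6 : x ^ (2 * (3 * j) + 1) = (x ^ j) ^ 6 * x := by ring
  have e7 : x ^ (2 * j + 1) = (x ^ j) ^ 2 * x := by ring
  have e8 : x ^ (2 * (2 * j) + 2) = (x ^ j) ^ 4 * x ^ 2 := by ring
  have e9 : x ^ (4 * j + 1) = (x ^ j) ^ 4 * x := by ring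
  have e10 : x ^ (4 * j + 3) = (x ^ j) ^ 4 * x ^ 3 := by ring
  have e11 : x ^ (2 * j + 1 + 1) = (x ^ j) ^ 2 * x ^ 2 := by ring
  have e12 : x ^ (2 * (2 * j + 1) + 1) = (x ^ j) ^ 4 * x ^ 3 := by ring
  have e13 : x ^ (2 * (3 * j + 1) + 1) = (x ^ j) ^ 6 * x ^ 3 := by ring
  have e14 : x ^ (4 * j + 1 + 1) = (x ^ j) ^ 4 * x ^ 2 := by ring
  have e15 : x ^ (4 * j + 1 + 1 + 1) = (x ^ j) ^ 4 * x ^ 3 := by ring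
  rw [e8] at h3
  rw [e9] at h4
  rw [e10] at h5
  simp only [e1, e2, e3, e4, e5, e6, e7, e8, e9, e11, e12, e13, e14, e15]
  generalize oddProd x (2 * j) = A at *
  generalize oddProd x (3 * j) = B at *
  generalize oddProd x j = C at *
  generalize evenProd x (2 * j) = D at *
  generalize fullProd x (4 * j) = E at *
  have hX : x ^ j ≠ 0 := pow_ne_zero _ hx0
  have hc : x ^ (2 * j).choose 2 ≠ 0 := pow_ne_zero _ hx0
  generalize x ^ (2 * j).choose 2 = Z at *
  generalize x ^ (2 * j.choose 2) = W at *
  generalize x ^ j = X at *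
  generalize (-1 : K) ^ j = V at *
  obtain ⟨u, hu⟩ : ∃ u, u = 1 - X ^ 4 * x ^ 2 := ⟨_, rfl⟩
  obtain ⟨v, hv⟩ : ∃ v, v = 1 - X ^ 4 * x := ⟨_, rfl⟩
  obtain ⟨w, hw⟩ : ∃ w, w = 1 - X ^ 4 * x ^ 3 := ⟨_, rfl⟩
  obtain ⟨y, hy⟩ : ∃ y, y = 1 - x ^ 1 := ⟨_, rfl⟩
  rw [← hu] at h3 ⊢
  rw [← hv] at h4 ⊢
  rw [← hw] at h5 ⊢
  rw [← hy] at h6 ⊢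
  field_simp
  simp only [hu, hy]
  ring

lemma residueTerm_step {x : K} (hx0 : x ≠ 0) (hx : ∀ m : ℕ, 0 < m → 1 - x ^ m ≠ 0)
    (j R : ℕ) : residueTerm x j (R + 2) + residueBoundary x j (R + 1) =
      x * residueTerm x (j + 1) R + residueBoundary x j (R + 2) := by
  have h1 := evenProd_ne_zero hx (2 * j + R + 1)
  have h2 := fullProd_ne_zero hx (4 * j + R + 2)
  have h3 := fullProd_ne_zero hx R
  have h4 : 1 - x ^ (2 * (2 * j + R + 1) + 2) ≠ 0 := hx _ (by omega)
  have h5 : 1 - x ^ (4 * j + R + 3) ≠ 0 := hx _ (by omega)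
  have h6 : 1 - x ^ (4 * j + R + 4) ≠ 0 := hx _ (by omega)
  have h7 : 1 - x ^ (R + 1) ≠ 0 := hx _ (by omega)
  have h8 : 1 - x ^ (R + 2) ≠ 0 := hx _ (by omega)
  simp only [residueTerm, residueBoundary]
  rw [show 2 * (j + 1) + R = 2 * j + R + 2 by ring, show 2 * j + (R + 2) = 2 * j + R + 2 by ring,
    show 3 * j + (R + 2) = 3 * j + R + 2 by ring, show j + (R + 2) = j + R + 2 by ring,
    show 4 * j + (R + 2) = 4 * j + R + 2 by ring, show 2 * j + (R + 1) = 2 * j + R + 1 by ring,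
    show 3 * j + (R + 1) = 3 * j + R + 1 by ring, show j + (R + 1) = j + R + 1 by ring,
    show 4 * j + (R + 1) = 4 * j + R + 1 by ring, show 3 * (j + 1) + R = 3 * j + R + 2 + 1 by ring,
    show j + 1 + R = j + R + 1 by ring, show 4 * (j + 1) + R = 4 * j + R + 2 + 1 + 1 by ring,
    show 4 * j + R + 1 + 2 = 4 * j + R + 2 + 1 by ring]
  simp only [evenProd_succ x (2 * j + R + 1), oddProd_succ x (j + R + 1),
    oddProd_succ x (2 * j + R + 2), oddProd_succ x (3 * j + R + 2),
    fullProd_succ x (4 * j + R + 2 + 1), fullProd_succ x (4 * j + R + 2), fullProd_succ x (R + 1),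
    fullProd_succ x R, choose_two_succ (2 * j + R + 2), choose_two_succ j]
  have e1 : x ^ (2 * (2 * j + R + 1) + 2) = (x ^ j) ^ 4 * (x ^ R) ^ 2 * x ^ 4 := by ring
  have e2 : x ^ (4 * j + R + 3) = (x ^ j) ^ 4 * x ^ R * x ^ 3 := by ring
  have e3 : x ^ (4 * j + R + 4) = (x ^ j) ^ 4 * x ^ R * x ^ 4 := by ring
  have e4 : x ^ (R + 1) = x ^ R * x := by ring
  have e5 : x ^ (R + 2) = x ^ R * x ^ 2 := by ring
  have e6 : x ^ (4 * j + R + 2 + 1) = (x ^ j) ^ 4 * x ^ R * x ^ 3 := by ring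
  have e7 : x ^ (4 * j + R + 2 + 1 + 1) = (x ^ j) ^ 4 * x ^ R * x ^ 4 := by ring
  have e8 : x ^ (R + 1 + 1) = x ^ R * x ^ 2 := by ring
  have e9 : x ^ (2 * (j + R + 1) + 1) = (x ^ j) ^ 2 * (x ^ R) ^ 2 * x ^ 3 := by ring
  have e10 : x ^ (2 * (2 * j + R + 2) + 1) = (x ^ j) ^ 4 * (x ^ R) ^ 2 * x ^ 5 := by ring
  have e11 : x ^ (2 * (3 * j + R + 2) + 1) = (x ^ j) ^ 6 * (x ^ R) ^ 2 * x ^ 5 := by ring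
  have e12 : x ^ (3 * (2 * j + R + 2) + 1) = (x ^ j) ^ 6 * (x ^ R) ^ 3 * x ^ 7 := by ring
  have e13 : x ^ (2 * j + 1) = (x ^ j) ^ 2 * x := by ring
  have e14 : x ^ (2 * j + R + 1 + 1) = (x ^ j) ^ 2 * x ^ R * x ^ 2 := by ring
  have e15 : x ^ (2 * j + R + 2 + 1) = (x ^ j) ^ 2 * x ^ R * x ^ 3 := by ring
  have e16 : x ^ ((2 * j + R + 2).choose 2 + (2 * j + R + 2)) =
    x ^ (2 * j + R + 2).choose 2 * ((x ^ j) ^ 2 * x ^ R * x ^ 2) := by ring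
  have e17 : x ^ (2 * (j.choose 2 + j)) = x ^ (2 * j.choose 2) * (x ^ j) ^ 2 := by ring
  have e18 : x ^ (2 * j + R + 1 + 1).choose 2 = x ^ (2 * j + R + 2).choose 2 := rfl
  rw [e1] at h4
  rw [e2] at h5
  rw [e3] at h6
  rw [e4] at h7
  rw [e5] at h8
  simp only [e1, e4, e6, e7, e8, e9, e10, e11, e12, e13, e14, e15, e16, e17, e18, pow_succ (-1 : K)]
  clear e1 e2 e3 e4 e5 e6 e7 e8 e9 e10 e11 e12 e13 e14 e15 e16 e17 e18
  have o1 : oddProd x (2 * j + R + 1 + 1) = oddProd x (2 * j + R + 2) := rfl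
  have o2 : oddProd x (3 * j + R + 1 + 1) = oddProd x (3 * j + R + 2) := rfl
  rw [o1, o2]
  generalize oddProd x (2 * j + R + 2) = A at *
  generalize oddProd x (3 * j + R + 2) = B at *
  generalize oddProd x (j + R + 1) = C at *
  generalize evenProd x (2 * j + R + 1) = D at *
  generalize fullProd x (4 * j + R + 2) = E at *
  generalize fullProd x R = F at *
  have hX : x ^ j ≠ 0 := pow_ne_zero _ hx0
  have hY : x ^ R ≠ 0 := pow_ne_zero _ hx0
  have hc : x ^ (2 * j + R + 2).choose 2 ≠ 0 := pow_ne_zero _ hx0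
  generalize x ^ (2 * j + R + 2).choose 2 = Z at *
  generalize x ^ (2 * j.choose 2) = W at *
  generalize x ^ j = X at *
  generalize x ^ R = Y at *
  generalize (-1 : K) ^ j = V at *
  obtain ⟨u, hu⟩ : ∃ u, u = 1 - X ^ 4 * Y ^ 2 * x ^ 4 := ⟨_, rfl⟩
  obtain ⟨v, hv⟩ : ∃ v, v = 1 - X ^ 4 * Y * x ^ 3 := ⟨_, rfl⟩
  obtain ⟨w, hw⟩ : ∃ w, w = 1 - X ^ 4 * Y * x ^ 4 := ⟨_, rfl⟩
  obtain ⟨y, hy⟩ : ∃ y, y = 1 - Y * x := ⟨_, rfl⟩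
  obtain ⟨z, hz⟩ : ∃ z, z = 1 - Y * x ^ 2 := ⟨_, rfl⟩
  rw [← hu] at h4 ⊢
  rw [← hv] at h5 ⊢
  rw [← hw] at h6 ⊢
  rw [← hy] at h7 ⊢
  rw [← hz] at h8 ⊢
  field_simp
  rw [hu, hv, hw, hy, hz]
  ring

lemma sum_residueTerm_step {x : K} (hx0 : x ≠ 0) (hx : ∀ m : ℕ, 0 < m → 1 - x ^ m ≠ 0)
    (j R : ℕ) : ∑ r ∈ range (R + 2), residueTerm x j r =
      x * ∑ r ∈ range R, residueTerm x (j + 1) r + residueBoundary x j (R + 1) := by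
  induction R with
  | zero => simp [sum_range_succ, residueTerm_zero_add_one hx0 hx]
  | succ R ih =>
    rw [show R + 1 + 2 = R + 2 + 1 by ring, sum_range_succ, ih, sum_range_succ _ R]
    linear_combination residueTerm_step hx0 hx j R

lemma sum_residueTerm {x : K} (hx0 : x ≠ 0) (hx : ∀ m : ℕ, 0 < m → 1 - x ^ m ≠ 0) (m : ℕ) :
    ∑ r ∈ range (2 * m + 1), residueTerm x 0 r =
      x ^ m * residueTerm x m 0 + ∑ j ∈ range m, x ^ j * residueBoundary x j (2 * (m - j)) := by
  have key : ∀ i ≤ m, ∑ r ∈ range (2 * m + 1), residueTerm x 0 r =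
      x ^ i * ∑ r ∈ range (2 * (m - i) + 1), residueTerm x i r +
        ∑ j ∈ range i, x ^ j * residueBoundary x j (2 * (m - j)) := by
    intro i
    induction i with
    | zero => simp
    | succ i ih =>
      intro hi
      rw [ih (by omega), sum_range_succ _ i,
        show 2 * (m - i) + 1 = 2 * (m - (i + 1)) + 1 + 2 by omega,
        sum_residueTerm_step hx0 hx, show 2 * (m - (i + 1)) + 1 + 1 = 2 * (m - i) by omega]
      ring
  simpa using key m le_rfl

lemma quadTerm_self (x : K) (r : ℕ) : quadTerm x x r = residueTerm x 0 r := by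
  have h : stepProd x x r = oddProd x r := prod_congr rfl fun i _ => by ring
  simp only [quadTerm, residueTerm, h, mul_zero, zero_add, choose_two_succ]
  simp only [Nat.choose_zero_succ, mul_zero, pow_zero, one_mul]
  rw [show x * x ^ (3 * r) = x ^ (3 * r + 1) by ring, show x ^ r * x ^ r.choose 2 =
    x ^ (r.choose 2 + r) by ring]
  ring

lemma fullProd_inv {x : K} (hx0 : x ≠ 0) (k : ℕ) :
    fullProd x⁻¹ k * x ^ (k + 1).choose 2 = (-1) ^ k * fullProd x k := by
  induction k with
  | zero => simp [fullProd]
  | succ k ih =>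
    have h : (1 - x⁻¹ ^ (k + 1)) * x ^ (k + 1) = -(1 - x ^ (k + 1)) := by
      rw [inv_pow]
      field_simp
      ring
    rw [fullProd_succ, choose_two_succ, pow_add, fullProd_succ, pow_succ (-1 : K)]
    linear_combination (1 - x⁻¹ ^ (k + 1)) * x ^ (k + 1) * ih + (-1) ^ k * fullProd x k * h

lemma oddProd_inv {x : K} (hx0 : x ≠ 0) (k : ℕ) :
    oddProd x⁻¹ k * x ^ k ^ 2 = (-1) ^ k * oddProd x k := by
  induction k with
  | zero => simp [oddProd]
  | succ k ih =>
    have h : (1 - x⁻¹ ^ (2 * k + 1)) * x ^ (2 * k + 1) = -(1 - x ^ (2 * k + 1)) := by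
      rw [inv_pow]
      field_simp
      ring
    rw [oddProd_succ, show (k + 1) ^ 2 = k ^ 2 + (2 * k + 1) by ring, pow_add, oddProd_succ,
      pow_succ (-1 : K)]
    linear_combination
      (1 - x⁻¹ ^ (2 * k + 1)) * x ^ (2 * k + 1) * ih + (-1) ^ k * oddProd x k * h

lemma oddProd_add (x : K) (a b : ℕ) :
    oddProd x (a + b) = oddProd x a * ∏ i ∈ range b, (1 - x ^ (2 * a + (2 * i + 1))) := by
  rw [oddProd, prod_range_add]
  congr 1
  exact prod_congr rfl fun i _ => by ring

lemma evenProd_add (x : K) (a b : ℕ) :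
    evenProd x (a + b) = evenProd x a * ∏ i ∈ range b, (1 - x ^ (2 * a + (2 * i + 2))) := by
  rw [evenProd, prod_range_add]
  congr 1
  exact prod_congr rfl fun i _ => by ring

lemma fullProd_add (x : K) (a b : ℕ) :
    fullProd x (a + b) = fullProd x a * ∏ i ∈ range b, (1 - x ^ (a + (i + 1))) := by
  rw [fullProd, prod_range_add]
  congr 1

/-- The function `x^i / (1 - x^i)²`. -/
def squareRatio (x : K) (i : ℕ) : K := x ^ i / (1 - x ^ i) ^ 2

/-- The product of `(1 - (1-x^{2n})² x^{-2n} w) / (1 - (1-x^n)² x^{-n} w)²` over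
`w = squareRatio x i` with `i < 2m` odd. -/
def ratioProd (x : K) (n m : ℕ) : K :=
  ∏ j ∈ range m, (1 - (1 - x ^ (2 * n)) ^ 2 / x ^ (2 * n) * squareRatio x (2 * j + 1)) *
    ((1 - (1 - x ^ n) ^ 2 / x ^ n * squareRatio x (2 * j + 1))⁻¹) ^ 2

lemma one_sub_pow_mul_one_sub_pow {x : K} (hx0 : x ≠ 0) {N o : ℕ} (ho : o ≤ N)
    (h : 1 - x ^ o ≠ 0) : (1 - x ^ (N - o)) * (1 - x ^ (N + o)) =
      -x ^ N / x ^ o * (1 - x ^ o) ^ 2 * (1 - (1 - x ^ N) ^ 2 / x ^ N * squareRatio x o) := by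
  obtain ⟨k, rfl⟩ := Nat.exists_eq_add_of_le ho
  have h1 : x ^ o ≠ 0 := pow_ne_zero _ hx0
  have h2 : x ^ k ≠ 0 := pow_ne_zero _ hx0
  rw [squareRatio, Nat.add_sub_cancel_left, pow_add, pow_add]
  generalize x ^ k = Y at *
  generalize x ^ o = X at *
  obtain ⟨u, hu⟩ : ∃ u, u = 1 - X := ⟨_, rfl⟩
  rw [← hu] at h ⊢
  field_simp
  rw [hu]
  ring

lemma oddProd_three_mul_add_one (x : K) (m : ℕ) :
    oddProd x (3 * m + 1) = oddProd x m * (1 - x ^ (2 * m + 1)) *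
      ∏ j ∈ range m, (1 - x ^ (2 * (2 * m + 1) - (2 * j + 1))) *
        (1 - x ^ (2 * (2 * m + 1) + (2 * j + 1))) := by
  rw [show 3 * m + 1 = m + 1 + m + m by ring, oddProd_add, oddProd_add, oddProd_succ,
    prod_mul_distrib, mul_assoc _ _ (∏ i ∈ range m, _)]
  congr 2
  · rw [← prod_range_reflect]
    refine prod_congr rfl fun j hj => ?_
    rw [mem_range] at hj
    congr 2
    omega
  · exact prod_congr rfl fun j _ => by ring

lemma evenProd_two_mul (x : K) (m : ℕ) :
    evenProd x (2 * m) = ∏ j ∈ range m, (1 - x ^ (2 * m + 1 - (2 * j + 1))) *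
        (1 - x ^ (2 * m + 1 + (2 * j + 1))) := by
  rw [two_mul, evenProd_add, prod_mul_distrib]
  congr 1
  · rw [evenProd, ← prod_range_reflect]
    refine prod_congr rfl fun j hj => ?_
    rw [mem_range] at hj
    congr 2
    omega
  · exact prod_congr rfl fun j _ => by ring

lemma prod_neg_pow_odd (x : K) (m : ℕ) :
    ∏ j ∈ range m, (-x ^ (2 * j + 1)) = (-1) ^ m * x ^ m ^ 2 := by
  induction m with
  | zero => simp
  | succ m ih =>
    rw [prod_range_succ, ih]
    ring

lemma oddProd_mul_oddProd_div {x : K} (hx0 : x ≠ 0) (hx : ∀ m : ℕ, 0 < m → 1 - x ^ m ≠ 0)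
    (m : ℕ) : oddProd x (3 * m + 1) * oddProd x m / evenProd x (2 * m) ^ 2 =
      (-1) ^ m * x ^ m ^ 2 * (1 - x ^ (2 * m + 1)) * ratioProd x (2 * m + 1) m := by
  rw [oddProd_three_mul_add_one, evenProd_two_mul, ratioProd, ← prod_neg_pow_odd, ← prod_pow,
    mul_right_comm _ _ (oddProd x m), mul_right_comm _ _ (oddProd x m), ← sq, oddProd, ← prod_pow,
    mul_right_comm, ← prod_mul_distrib, mul_div_right_comm, ← prod_div_distrib,
    mul_right_comm (∏ j ∈ range m, _), ← prod_mul_distrib]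
  congr 1
  refine prod_congr rfl fun j hj => ?_
  rw [mem_range] at hj
  have ho : 1 - x ^ (2 * j + 1) ≠ 0 := hx _ (by omega)
  rw [one_sub_pow_mul_one_sub_pow hx0 (by omega) ho, one_sub_pow_mul_one_sub_pow hx0 (by omega) ho]
  have h1 : x ^ (2 * j + 1) ≠ 0 := pow_ne_zero _ hx0
  have h2 : x ^ (2 * m + 1) ≠ 0 := pow_ne_zero _ hx0
  have h3 : x ^ (2 * (2 * m + 1)) = (x ^ (2 * m + 1)) ^ 2 := by ring
  rw [h3]
  generalize 1 - (1 - (x ^ (2 * m + 1)) ^ 2) ^ 2 / (x ^ (2 * m + 1)) ^ 2 *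
    squareRatio x (2 * j + 1) = A
  generalize 1 - (1 - x ^ (2 * m + 1)) ^ 2 / x ^ (2 * m + 1) *
    squareRatio x (2 * j + 1) = B
  by_cases hB : B = 0
  · simp [hB]
  · field_simp

lemma residueTerm_self_zero_eq {x : K} (hx0 : x ≠ 0) (hx : ∀ m : ℕ, 0 < m → 1 - x ^ m ≠ 0)
    (m : ℕ) : residueTerm x m 0 = (-1) ^ m * x ^ (2 * m.choose 2) / x ^ (2 * m + 1).choose 2 *
      (oddProd x (3 * m + 1) * oddProd x m / evenProd x (2 * m) ^ 2) := by
  have h1 := evenProd_ne_zero hx (2 * m)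
  have h2 := oddProd_ne_zero hx (2 * m)
  have hf : fullProd x 0 = 1 := by simp [fullProd]
  have hc : x ^ (2 * m + 1).choose 2 ≠ 0 := pow_ne_zero _ hx0
  rw [residueTerm, oddProd_succ, show 4 * m + 0 = 2 * (2 * m) by ring, fullProd_two_mul, hf]
  simp only [add_zero]
  rw [show 3 * (2 * m) + 1 = 2 * (3 * m) + 1 by ring]
  field_simp

lemma two_mul_choose_two_add (m : ℕ) : 2 * m.choose 2 + m = m ^ 2 := by
  induction m with
  | zero => simp
  | succ m ih =>
    rw [choose_two_succ]
    linear_combination ih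

lemma residueTerm_self_zero {x : K} (hx0 : x ≠ 0) (hx : ∀ m : ℕ, 0 < m → 1 - x ^ m ≠ 0) (m : ℕ) :
    x ^ m * residueTerm x m 0 =
      (1 - x ^ (2 * m + 1)) / x ^ m * ratioProd x (2 * m + 1) m := by
  have h1 : x ^ m ≠ 0 := pow_ne_zero _ hx0
  have h2 : x ^ (2 * m + 1).choose 2 ≠ 0 := pow_ne_zero _ hx0
  have h3 : x ^ m * x ^ m * x ^ (2 * m.choose 2) * x ^ m ^ 2 = x ^ (2 * m + 1).choose 2 := by
    rw [← pow_add, ← pow_add, ← pow_add]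
    congr 1
    have e1 := two_mul_choose_two_add m
    have e2 := two_mul_choose_two_add (2 * m + 1)
    nlinarith
  have h4 : ((-1 : K) ^ m) * (-1) ^ m = 1 := by rw [← mul_pow]; simp
  rw [residueTerm_self_zero_eq hx0 hx, oddProd_mul_oddProd_div hx0 hx]
  field_simp
  rw [← h3]
  linear_combination (1 - x ^ (2 * m + 1)) * ratioProd x (2 * m + 1) m *
    (x ^ m * x ^ m * x ^ (2 * m.choose 2) * x ^ m ^ 2) * h4

lemma stepProd_inv_mul_sq (x : K) (k : ℕ) :
    stepProd x (x⁻¹ * x ^ 2) k = oddProd x k :=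
  prod_congr rfl fun i _ => by
    field_simp
    ring

lemma stepProd_inv_cube_mul_sq {x : K} (hx0 : x ≠ 0) (k : ℕ) :
    stepProd x (x⁻¹ ^ 3 * x ^ 2) (k + 1) = -(1 - x) / x * oddProd x k := by
  rw [stepProd_succ_left]
  congr 1
  · field_simp
    ring
  · exact prod_congr rfl fun i _ => by
      field_simp
      ring

lemma shiftBoundary_inv {x : K} (hx0 : x ≠ 0) (N : ℕ) :
    shiftBoundary x x⁻¹ N = (1 + x ^ N) * oddProd x (N + 1) * oddProd x N ^ 2 * x ^ N /
      (evenProd x N * fullProd x N ^ 2 * (x ^ N.choose 2 * x ^ (2 * N))) := by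
  rw [shiftBoundary, stepProd_inv_mul_sq]
  have h : x⁻¹ * x ^ (N + 1) = x ^ N := by
    field_simp
    ring
  rw [h, inv_pow]
  field_simp

lemma shiftBoundary_inv_cube {x : K} (hx0 : x ≠ 0) (N : ℕ) :
    shiftBoundary x (x⁻¹ ^ 3) (N + 2) = (1 + x ^ N) * oddProd x (N + 3) *
      ((1 - x) * oddProd x (N + 1)) ^ 2 * x ^ (3 * N + 4) /
      (evenProd x (N + 2) * fullProd x (N + 2) ^ 2 * (x ^ (N + 2).choose 2 * x ^ (2 * (N + 2)))) := by
  rw [shiftBoundary, stepProd_inv_cube_mul_sq hx0]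
  have h : x⁻¹ ^ 3 * x ^ (N + 2 + 1) = x ^ N := by
    field_simp
    ring
  rw [h, show (x⁻¹ ^ 3) ^ (N + 2) = (x ^ (3 * N + 4) * x ^ 2)⁻¹ by
    rw [← pow_mul, inv_pow, ← pow_add]
    ring_nf]
  field_simp

end QIdentities

section RootsOfUnity

variable {K : Type*} [Field K]

lemma sum_mul_sub_mul_pow (c z : K) (N : ℕ) :
    (1 - z) ^ 3 * ∑ k ∈ range N, (k : K) * (c - k) * z ^ k =
      (c - 1) * (z - z ^ 2) - 2 * (z ^ 2 - z ^ N) + (1 - z) * z ^ N *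
        ((N - 2) * (c - N + 2) - 2 * ((N - 1) * (c - N + 1)) + (N - 1) * (c - N + 1) * z) := by
  induction N with
  | zero =>
    simp
    ring
  | succ N ih =>
    rw [sum_range_succ, mul_add, ih]
    push_cast
    ring

lemma sum_mul_sub_mul_pow_of_pow_eq_one {z : K} {n : ℕ} (hz : z ^ n = 1) (hz1 : z ≠ 1) :
    ∑ k ∈ range n, (k : K) * (n - k) * z ^ k = 2 * n * (z / (1 - z) ^ 2) := by
  have h : 1 - z ≠ 0 := sub_ne_zero.2 hz1.symm
  have := sum_mul_sub_mul_pow (n : K) z n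
  rw [hz] at this
  rw [← mul_right_inj' (pow_ne_zero 3 h), this]
  field_simp
  ring

lemma sum_mul_sub [CharZero K] (c : K) (N : ℕ) :
    ∑ k ∈ range N, (k : K) * (c - k) = N * (N - 1) * (3 * c - 2 * N + 1) / 6 := by
  induction N with
  | zero => simp
  | succ N ih =>
    rw [sum_range_succ, ih]
    push_cast
    ring

lemma sum_squareRatio [CharZero K] {z : K} {n : ℕ} (hn : 0 < n) (hz : IsPrimitiveRoot z n) :
    ∑ i ∈ range n, squareRatio z i = -((n : K) ^ 2 - 1) / 12 := by
  have hn0 : (n : K) ≠ 0 := by exact_mod_cast hn.ne'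
  have h1 : ∀ i ∈ range n, 2 * (n : K) * squareRatio z i =
      ∑ k ∈ range n, (k : K) * (n - k) * (z ^ i) ^ k - if i = 0 then
        ∑ k ∈ range n, (k : K) * (n - k) else 0 := by
    intro i hi
    rw [mem_range] at hi
    rcases Nat.eq_zero_or_pos i with rfl | hi0
    · simp [squareRatio]
    · rw [if_neg hi0.ne', sub_zero, sum_mul_sub_mul_pow_of_pow_eq_one, squareRatio]
      · rw [← pow_mul, mul_comm, pow_mul, hz.pow_eq_one, one_pow]
      · exact hz.pow_ne_one_of_pos_of_lt hi0.ne' hi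
  have h2 : ∀ k ∈ range n, ∑ i ∈ range n, (k : K) * (n - k) * (z ^ i) ^ k = 0 := by
    intro k hk
    rw [mem_range] at hk
    rcases Nat.eq_zero_or_pos k with rfl | hk0
    · simp
    · have hk1 : z ^ k ≠ 1 := hz.pow_ne_one_of_pos_of_lt hk0.ne' hk
      have : ∑ i ∈ range n, (z ^ i) ^ k = 0 := by
        simp_rw [← pow_mul, mul_comm _ k, pow_mul]
        rw [geom_sum_eq hk1, ← pow_mul, mul_comm, pow_mul, hz.pow_eq_one, one_pow, sub_self,
          zero_div]
      rw [← mul_sum, this, mul_zero]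
  have h3 : 2 * (n : K) * ∑ i ∈ range n, squareRatio z i = -∑ k ∈ range n, (k : K) * (n - k) := by
    rw [mul_sum, sum_congr rfl h1, sum_sub_distrib, sum_comm, sum_congr rfl h2]
    simp [hn]
  rw [sum_mul_sub] at h3
  rw [← mul_right_inj' (mul_ne_zero two_ne_zero hn0), h3]
  ring

lemma squareRatio_reflect {z : K} {n i : ℕ} (hz : z ^ n = 1) (hi : i ≤ n) :
    squareRatio z (n - i) = squareRatio z i := by
  have h0 : z ^ i ≠ 0 := by
    intro h
    rw [← Nat.sub_add_cancel hi, pow_add, h, mul_zero] at hz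
    exact zero_ne_one hz
  have h1 : z ^ (n - i) = (z ^ i)⁻¹ := by
    exact eq_inv_of_mul_eq_one_left (by rw [← pow_add, Nat.sub_add_cancel hi, hz])
  rw [squareRatio, squareRatio, h1]
  by_cases h : 1 - z ^ i = 0
  · have : z ^ i = 1 := (sub_eq_zero.1 h).symm
    simp [this]
  · have h2 : 1 - (z ^ i)⁻¹ = -(1 - z ^ i) / z ^ i := by
      field_simp
      ring
    rw [h2]
    field_simp

lemma sum_range_two_mul {M : Type*} [AddCommMonoid M] (g : ℕ → M) (m : ℕ) :
    ∑ i ∈ range (2 * m), g i = ∑ j ∈ range m, g (2 * j) + ∑ j ∈ range m, g (2 * j + 1) := by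
  induction m with
  | zero => simp
  | succ m ih =>
    rw [show 2 * (m + 1) = 2 * m + 1 + 1 by ring, sum_range_succ, sum_range_succ, ih,
      sum_range_succ, sum_range_succ]
    abel

lemma sum_squareRatio_odd [CharZero K] {z : K} {m : ℕ} (hz : IsPrimitiveRoot z (2 * m + 1)) :
    ∑ j ∈ range m, squareRatio z (2 * j + 1) = -(((2 * m + 1 : ℕ) : K) ^ 2 - 1) / 24 := by
  have h := sum_squareRatio (by omega) hz
  have h0 : squareRatio z 0 = 0 := by simp [squareRatio]
  have h2 : ∑ j ∈ range m, squareRatio z (2 * j + 1 + 1) =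
      ∑ j ∈ range m, squareRatio z (2 * j + 1) := by
    rw [← sum_range_reflect]
    refine sum_congr rfl fun j hj => ?_
    rw [mem_range] at hj
    rw [← squareRatio_reflect hz.pow_eq_one (by omega)]
    congr 1
    omega
  rw [sum_range_succ', h0, add_zero, sum_range_two_mul (fun i => squareRatio z (i + 1)), h2] at h
  linear_combination h / 2

lemma sum_pow_mul_one_add_div [CharZero K] {z : K} {m : ℕ}
    (hz : IsPrimitiveRoot z (2 * m + 1)) :
    ∑ j ∈ range m, z ^ j * (z * (1 + z ^ (2 * j + 1)) / (1 - z ^ (2 * j + 1)) ^ 2) =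
      z ^ (m + 1) * ((((2 * m + 1 : ℕ) : K) ^ 2 - 1) / 24) := by
  set p := z ^ (m + 1) with hp
  have hpz : p ^ 2 = z := by
    rw [hp, ← pow_mul, show (m + 1) * 2 = 2 * m + 1 + 1 by ring, pow_succ, hz.pow_eq_one, one_mul]
  have hpp : IsPrimitiveRoot p (2 * m + 1) := by
    refine hz.pow_of_coprime _ ?_
    exact Nat.isCoprime_iff_coprime.1 ⟨2, -1, by push_cast; ring⟩
  have h : ∀ j ∈ range m, z ^ j * (z * (1 + z ^ (2 * j + 1)) / (1 - z ^ (2 * j + 1)) ^ 2) =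
      p * (squareRatio p (2 * j + 1) - 2 * squareRatio z (2 * j + 1)) := by
    intro j hj
    rw [mem_range] at hj
    have h1 : z ^ (2 * j + 1) ≠ 1 := hz.pow_ne_one_of_pos_of_lt (by omega) (by omega)
    have h2 : z ^ (2 * j + 1) = (p ^ (2 * j + 1)) ^ 2 := by rw [← hpz]; ring
    have h3 : z ^ j * z * 1 = p * p ^ (2 * j + 1) := by rw [← hpz]; ring
    have h4 : (1 - p ^ (2 * j + 1)) * (1 + p ^ (2 * j + 1)) ≠ 0 := by
      rw [h2] at h1
      intro h
      exact h1 (by linear_combination -h)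
    rw [squareRatio, squareRatio, h2, show 1 - (p ^ (2 * j + 1)) ^ 2 =
      (1 - p ^ (2 * j + 1)) * (1 + p ^ (2 * j + 1)) by ring]
    have h5 := left_ne_zero_of_mul h4
    have h6 := right_ne_zero_of_mul h4
    have h7 : z ^ j * (z * (1 + (p ^ (2 * j + 1)) ^ 2) /
        ((1 - p ^ (2 * j + 1)) * (1 + p ^ (2 * j + 1))) ^ 2) = p * (p ^ (2 * j + 1) *
        (1 + (p ^ (2 * j + 1)) ^ 2) / ((1 - p ^ (2 * j + 1)) * (1 + p ^ (2 * j + 1))) ^ 2) := by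
      linear_combination (1 + (p ^ (2 * j + 1)) ^ 2) /
        ((1 - p ^ (2 * j + 1)) * (1 + p ^ (2 * j + 1))) ^ 2 * h3
    rw [h7]
    congr 1
    generalize p ^ (2 * j + 1) = u at *
    field_simp
    ring
  rw [sum_congr rfl h, ← mul_sum, sum_sub_distrib, ← mul_sum, sum_squareRatio_odd hz,
    sum_squareRatio_odd hpp]
  ring

end RootsOfUnity

section Values

/-- The rational function `f` is regular at `z` and takes the value `c` there. -/
def HasValueAt (z : ℂ) (f : RatFunc ℚ) (c : ℂ) : Prop :=
  ∃ a b : ℚ[X], aeval z b ≠ 0 ∧ f * algebraMap ℚ[X] (RatFunc ℚ) b = algebraMap ℚ[X] (RatFunc ℚ) a ∧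
    aeval z a = c * aeval z b

namespace HasValueAt

variable {z : ℂ} {f g : RatFunc ℚ} {c c' : ℂ}

lemma polynomial (z : ℂ) (p : ℚ[X]) :
    HasValueAt z (algebraMap ℚ[X] (RatFunc ℚ) p) (aeval z p) :=
  ⟨p, 1, by simp, by simp, by simp⟩

lemma const (z : ℂ) (r : ℚ) : HasValueAt z (algebraMap ℚ (RatFunc ℚ) r) r := by
  have := polynomial z (C r)
  simpa [RatFunc.algebraMap_C] using this

lemma q_pow (z : ℂ) (k : ℕ) : HasValueAt z (q ^ k) (z ^ k) := by
  have := polynomial z (X ^ k)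
  simpa [q, RatFunc.algebraMap_X] using this

lemma one (z : ℂ) : HasValueAt z 1 1 := by
  simpa using q_pow z 0

lemma zero (z : ℂ) : HasValueAt z 0 0 := by
  simpa using polynomial z 0

lemma add (hf : HasValueAt z f c) (hg : HasValueAt z g c') : HasValueAt z (f + g) (c + c') := by
  obtain ⟨a, b, hb, h1, h2⟩ := hf
  obtain ⟨a', b', hb', h1', h2'⟩ := hg
  refine ⟨a * b' + a' * b, b * b', by simp [hb, hb'], ?_, ?_⟩
  · simp only [map_mul, map_add, ← h1, ← h1']
    ring
  · simp only [map_mul, map_add, h2, h2']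
    ring

lemma mul (hf : HasValueAt z f c) (hg : HasValueAt z g c') : HasValueAt z (f * g) (c * c') := by
  obtain ⟨a, b, hb, h1, h2⟩ := hf
  obtain ⟨a', b', hb', h1', h2'⟩ := hg
  refine ⟨a * a', b * b', by simp [hb, hb'], ?_, ?_⟩
  · simp only [map_mul, ← h1, ← h1']
    ring
  · simp only [map_mul, h2, h2']
    ring

lemma neg (hf : HasValueAt z f c) : HasValueAt z (-f) (-c) := by
  simpa using (const z (-1)).mul hf

lemma sub (hf : HasValueAt z f c) (hg : HasValueAt z g c') : HasValueAt z (f - g) (c - c') := by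
  simpa [sub_eq_add_neg] using hf.add hg.neg

lemma inv (hf : HasValueAt z f c) (hc : c ≠ 0) : HasValueAt z f⁻¹ c⁻¹ := by
  obtain ⟨a, b, hb, h1, h2⟩ := hf
  have ha : aeval z a ≠ 0 := by simp [h2, hb, hc]
  have ha0 : algebraMap ℚ[X] (RatFunc ℚ) a ≠ 0 := by
    rw [Ne, FaithfulSMul.algebraMap_eq_zero_iff]
    rintro rfl
    simp at ha
  have hf0 : f ≠ 0 := by
    rintro rfl
    exact ha0 (by rw [← h1, zero_mul])
  refine ⟨b, a, ha, ?_, ?_⟩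
  · rw [← h1, inv_mul_cancel_left₀ hf0]
  · rw [h2, inv_mul_cancel_left₀ hc]

lemma div (hf : HasValueAt z f c) (hg : HasValueAt z g c') (hc : c' ≠ 0) :
    HasValueAt z (f / g) (c / c') := by
  simpa [div_eq_mul_inv] using hf.mul (hg.inv hc)

lemma pow (hf : HasValueAt z f c) (k : ℕ) : HasValueAt z (f ^ k) (c ^ k) := by
  induction k with
  | zero => simpa using one z
  | succ k ih => simpa [pow_succ] using ih.mul hf

lemma sum {ι : Type*} {s : Finset ι} {F : ι → RatFunc ℚ} {v : ι → ℂ}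
    (h : ∀ i ∈ s, HasValueAt z (F i) (v i)) : HasValueAt z (∑ i ∈ s, F i) (∑ i ∈ s, v i) := by
  classical
  induction s using Finset.induction_on with
  | empty => simpa using zero z
  | insert i s hi ih =>
    rw [sum_insert hi, sum_insert hi]
    exact (h i (mem_insert_self i s)).add (ih fun j hj => h j (mem_insert_of_mem hj))

lemma prod {ι : Type*} {s : Finset ι} {F : ι → RatFunc ℚ} {v : ι → ℂ}
    (h : ∀ i ∈ s, HasValueAt z (F i) (v i)) : HasValueAt z (∏ i ∈ s, F i) (∏ i ∈ s, v i) := by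
  classical
  induction s using Finset.induction_on with
  | empty => simpa using one z
  | insert i s hi ih =>
    rw [prod_insert hi, prod_insert hi]
    exact (h i (mem_insert_self i s)).mul (ih fun j hj => h j (mem_insert_of_mem hj))

lemma one_sub_q_pow (z : ℂ) (k : ℕ) : HasValueAt z (1 - q ^ k) (1 - z ^ k) :=
  (one z).sub (q_pow z k)

lemma one_add_q_pow (z : ℂ) (k : ℕ) : HasValueAt z (1 + q ^ k) (1 + z ^ k) :=
  (one z).add (q_pow z k)

lemma fullProd (z : ℂ) (k : ℕ) : HasValueAt z (fullProd q k) (fullProd z k) :=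
  prod fun _ _ => one_sub_q_pow z _

lemma oddProd (z : ℂ) (k : ℕ) : HasValueAt z (oddProd q k) (oddProd z k) :=
  prod fun _ _ => one_sub_q_pow z _

lemma evenProd (z : ℂ) (k : ℕ) : HasValueAt z (evenProd q k) (evenProd z k) :=
  prod fun _ _ => one_sub_q_pow z _

end HasValueAt

lemma q_ne_zero : q ≠ 0 := RatFunc.X_ne_zero

lemma one_sub_q_pow_ne_zero (m : ℕ) (hm : 0 < m) : 1 - q ^ m ≠ 0 := by
  intro h
  have h1 : algebraMap ℚ[X] (RatFunc ℚ) (1 - X ^ m) = 0 := by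
    simpa [q, RatFunc.algebraMap_X] using h
  rw [FaithfulSMul.algebraMap_eq_zero_iff] at h1
  have h2 := congrArg (Polynomial.eval 0) h1
  simp [hm.ne'] at h2

/-- The rational function `f` behaves like `c (1 - q^d)^v` at `z`. -/
def HasLeading (z : ℂ) (d : ℕ) (f : RatFunc ℚ) (v : ℤ) (c : ℂ) : Prop :=
  HasValueAt z (f / (1 - q ^ d) ^ v) c

namespace HasLeading

variable {z : ℂ} {d : ℕ} {f g : RatFunc ℚ} {v w : ℤ} {c c' : ℂ}

lemma of_hasValueAt (d : ℕ) (h : HasValueAt z f c) : HasLeading z d f 0 c := by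
  simpa [HasLeading] using h

lemma add (hf : HasLeading z d f v c) (hg : HasLeading z d g v c') :
    HasLeading z d (f + g) v (c + c') := by
  rw [HasLeading, add_div]
  exact HasValueAt.add hf hg

lemma sub (hf : HasLeading z d f v c) (hg : HasLeading z d g v c') :
    HasLeading z d (f - g) v (c - c') := by
  rw [HasLeading, sub_div]
  exact HasValueAt.sub hf hg

lemma sum {ι : Type*} {s : Finset ι} {F : ι → RatFunc ℚ} {y : ι → ℂ}
    (h : ∀ i ∈ s, HasLeading z d (F i) v (y i)) :
    HasLeading z d (∑ i ∈ s, F i) v (∑ i ∈ s, y i) := by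
  rw [HasLeading, sum_div]
  exact HasValueAt.sum h

lemma inv (hf : HasLeading z d f v c) (hc : c ≠ 0) : HasLeading z d f⁻¹ (-v) c⁻¹ := by
  rw [HasLeading, show f⁻¹ / (1 - q ^ d) ^ (-v) = (f / (1 - q ^ d) ^ v)⁻¹ by
    rw [zpow_neg, inv_div, div_inv_eq_mul, inv_mul_eq_div]]
  exact HasValueAt.inv hf hc

variable [NeZero d]

lemma mul (hf : HasLeading z d f v c) (hg : HasLeading z d g w c') :
    HasLeading z d (f * g) (v + w) (c * c') := by
  rw [HasLeading, zpow_add₀ (one_sub_q_pow_ne_zero d (NeZero.pos d)), mul_div_mul_comm]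
  exact HasValueAt.mul hf hg

lemma div (hf : HasLeading z d f v c) (hg : HasLeading z d g w c') (hc : c' ≠ 0) :
    HasLeading z d (f / g) (v - w) (c / c') := by
  simpa [div_eq_mul_inv, sub_eq_add_neg] using hf.mul (hg.inv hc)

lemma pow (hf : HasLeading z d f v c) (k : ℕ) : HasLeading z d (f ^ k) (k * v) (c ^ k) := by
  induction k with
  | zero => simpa using of_hasValueAt d (HasValueAt.one z)
  | succ k ih =>
    rw [pow_succ, pow_succ, show ((k + 1 : ℕ) : ℤ) * v = k * v + v by push_cast; ring]
    exact ih.mul hf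

lemma one_sub_q_pow_self (z : ℂ) (d : ℕ) [NeZero d] : HasLeading z d (1 - q ^ d) 1 1 := by
  rw [HasLeading, zpow_one, div_self (one_sub_q_pow_ne_zero d (NeZero.pos d))]
  exact HasValueAt.one z

lemma one_sub_q_pow_mul (hz : z ^ d = 1) (t : ℕ) : HasLeading z d (1 - q ^ (d * t)) 1 t := by
  have h : 1 - q ^ (d * t) = (1 - q ^ d) * ∑ i ∈ range t, q ^ (d * i) := by
    simp only [pow_mul]
    exact (mul_neg_geom_sum _ _).symm
  rw [h]
  have h2 : HasValueAt z (∑ i ∈ range t, q ^ (d * i)) (∑ i ∈ range t, z ^ (d * i)) :=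
    HasValueAt.sum fun i _ => HasValueAt.q_pow z _
  simp only [pow_mul, hz, one_pow, sum_const, card_range, nsmul_eq_mul, mul_one] at h2
  simp only [← pow_mul] at h2
  simpa using (one_sub_q_pow_self z d).mul (of_hasValueAt d h2)

lemma hasValueAt_zero (hz : z ^ d = 1) (h : HasLeading z d f v c) (hv : 0 < v) :
    HasValueAt z f 0 := by
  obtain ⟨k, rfl⟩ : ∃ k : ℕ, v = (k + 1 : ℕ) := ⟨v.toNat - 1, by omega⟩
  have h1 : f = f / (1 - q ^ d) ^ ((k + 1 : ℕ) : ℤ) * (1 - q ^ d) ^ (k + 1) := by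
    rw [zpow_natCast, div_mul_cancel₀]
    exact pow_ne_zero _ (one_sub_q_pow_ne_zero d (NeZero.pos d))
  rw [h1]
  simpa [hz] using HasValueAt.mul h ((HasValueAt.one_sub_q_pow z d).pow (k + 1))

end HasLeading

lemma aeval_primitiveRoot_eq_zero_iff {z : ℂ} {d : ℕ} (hd : 0 < d) (hz : IsPrimitiveRoot z d)
    (p : ℚ[X]) : aeval z p = 0 ↔ cyclotomic d ℚ ∣ p := by
  rw [cyclotomic_eq_minpoly_rat hz hd, minpoly.dvd_iff]

/-- A rational function divisible by `(1 - q^d)^k` with quotient vanishing at a primitive root of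
order `d` has numerator divisible by `Φ_d(q)^{k+1}`. -/
lemma cyclotomic_pow_dvd_num {z : ℂ} {d : ℕ} [NeZero d] (hz : IsPrimitiveRoot z d)
    {f : RatFunc ℚ} {k : ℕ} (h : HasLeading z d f k 0) :
    cyclotomic d ℚ ^ (k + 1) ∣ f.num := by
  have hd := NeZero.pos d
  obtain ⟨a, b, hb, h1, h2⟩ := h
  rw [zero_mul, aeval_primitiveRoot_eq_zero_iff hd hz] at h2
  rw [Ne, aeval_primitiveRoot_eq_zero_iff hd hz] at hb
  have h3 : f.num * b = f.denom * ((1 - X ^ d) ^ k * a) := by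
    apply FaithfulSMul.algebraMap_injective ℚ[X] (RatFunc ℚ)
    have h4 : algebraMap ℚ[X] (RatFunc ℚ) (1 - X ^ d) = 1 - q ^ d := by
      simp [q, RatFunc.algebraMap_X]
    have h5 : algebraMap ℚ[X] (RatFunc ℚ) f.denom ≠ 0 := by
      rw [Ne, FaithfulSMul.algebraMap_eq_zero_iff]
      exact f.denom_ne_zero
    have h6 := one_sub_q_pow_ne_zero d hd
    rw [map_mul, map_mul, map_mul, map_pow, h4, ← h1, zpow_natCast]
    have h7 : algebraMap ℚ[X] (RatFunc ℚ) f.num = f * algebraMap ℚ[X] (RatFunc ℚ) f.denom := by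
      nth_rewrite 2 [← RatFunc.num_div_denom f]
      rw [div_mul_cancel₀ _ h5]
    rw [h7]
    field_simp
  have h4 : cyclotomic d ℚ ^ (k + 1) ∣ f.num * b := by
    rw [h3, pow_succ]
    refine Dvd.dvd.mul_left (mul_dvd_mul (pow_dvd_pow_of_dvd ?_ _) h2) _
    rw [← dvd_neg, neg_sub]
    exact cyclotomic.dvd_X_pow_sub_one d ℚ
  exact ((cyclotomic.irreducible_rat hd).coprime_iff_not_dvd.2 hb).pow_left.dvd_of_dvd_mul_right h4

end Values

section Orders

/-- The rational function `f` has order `v` with respect to `1 - q^d` at `z`. -/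
def HasOrder (z : ℂ) (d : ℕ) (f : RatFunc ℚ) (v : ℤ) : Prop := ∃ c ≠ 0, HasLeading z d f v c

variable {z : ℂ} {d : ℕ} [NeZero d] {f g : RatFunc ℚ} {v w : ℤ}

namespace HasOrder

lemma mul (hf : HasOrder z d f v) (hg : HasOrder z d g w) : HasOrder z d (f * g) (v + w) :=
  let ⟨_, h0, h⟩ := hf
  let ⟨_, h0', h'⟩ := hg
  ⟨_, mul_ne_zero h0 h0', h.mul h'⟩

lemma div (hf : HasOrder z d f v) (hg : HasOrder z d g w) : HasOrder z d (f / g) (v - w) :=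
  let ⟨_, h0, h⟩ := hf
  let ⟨_, h0', h'⟩ := hg
  ⟨_, div_ne_zero h0 h0', h.div h' h0'⟩

lemma pow (hf : HasOrder z d f v) (k : ℕ) : HasOrder z d (f ^ k) (k * v) :=
  let ⟨_, h0, h⟩ := hf
  ⟨_, pow_ne_zero _ h0, h.pow k⟩

omit [NeZero d] in
lemma of_hasValueAt {c : ℂ} (h : HasValueAt z f c) (hc : c ≠ 0) : HasOrder z d f 0 :=
  ⟨c, hc, .of_hasValueAt d h⟩

lemma hasValueAt_zero (hz : z ^ d = 1) (hf : HasOrder z d f v) (hv : 0 < v) :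
    HasValueAt z f 0 :=
  let ⟨_, _, h⟩ := hf
  h.hasValueAt_zero hz hv

end HasOrder

lemma hasOrder_q_pow (hz : IsPrimitiveRoot z d) (k : ℕ) : HasOrder z d (q ^ k) 0 :=
  .of_hasValueAt (HasValueAt.q_pow z k) (pow_ne_zero _ (hz.ne_zero (NeZero.ne d)))

lemma hasOrder_neg_one_pow (z : ℂ) (d : ℕ) [NeZero d] (k : ℕ) :
    HasOrder z d ((-1) ^ k) 0 :=
  .of_hasValueAt ((HasValueAt.one z).neg.pow k) (pow_ne_zero _ (by simp))

lemma hasOrder_one_sub_q_pow (hz : IsPrimitiveRoot z d) {k : ℕ} (hk : 0 < k) :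
    HasOrder z d (1 - q ^ k) (if d ∣ k then 1 else 0 : ℕ) := by
  split_ifs with h
  · obtain ⟨t, rfl⟩ := h
    refine ⟨t, ?_, HasLeading.one_sub_q_pow_mul hz.pow_eq_one t⟩
    rw [Nat.cast_ne_zero]
    rintro rfl
    simp at hk
  · refine .of_hasValueAt (HasValueAt.one_sub_q_pow z k) ?_
    rwa [sub_ne_zero, ne_comm, Ne, hz.pow_eq_one_iff_dvd]

omit [NeZero d] in
lemma one_add_pow_ne_zero (hd : Odd d) (hz : IsPrimitiveRoot z d) (k : ℕ) : 1 + z ^ k ≠ 0 := by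
  intro h
  have h1 : z ^ k = -1 := by linear_combination h
  have h2 : (z ^ k) ^ d = 1 := by rw [← pow_mul, mul_comm, pow_mul, hz.pow_eq_one, one_pow]
  rw [h1, hd.neg_one_pow] at h2
  norm_num at h2

omit [NeZero d] in
lemma hasOrder_one_add_q_pow (hd : Odd d) (hz : IsPrimitiveRoot z d) (k : ℕ) :
    HasOrder z d (1 + q ^ k) 0 :=
  .of_hasValueAt (HasValueAt.one_add_q_pow z k) (one_add_pow_ne_zero hd hz k)

lemma hasOrder_fullProd (hz : IsPrimitiveRoot z d) (k : ℕ) :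
    HasOrder z d (fullProd q k) (k / d : ℕ) := by
  induction k with
  | zero => simpa [fullProd] using hasOrder_q_pow hz 0
  | succ k ih =>
    rw [fullProd_succ, Nat.succ_div, Nat.cast_add]
    exact ih.mul (hasOrder_one_sub_q_pow hz k.succ_pos)

lemma hasOrder_evenProd (hd : Odd d) (hz : IsPrimitiveRoot z d) (k : ℕ) :
    HasOrder z d (evenProd q k) (k / d : ℕ) := by
  induction k with
  | zero => simpa [evenProd] using hasOrder_q_pow hz 0
  | succ k ih =>
    have h : d ∣ 2 * k + 2 ↔ d ∣ k + 1 := by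
      rw [show 2 * k + 2 = 2 * (k + 1) by ring]
      exact (Nat.coprime_two_right.2 hd).dvd_mul_left
    rw [evenProd_succ, Nat.succ_div, Nat.cast_add, ← if_congr h rfl rfl]
    exact ih.mul (hasOrder_one_sub_q_pow hz (by omega))

lemma hasOrder_oddProd (hd : Odd d) (hz : IsPrimitiveRoot z d) (k : ℕ) :
    HasOrder z d (oddProd q k) ((2 * k / d : ℕ) - (k / d : ℕ)) := by
  rw [← mul_div_cancel_right₀ (oddProd q k) (evenProd_ne_zero one_sub_q_pow_ne_zero k),
    ← fullProd_two_mul]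
  exact (hasOrder_fullProd hz _).div (hasOrder_evenProd hd hz k)

omit [NeZero d] in
lemma div_add_div_add_one {k s u : ℕ} (h : k + s + 1 = d * u) : k / d + s / d + 1 = u := by
  have h1 := Nat.mul_sub_div s d u (by omega)
  have h2 : s / d < u := Nat.div_lt_of_lt_mul (by omega)
  rw [← h, show k + s + 1 - (s + 1) = k by omega] at h1
  omega

lemma div_eq_add_div {k s u : ℕ} (h : k = d * u + s) : k / d = u + s / d := by
  rw [h, Nat.mul_add_div (NeZero.pos d)]

omit [NeZero d] in
lemma add_one_div_le (k : ℕ) : (k + 1) / d ≤ k / d + 1 := by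
  rw [Nat.succ_div]
  split_ifs <;> omega

lemma hasValueAt_residueBoundary_zero (hd : Odd d) (hz : IsPrimitiveRoot z d) {m t j : ℕ}
    (hm : 2 * m + 1 = d * t) (hj : j < m) :
    HasValueAt z (residueBoundary q j (2 * (m - j))) 0 := by
  obtain ⟨r, hr⟩ : ∃ r, r = 2 * (m - j) := ⟨_, rfl⟩
  rw [← hr]
  refine HasOrder.hasValueAt_zero hz.pow_eq_one ((((((((hasOrder_neg_one_pow z d _).mul
    (hasOrder_q_pow hz _)).mul (hasOrder_one_add_q_pow hd hz _)).mul
    (hasOrder_one_sub_q_pow hz (by omega))).mul (hasOrder_oddProd hd hz _)).mul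
    (hasOrder_oddProd hd hz _)).mul (hasOrder_oddProd hd hz _)).div
    ((((hasOrder_evenProd hd hz _).mul (hasOrder_fullProd hz _)).mul (hasOrder_fullProd hz _)).mul
      (hasOrder_q_pow hz _))) ?_
  rw [if_pos ⟨t, by omega⟩,
    div_eq_add_div (d := d) (k := 2 * (2 * j + r + 1)) (u := 2 * t) (s := 0) (by lia),
    div_eq_add_div (d := d) (k := 2 * j + r + 1) (u := t) (s := 0) (by lia),
    div_eq_add_div (d := d) (k := 2 * (3 * j + r + 1)) (u := 2 * t) (s := 2 * j) (by lia),
    div_eq_add_div (d := d) (k := 3 * j + r + 1) (u := t) (s := j) (by lia),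
    div_eq_add_div (d := d) (k := 4 * j + r + 2) (u := t) (s := 2 * j + 1) (by lia), Nat.zero_div]
  have h1 := div_add_div_add_one (d := d) (k := 2 * (j + r)) (u := 2 * t) (s := 2 * j + 1) (by lia)
  have h2 := div_add_div_add_one (d := d) (k := j + r) (u := t) (s := j) (by lia)
  have h3 := div_add_div_add_one (d := d) (k := 2 * j + r) (u := t) (s := 0) (by lia)
  have h4 := div_add_div_add_one (d := d) (k := r) (u := t) (s := 2 * j) (by lia)
  have h5 := add_one_div_le (d := d) (2 * j)
  rw [Nat.zero_div] at h3
  generalize 2 * (j + r) / d = a1 at *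
  generalize (j + r) / d = a2 at *
  generalize (2 * j + r) / d = a3 at *
  generalize r / d = a4 at *
  generalize (2 * j + 1) / d = a5 at *
  generalize (2 * j) / d = a6 at *
  generalize j / d = a7 at *
  omega

lemma hasValueAt_residueTerm_zero (hd : Odd d) (hz : IsPrimitiveRoot z d) {m t : ℕ}
    (hm : 2 * m + 1 = d * t) : HasValueAt z (residueTerm q m 0) 0 := by
  rw [residueTerm_self_zero_eq q_ne_zero one_sub_q_pow_ne_zero]
  refine HasOrder.hasValueAt_zero hz.pow_eq_one ((((hasOrder_neg_one_pow z d _).mul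
    (hasOrder_q_pow hz _)).div (hasOrder_q_pow hz _)).mul (((hasOrder_oddProd hd hz _).mul
    (hasOrder_oddProd hd hz _)).div ((hasOrder_evenProd hd hz _).pow 2))) ?_
  have h1 := div_add_div_add_one (d := d) (k := 2 * (3 * m + 1)) (u := 3 * t) (s := 0) (by lia)
  have h2 := div_add_div_add_one (d := d) (k := 2 * m) (u := t) (s := 0) (by lia)
  have h3 := div_add_div_add_one (d := d) (k := m) (u := t) (s := m) (by lia)
  rw [div_eq_add_div (d := d) (k := 3 * m + 1) (u := t) (s := m) (by lia)]
  rw [Nat.zero_div] at h1 h2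
  generalize 2 * (3 * m + 1) / d = a1 at *
  generalize (2 * m) / d = a2 at *
  generalize m / d = a3 at *
  push_cast
  omega

/-- At a root of unity of order a divisor of `n = 2m+1`, the series with parameter `q` vanishes. -/
lemma hasValueAt_sum_quadTerm_zero (hd : Odd d) (hz : IsPrimitiveRoot z d) {m t : ℕ}
    (hm : 2 * m + 1 = d * t) : HasValueAt z (∑ k ∈ range (2 * m + 1), quadTerm q q k) 0 := by
  simp_rw [quadTerm_self]
  rw [sum_residueTerm q_ne_zero one_sub_q_pow_ne_zero]
  have h1 := (HasValueAt.q_pow z m).mul (hasValueAt_residueTerm_zero hd hz hm)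
  have h2 : HasValueAt z (∑ j ∈ range m, q ^ j * residueBoundary q j (2 * (m - j)))
      (∑ j ∈ range m, z ^ j * 0) := HasValueAt.sum fun j hj =>
    (HasValueAt.q_pow z j).mul (hasValueAt_residueBoundary_zero hd hz hm (mem_range.1 hj))
  simpa using h1.add h2

/-- At a root of unity of order a divisor `d > 1` of `N + 1`, the boundary term for `a = q⁻¹`
vanishes. -/
lemma hasValueAt_shiftBoundary_inv_zero (hd : Odd d) (hz : IsPrimitiveRoot z d) {N t : ℕ}
    (hd1 : 1 < d) (hN : N + 1 = d * t) : HasValueAt z (shiftBoundary q q⁻¹ N) 0 := by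
  rw [shiftBoundary_inv q_ne_zero]
  refine HasOrder.hasValueAt_zero hz.pow_eq_one ((((((hasOrder_one_add_q_pow hd hz _).mul
    (hasOrder_oddProd hd hz _)).mul ((hasOrder_oddProd hd hz _).pow 2)).mul
    (hasOrder_q_pow hz _)).div (((hasOrder_evenProd hd hz _).mul
    ((hasOrder_fullProd hz _).pow 2)).mul
      ((hasOrder_q_pow hz _).mul (hasOrder_q_pow hz _))))) ?_
  rw [div_eq_add_div (d := d) (k := 2 * (N + 1)) (u := 2 * t) (s := 0) (by lia),
    div_eq_add_div (d := d) (k := N + 1) (u := t) (s := 0) (by lia), Nat.zero_div]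
  have h1 := div_add_div_add_one (d := d) (k := 2 * N) (u := 2 * t) (s := 1) (by lia)
  have h2 := div_add_div_add_one (d := d) (k := N) (u := t) (s := 0) (by lia)
  rw [Nat.div_eq_of_lt hd1] at h1
  rw [Nat.zero_div] at h2
  generalize 2 * N / d = a1 at *
  generalize N / d = a2 at *
  push_cast
  omega

/-- At a root of unity of order a divisor `d > 1` of `N + 3`, the boundary term for `a = q⁻³`
vanishes. -/
lemma hasValueAt_shiftBoundary_inv_cube_zero (hd : Odd d) (hz : IsPrimitiveRoot z d) {N t : ℕ}
    (hd1 : 1 < d) (hN : N + 3 = d * t) :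
    HasValueAt z (shiftBoundary q (q⁻¹ ^ 3) (N + 2)) 0 := by
  have h0 : HasOrder z d (1 - q) 0 := by
    have := hasOrder_one_sub_q_pow hz one_pos
    rwa [if_neg (by rw [Nat.dvd_one]; omega), pow_one] at this
  rw [shiftBoundary_inv_cube q_ne_zero]
  refine HasOrder.hasValueAt_zero hz.pow_eq_one ((((((hasOrder_one_add_q_pow hd hz _).mul
    (hasOrder_oddProd hd hz _)).mul ((h0.mul (hasOrder_oddProd hd hz _)).pow 2)).mul
    (hasOrder_q_pow hz _)).div (((hasOrder_evenProd hd hz _).mul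
    ((hasOrder_fullProd hz _).pow 2)).mul
      ((hasOrder_q_pow hz _).mul (hasOrder_q_pow hz _))))) ?_
  rw [div_eq_add_div (d := d) (k := 2 * (N + 3)) (u := 2 * t) (s := 0) (by lia),
    div_eq_add_div (d := d) (k := N + 3) (u := t) (s := 0) (by lia), Nat.zero_div]
  have h1 := div_add_div_add_one (d := d) (k := 2 * (N + 1)) (u := 2 * t) (s := 3) (by lia)
  have h2 := div_add_div_add_one (d := d) (k := N + 1) (u := t) (s := 1) (by lia)
  have h3 := div_add_div_add_one (d := d) (k := N + 2) (u := t) (s := 0) (by lia)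
  have h4 : 3 / d ≤ 1 := by
    have : 3 ≤ d := by
      rcases hd with ⟨e, rfl⟩
      omega
    exact Nat.div_le_of_le_mul (by omega)
  rw [Nat.div_eq_of_lt hd1] at h2
  rw [Nat.zero_div] at h3
  generalize 2 * (N + 1) / d = a1 at *
  generalize (N + 1) / d = a2 at *
  generalize (N + 2) / d = a3 at *
  generalize 3 / d = a4 at *
  push_cast
  omega

end Orders

section Limits

variable {z : ℂ} {m : ℕ}

lemma fullProd_primitiveRoot (hz : IsPrimitiveRoot z (2 * m + 1)) :
    fullProd z (2 * m) = (2 * m + 1 : ℕ) := by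
  have := hz.prod_one_sub_pow_eq_order
  simpa [fullProd] using this

lemma evenProd_primitiveRoot (hz : IsPrimitiveRoot z (2 * m + 1)) :
    evenProd z (2 * m) = (2 * m + 1 : ℕ) := by
  have h2 : IsPrimitiveRoot (z ^ 2) (2 * m + 1) := hz.pow_of_coprime _ (by simp)
  rw [← fullProd_primitiveRoot h2]
  exact prod_congr rfl fun i _ => by rw [← pow_mul, mul_add, mul_one]

lemma one_sub_pow_ne_zero (hz : IsPrimitiveRoot z (2 * m + 1)) {k : ℕ}
    (hk : ¬ (2 * m + 1) ∣ k) : 1 - z ^ k ≠ 0 := by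
  rwa [sub_ne_zero, ne_comm, Ne, hz.pow_eq_one_iff_dvd]

lemma one_sub_pow_ne_zero_of_lt (hz : IsPrimitiveRoot z (2 * m + 1)) {k : ℕ} (hk : 0 < k)
    (hk' : k < 2 * m + 1) : 1 - z ^ k ≠ 0 :=
  one_sub_pow_ne_zero hz (Nat.not_dvd_of_pos_of_lt hk hk')

lemma fullProd_primitiveRoot_ne_zero (hz : IsPrimitiveRoot z (2 * m + 1)) {k : ℕ}
    (hk : k ≤ 2 * m) : fullProd z k ≠ 0 :=
  prod_ne_zero_iff.2 fun i hi =>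
    one_sub_pow_ne_zero_of_lt hz (by omega) (by rw [mem_range] at hi; omega)

lemma oddProd_primitiveRoot_ne_zero (hz : IsPrimitiveRoot z (2 * m + 1)) {k : ℕ}
    (hk : k ≤ m) : oddProd z k ≠ 0 :=
  prod_ne_zero_iff.2 fun i hi =>
    one_sub_pow_ne_zero_of_lt hz (by omega) (by rw [mem_range] at hi; omega)

lemma pow_eq_inv_pow {k l : ℕ} (hz : IsPrimitiveRoot z (2 * m + 1)) (h : 2 * m + 1 ∣ k + l) :
    z ^ k = z⁻¹ ^ l := by
  rw [inv_pow]
  refine eq_inv_of_mul_eq_one_left ?_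
  rwa [← pow_add, hz.pow_eq_one_iff_dvd]

lemma cast_order_ne_zero (m : ℕ) : ((2 * m + 1 : ℕ) : ℂ) ≠ 0 := Nat.cast_ne_zero.2 (by omega)

lemma hasValueAt_fullProd_sub (hz : IsPrimitiveRoot z (2 * m + 1)) {k l : ℕ} (hkl : k + l = 2 * m) :
    HasValueAt z (fullProd q k) ((2 * m + 1 : ℕ) / fullProd z⁻¹ l) := by
  have h := HasValueAt.fullProd z k
  have h1 : fullProd z k * fullProd z⁻¹ l = (2 * m + 1 : ℕ) := by
    rw [← fullProd_primitiveRoot hz, ← hkl, fullProd_add]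
    congr 1
    rw [fullProd, ← prod_range_reflect]
    refine prod_congr rfl fun i hi => ?_
    rw [mem_range] at hi
    rw [pow_eq_inv_pow hz (k := k + (i + 1)) (l := l - 1 - i + 1) ⟨1, by omega⟩]
  rwa [← h1, mul_div_cancel_right₀]
  refine right_ne_zero_of_mul (a := fullProd z k) ?_
  rw [h1]
  exact cast_order_ne_zero m

lemma hasLeading_oddProd_order (hz : IsPrimitiveRoot z (2 * m + 1)) :
    HasLeading z (2 * m + 1) (oddProd q (2 * m + 1)) 1 (2 * m + 1 : ℕ) := by
  have h1 : ∏ i ∈ range m, (1 - z ^ (2 * (m + 1) + (2 * i + 1))) = evenProd z m :=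
    prod_congr rfl fun i _ => by
      rw [show 2 * (m + 1) + (2 * i + 1) = 2 * m + 1 + (2 * i + 2) by ring, pow_add, hz.pow_eq_one,
        one_mul]
  have h2 : HasValueAt z (∏ i ∈ range m, (1 - q ^ (2 * (m + 1) + (2 * i + 1)))) (evenProd z m) := by
    rw [← h1]
    exact HasValueAt.prod fun i _ => HasValueAt.one_sub_q_pow z _
  rw [show oddProd q (2 * m + 1) = oddProd q (m + 1 + m) by ring_nf, oddProd_add, oddProd_succ,
    ← fullProd_primitiveRoot hz, fullProd_two_mul]
  have := ((HasLeading.of_hasValueAt (2 * m + 1) (HasValueAt.oddProd z m)).mul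
    (HasLeading.one_sub_q_pow_self z _)).mul (HasLeading.of_hasValueAt _ h2)
  simpa using this

lemma hasLeading_oddProd_add (hz : IsPrimitiveRoot z (2 * m + 1)) (k : ℕ) :
    HasLeading z (2 * m + 1) (oddProd q (2 * m + 1 + k)) 1 ((2 * m + 1 : ℕ) * oddProd z k) := by
  rw [oddProd_add]
  have h : HasValueAt z (∏ i ∈ range k, (1 - q ^ (2 * (2 * m + 1) + (2 * i + 1))))
      (oddProd z k) := by
    have : oddProd z k = ∏ i ∈ range k, (1 - z ^ (2 * (2 * m + 1) + (2 * i + 1))) :=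
      prod_congr rfl fun i _ => by
        rw [pow_add z (2 * (2 * m + 1)), mul_comm 2 (2 * m + 1), pow_mul, hz.pow_eq_one, one_pow,
          one_mul]
    rw [this]
    exact HasValueAt.prod fun i _ => HasValueAt.one_sub_q_pow z _
  simpa using (hasLeading_oddProd_order hz).mul (HasLeading.of_hasValueAt _ h)

lemma oddProd_inv_primitiveRoot_ne_zero (hz : IsPrimitiveRoot z (2 * m + 1)) {k : ℕ}
    (hk : k ≤ m) : oddProd z⁻¹ k ≠ 0 :=
  oddProd_primitiveRoot_ne_zero hz.inv hk

lemma hasLeading_oddProd_sub (hz : IsPrimitiveRoot z (2 * m + 1)) {k l : ℕ}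
    (hkl : k + l = 2 * m + 1) (hl : l ≤ m) :
    HasLeading z (2 * m + 1) (oddProd q k) 1 ((2 * m + 1 : ℕ) / oddProd z⁻¹ l) := by
  have h : HasValueAt z (∏ i ∈ range l, (1 - q ^ (2 * k + (2 * i + 1)))) (oddProd z⁻¹ l) := by
    have : oddProd z⁻¹ l = ∏ i ∈ range l, (1 - z ^ (2 * k + (2 * i + 1))) := by
      rw [oddProd, ← prod_range_reflect]
      refine prod_congr rfl fun i hi => ?_
      rw [mem_range] at hi
      rw [pow_eq_inv_pow hz (k := 2 * k + (2 * i + 1)) (l := 2 * (l - 1 - i) + 1) ⟨2, by omega⟩]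
    rw [this]
    exact HasValueAt.prod fun i _ => HasValueAt.one_sub_q_pow z _
  have h0 := oddProd_inv_primitiveRoot_ne_zero hz hl
  have h1 := (hasLeading_oddProd_order hz).div (HasLeading.of_hasValueAt _ h) h0
  have h2 : ∏ i ∈ range l, (1 - q ^ (2 * k + (2 * i + 1))) ≠ 0 :=
    prod_ne_zero_iff.2 fun i _ => one_sub_q_pow_ne_zero _ (by omega)
  rw [show oddProd q (2 * m + 1) = oddProd q (k + l) by rw [hkl], oddProd_add,
    mul_div_cancel_right₀ _ h2] at h1
  simpa using h1

lemma hasLeading_fullProd_add (hz : IsPrimitiveRoot z (2 * m + 1)) (k : ℕ) :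
    HasLeading z (2 * m + 1) (fullProd q (2 * m + 1 + k)) 1 ((2 * m + 1 : ℕ) * fullProd z k) := by
  have h : HasValueAt z (∏ i ∈ range k, (1 - q ^ (2 * m + 1 + (i + 1)))) (fullProd z k) := by
    have : fullProd z k = ∏ i ∈ range k, (1 - z ^ (2 * m + 1 + (i + 1))) :=
      prod_congr rfl fun i _ => by rw [pow_add z (2 * m + 1), hz.pow_eq_one, one_mul]
    rw [this]
    exact HasValueAt.prod fun i _ => HasValueAt.one_sub_q_pow z _
  rw [fullProd_add, fullProd_succ]
  have h1 := HasValueAt.fullProd z (2 * m)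
  rw [fullProd_primitiveRoot hz] at h1
  simpa using ((HasLeading.of_hasValueAt (2 * m + 1) h1).mul
    (HasLeading.one_sub_q_pow_self z (2 * m + 1))).mul (HasLeading.of_hasValueAt _ h)

lemma hasLeading_residueBoundary (hz : IsPrimitiveRoot z (2 * m + 1)) {j : ℕ} (hj : j < m) :
    HasLeading z (2 * m + 1) (residueBoundary q j (2 * (m - j))) 3
      (-(z * (1 + z ^ (2 * j + 1)) / (1 - z ^ (2 * j + 1)) ^ 2)) := by
  obtain ⟨r, hr⟩ : ∃ r, r = 2 * (m - j) := ⟨_, rfl⟩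
  rw [← hr, residueBoundary]
  have hz0 : z ≠ 0 := hz.ne_zero (by omega)
  rw [show 2 * j + r + 1 = 2 * m + 1 by omega, show 3 * j + r + 1 = 2 * m + 1 + j by omega,
    show 2 * j + r = 2 * m by omega, show 4 * j + r + 2 = 2 * m + 1 + (2 * j + 1) by omega]
  have hn := cast_order_ne_zero m
  have ho : 1 - z ^ (2 * j + 1) ≠ 0 := one_sub_pow_ne_zero_of_lt hz (by omega) (by omega)
  have hF := fullProd_primitiveRoot_ne_zero hz (k := 2 * j) (by omega)
  have hFi := fullProd_primitiveRoot_ne_zero hz.inv (k := 2 * j) (by omega)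
  have hO := oddProd_primitiveRoot_ne_zero hz (k := j) (by omega)
  have hOi := oddProd_inv_primitiveRoot_ne_zero hz (k := j + 1) (by omega)
  have hc : z ^ Nat.choose (2 * m + 1) 2 = 1 := by
    rw [hz.pow_eq_one_iff_dvd, Nat.choose_two_right, Nat.add_sub_cancel, Nat.mul_div_assoc]
    · exact Dvd.intro _ rfl
    · exact Dvd.intro _ rfl
  have hE := HasValueAt.evenProd z (2 * m)
  rw [evenProd_primitiveRoot hz] at hE
  have hq := HasValueAt.q_pow z (Nat.choose (2 * m + 1) 2)
  rw [hc] at hq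
  have key := ((((((HasLeading.of_hasValueAt (2 * m + 1) (((HasValueAt.one z).neg.pow j).mul
    (HasValueAt.q_pow z (2 * Nat.choose j 2)))).mul
    (HasLeading.of_hasValueAt _ (HasValueAt.one_add_q_pow z (2 * j + 1)))).mul
    (HasLeading.one_sub_q_pow_self z _)).mul (hasLeading_oddProd_order hz)).mul
    (hasLeading_oddProd_add hz j)).mul
    (hasLeading_oddProd_sub hz (k := j + r) (l := j + 1) (by omega) (by omega))).div
    ((((HasLeading.of_hasValueAt _ hE).mul (HasLeading.of_hasValueAt _
    (hasValueAt_fullProd_sub hz (k := r) (l := 2 * j) (by omega)))).mul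
    (hasLeading_fullProd_add hz (2 * j + 1))).mul (HasLeading.of_hasValueAt _ hq)) (by
      rw [fullProd_succ]
      simp only [mul_one]
      exact mul_ne_zero (mul_ne_zero hn (div_ne_zero hn hFi)) (mul_ne_zero hn (mul_ne_zero hF ho)))
  convert key using 1
  · norm_num
  have e1 := fullProd_inv hz0 (2 * j)
  have e2 := oddProd_inv hz0 (j + 1)
  have e3 : z ^ (2 * j.choose 2) * z ^ (j + 1) ^ 2 = z * z ^ (2 * j + 1).choose 2 := by
    rw [← pow_add, ← pow_succ']
    congr 1
    have e1 := two_mul_choose_two_add j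
    have e2 := two_mul_choose_two_add (2 * j + 1)
    nlinarith
  have hz1 : z ^ (j + 1) ^ 2 ≠ 0 := pow_ne_zero _ hz0
  have hz2 : z ^ (2 * j + 1).choose 2 ≠ 0 := pow_ne_zero _ hz0
  have hs : ((-1 : ℂ) ^ j) ^ 2 = 1 := by rw [← pow_mul, mul_comm, pow_mul]; simp
  rw [pow_mul, neg_one_sq, one_pow, one_mul] at e1
  rw [oddProd_succ z j, pow_succ (-1 : ℂ)] at e2
  rw [fullProd_succ]
  generalize ((2 * m + 1 : ℕ) : ℂ) = n at *
  generalize z ^ (2 * j + 1).choose 2 = A at *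
  generalize z ^ (j + 1) ^ 2 = B at *
  generalize z ^ (2 * j.choose 2) = C at *
  generalize (-1 : ℂ) ^ j = s at *
  generalize fullProd z⁻¹ (2 * j) = Fi at *
  generalize oddProd z⁻¹ (j + 1) = Oi at *
  have hs0 : s ≠ 0 := fun h => by simp [h] at hs
  obtain ⟨u, hu⟩ : ∃ u, u = 1 - z ^ (2 * j + 1) := ⟨_, rfl⟩
  rw [← hu] at e2 ho ⊢
  rw [← eq_div_iff hz2] at e1
  rw [← eq_div_iff hz1] at e2
  rw [e1, e2]
  field_simp
  linear_combination (1 + z ^ (2 * j + 1)) * e3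

end Limits

section Expansion

variable {z : ℂ} {m : ℕ}

lemma hasLeading_shiftBoundary_inv (hz : IsPrimitiveRoot z (2 * m + 1)) (hm : 1 ≤ m) :
    HasLeading z (2 * m + 1) (shiftBoundary q q⁻¹ (2 * m)) 3 (z * (1 + z) / (1 - z) ^ 2) := by
  have hz0 : z ≠ 0 := hz.ne_zero (by omega)
  have hn := cast_order_ne_zero m
  have h1 : 1 - z⁻¹ ≠ 0 := by
    simpa using one_sub_pow_ne_zero_of_lt hz.inv one_pos (by omega)
  have h2 : 1 - z ≠ 0 := by
    simpa using one_sub_pow_ne_zero_of_lt hz one_pos (by omega)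
  have hO : oddProd z⁻¹ 1 = 1 - z⁻¹ := by simp [oddProd]
  have hN : z ^ (2 * m) = z⁻¹ := by
    simpa using pow_eq_inv_pow hz (k := 2 * m) (l := 1) ⟨1, by ring⟩
  have hc : z ^ Nat.choose (2 * m) 2 * z ^ (2 * (2 * m)) = z⁻¹ := by
    rw [← hN, ← pow_add]
    have e2 := two_mul_choose_two_add (2 * m)
    rw [← mul_one (z ^ (2 * m)), show Nat.choose (2 * m) 2 + 2 * (2 * m) =
      2 * m + (2 * m + 1) * m by nlinarith, pow_add, pow_mul z (2 * m + 1), hz.pow_eq_one, one_pow]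
  have hE := HasValueAt.evenProd z (2 * m)
  rw [evenProd_primitiveRoot hz] at hE
  have hF := HasValueAt.fullProd z (2 * m)
  rw [fullProd_primitiveRoot hz] at hF
  have key := ((((HasLeading.of_hasValueAt (2 * m + 1) (HasValueAt.one_add_q_pow z (2 * m))).mul
    (hasLeading_oddProd_order hz)).mul
    ((hasLeading_oddProd_sub hz (k := 2 * m) (l := 1) (by omega) hm).pow 2)).mul
    (HasLeading.of_hasValueAt _ (HasValueAt.q_pow z (2 * m)))).div
    (HasLeading.of_hasValueAt _ ((hE.mul (hF.pow 2)).mul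
      ((HasValueAt.q_pow z (Nat.choose (2 * m) 2)).mul (HasValueAt.q_pow z (2 * (2 * m))))))
    (mul_ne_zero (mul_ne_zero hn (pow_ne_zero _ hn))
      (mul_ne_zero (pow_ne_zero _ hz0) (pow_ne_zero _ hz0)))
  rw [shiftBoundary_inv q_ne_zero]
  convert key using 1
  · norm_num
  rw [hc, hN, hO]
  generalize ((2 * m + 1 : ℕ) : ℂ) = n at *
  have h3 : 1 - z⁻¹ = -(1 - z) / z := by
    field_simp
    ring
  rw [h3]
  field_simp
  ring

lemma hasLeading_shiftBoundary_inv_cube (hz : IsPrimitiveRoot z (2 * m + 1)) (hm : 2 ≤ m) :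
    HasLeading z (2 * m + 1) (shiftBoundary q (q⁻¹ ^ 3) (2 * m)) 3
      (z * (1 + z ^ 3) / (1 - z ^ 3) ^ 2) := by
  have hz0 : z ≠ 0 := hz.ne_zero (by omega)
  have hn := cast_order_ne_zero m
  have h2 : 1 - z ≠ 0 := by
    simpa using one_sub_pow_ne_zero_of_lt hz one_pos (by omega)
  have h4 : 1 - z ^ 3 ≠ 0 := one_sub_pow_ne_zero_of_lt hz (by omega) (by omega)
  have hO : oddProd z⁻¹ 2 = (1 - z⁻¹) * (1 - z⁻¹ ^ 3) := by simp [oddProd, prod_range_succ]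
  have hc : z ^ Nat.choose (2 * m) 2 * z ^ (2 * (2 * m)) = z⁻¹ ^ 1 := by
    rw [← pow_eq_inv_pow hz (k := 2 * m) (l := 1) ⟨1, by ring⟩, ← pow_add]
    have e2 := two_mul_choose_two_add (2 * m)
    rw [← mul_one (z ^ (2 * m)), show Nat.choose (2 * m) 2 + 2 * (2 * m) =
      2 * m + (2 * m + 1) * m by nlinarith, pow_add, pow_mul z (2 * m + 1), hz.pow_eq_one, one_pow]
  have hE := HasValueAt.evenProd z (2 * m)
  rw [evenProd_primitiveRoot hz] at hE
  have hF := HasValueAt.fullProd z (2 * m)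
  rw [fullProd_primitiveRoot hz] at hF
  obtain ⟨l, hl⟩ : ∃ l, 2 * m = l + 2 := ⟨2 * m - 2, by omega⟩
  have hN : z ^ l = z⁻¹ ^ 3 := pow_eq_inv_pow hz (k := l) (l := 3) ⟨1, by omega⟩
  have hN' : z ^ (3 * l + 4) = z⁻¹ ^ 5 :=
    pow_eq_inv_pow hz (k := 3 * l + 4) (l := 5) ⟨3, by omega⟩
  have h5 := HasValueAt.one_sub_q_pow z 1
  rw [pow_one, pow_one] at h5
  have h7 : shiftBoundary q (q⁻¹ ^ 3) (2 * m) = (1 + q ^ l) * oddProd q (2 * m + 1) *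
      ((1 - q) * oddProd q (l + 1)) ^ 2 * q ^ (3 * l + 4) /
      (evenProd q (2 * m) * fullProd q (2 * m) ^ 2 * (q ^ (2 * m).choose 2 * q ^ (2 * (2 * m)))) := by
    rw [hl, shiftBoundary_inv_cube q_ne_zero]
  have key := ((((HasLeading.of_hasValueAt (2 * m + 1) (HasValueAt.one_add_q_pow z l)).mul
    (hasLeading_oddProd_order hz)).mul
    (((HasLeading.of_hasValueAt _ h5).mul
      (hasLeading_oddProd_sub hz (k := l + 1) (l := 2) (by omega) hm)).pow 2)).mul
    (HasLeading.of_hasValueAt _ (HasValueAt.q_pow z (3 * l + 4)))).div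
    (HasLeading.of_hasValueAt _ ((hE.mul (hF.pow 2)).mul
      ((HasValueAt.q_pow z (Nat.choose (2 * m) 2)).mul (HasValueAt.q_pow z (2 * (2 * m))))))
    (mul_ne_zero (mul_ne_zero hn (pow_ne_zero _ hn))
      (mul_ne_zero (pow_ne_zero _ hz0) (pow_ne_zero _ hz0)))
  rw [h7]
  convert key using 1
  · norm_num
  rw [hc, hN, hN', hO]
  generalize ((2 * m + 1 : ℕ) : ℂ) = n at *
  have h3 : 1 - z⁻¹ = -(1 - z) / z := by
    field_simp
    ring
  have h3' : 1 - z⁻¹ ^ 3 = -(1 - z ^ 3) / z ^ 3 := by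
    field_simp
    ring
  rw [h3, h3']
  obtain ⟨u, hu⟩ : ∃ u, u = 1 - z ^ 3 := ⟨_, rfl⟩
  rw [← hu] at h4 ⊢
  field_simp
  ring

lemma HasValueAt.ne_zero {f : RatFunc ℚ} {c : ℂ} (h : HasValueAt z f c) (hc : c ≠ 0) : f ≠ 0 := by
  rintro rfl
  obtain ⟨a, b, hb, h1, h2⟩ := h
  rw [zero_mul, eq_comm, FaithfulSMul.algebraMap_eq_zero_iff] at h1
  rw [h1, map_zero, eq_comm] at h2
  exact mul_ne_zero hc hb h2

namespace HasLeading

variable {d : ℕ} [NeZero d] {f g : RatFunc ℚ} {c c' : ℂ} {v : ℤ}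

lemma hasValueAt_one (hz : z ^ d = 1) (hf : HasLeading z d (f - 1) v c) (hv : 0 < v) :
    HasValueAt z f 1 := by
  simpa using (hf.hasValueAt_zero hz hv).add (HasValueAt.one z)

lemma mul_sub_one (hz : z ^ d = 1) (hf : HasLeading z d (f - 1) v c)
    (hg : HasLeading z d (g - 1) v c') (hv : 0 < v) : HasLeading z d (f * g - 1) v (c + c') := by
  rw [show f * g - 1 = (f - 1) * g + (g - 1) by ring]
  simpa using (hf.mul (of_hasValueAt d (hg.hasValueAt_one hz hv))).add (by simpa using hg)

lemma inv_sub_one (hz : z ^ d = 1) (hf : HasLeading z d (f - 1) v c) (hv : 0 < v) :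
    HasLeading z d (f⁻¹ - 1) v (-c) := by
  have h1 := hf.hasValueAt_one hz hv
  have h0 := h1.ne_zero one_ne_zero
  rw [show f⁻¹ - 1 = -1 * ((f - 1) * f⁻¹) by
    field_simp
    ring]
  simpa using (of_hasValueAt d (HasValueAt.one z).neg).mul
    (hf.mul (of_hasValueAt d (h1.inv one_ne_zero)))

lemma prod_sub_one (hz : z ^ d = 1) (hv : 0 < v) {F : ℕ → RatFunc ℚ} {y : ℕ → ℂ} {N : ℕ}
    (h : ∀ i < N, HasLeading z d (F i - 1) v (y i)) :
    HasLeading z d (∏ i ∈ range N, F i - 1) v (∑ i ∈ range N, y i) := by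
  induction N with
  | zero => simpa [HasLeading] using HasValueAt.zero z
  | succ N ih =>
    rw [prod_range_succ, sum_range_succ]
    exact (ih fun i hi => h i (by omega)).mul_sub_one hz (h N (by omega)) hv

end HasLeading

lemma hasValueAt_squareRatio {k : ℕ} (h : 1 - z ^ k ≠ 0) :
    HasValueAt z (squareRatio q k) (squareRatio z k) :=
  (HasValueAt.q_pow z k).div ((HasValueAt.one_sub_q_pow z k).pow 2) (pow_ne_zero _ h)

lemma hasLeading_ratioProd_sub_one (hz : IsPrimitiveRoot z (2 * m + 1)) :
    HasLeading z (2 * m + 1) (ratioProd q (2 * m + 1) m - 1) 2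
      (((2 * m + 1 : ℕ) ^ 2 - 1) / 12) := by
  have hz0 : z ≠ 0 := hz.ne_zero (by omega)
  have hz1 := hz.pow_eq_one
  have h1 : ∀ j < m, HasLeading z (2 * m + 1)
      ((1 - (1 - q ^ (2 * (2 * m + 1))) ^ 2 / q ^ (2 * (2 * m + 1)) * squareRatio q (2 * j + 1)) *
        ((1 - (1 - q ^ (2 * m + 1)) ^ 2 / q ^ (2 * m + 1) * squareRatio q (2 * j + 1))⁻¹) ^ 2 - 1) 2
      (-2 * squareRatio z (2 * j + 1)) := by
    intro j hj
    have hw := HasLeading.of_hasValueAt (2 * m + 1) (hasValueAt_squareRatio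
      (one_sub_pow_ne_zero_of_lt hz (k := 2 * j + 1) (by omega) (by omega)))
    have hA := (((((HasLeading.one_sub_q_pow_mul hz1 2).pow 2).div
      (HasLeading.of_hasValueAt _ (HasValueAt.q_pow z ((2 * m + 1) * 2)))
      (pow_ne_zero _ hz0)).mul hw).mul (HasLeading.of_hasValueAt _ (HasValueAt.one z).neg))
    have hB := (((((HasLeading.one_sub_q_pow_self z (2 * m + 1)).pow 2).div
      (HasLeading.of_hasValueAt _ (HasValueAt.q_pow z (2 * m + 1)))
      (pow_ne_zero _ hz0)).mul hw).mul (HasLeading.of_hasValueAt _ (HasValueAt.one z).neg))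
    rw [mul_comm 2 (2 * m + 1)]
    rw [pow_mul z, hz1] at hA
    rw [hz1] at hB
    norm_num at hA hB
    rw [← sub_sub_cancel_left 1] at hA hB
    have hB' := hB.inv_sub_one hz1 two_pos
    rw [sq]
    convert hA.mul_sub_one hz1 (hB'.mul_sub_one hz1 hB' two_pos) two_pos using 1 <;> ring
  convert HasLeading.prod_sub_one hz1 two_pos h1 using 1
  · rfl
  rw [← mul_sum, sum_squareRatio_odd hz]
  ring

/-- The expansion of the series with parameter `q` to third order at a primitive root of unity. -/
lemma hasLeading_sum_quadTerm (hz : IsPrimitiveRoot z (2 * m + 1)) :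
    HasLeading z (2 * m + 1) (∑ k ∈ range (2 * m + 1), quadTerm q q k -
      (1 - q ^ (2 * m + 1)) / q ^ m -
      (((2 * m + 1 : ℕ) : RatFunc ℚ) ^ 2 - 1) / 24 * (1 - q ^ (2 * m + 1)) ^ 3 / q ^ m) 3 0 := by
  have hz0 : z ≠ 0 := hz.ne_zero (by omega)
  simp_rw [quadTerm_self]
  rw [sum_residueTerm q_ne_zero one_sub_q_pow_ne_zero,
    residueTerm_self_zero q_ne_zero one_sub_q_pow_ne_zero]
  have hc := HasValueAt.const z (((2 * m + 1 : ℕ) ^ 2 - 1) / 24)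
  have hε := HasLeading.one_sub_q_pow_self z (2 * m + 1)
  have hm := HasLeading.of_hasValueAt (2 * m + 1) (HasValueAt.q_pow z m)
  have hm0 : z ^ m ≠ 0 := pow_ne_zero _ hz0
  have h1 := (hε.div hm hm0).mul (hasLeading_ratioProd_sub_one hz)
  have h2 : HasLeading z (2 * m + 1) (∑ j ∈ range m, q ^ j * residueBoundary q j (2 * (m - j))) 3
      (∑ j ∈ range m, z ^ j * -(z * (1 + z ^ (2 * j + 1)) / (1 - z ^ (2 * j + 1)) ^ 2)) :=
    HasLeading.sum fun j hj => by
      simpa using (HasLeading.of_hasValueAt (2 * m + 1) (HasValueAt.q_pow z j)).mul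
        (hasLeading_residueBoundary hz (mem_range.1 hj))
  have h3 := ((HasLeading.of_hasValueAt (2 * m + 1) hc).mul (hε.pow 3)).div hm hm0
  have hp : 1 / z ^ m = z ^ (m + 1) := by
    rw [div_eq_iff hm0, ← pow_add, show m + 1 + m = 2 * m + 1 by ring, hz.pow_eq_one]
  norm_num at h1 h3
  convert (h1.add h2).sub h3 using 1
  · push_cast
    ring
  · simp_rw [mul_neg, sum_neg_distrib]
    rw [sum_pow_mul_one_add_div hz, ← hp]
    push_cast
    field_simp
    ring

end Expansion

section Assembly

lemma qpoch_q (k : ℕ) : qpoch q q k = fullProd q k :=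
  prod_congr rfl fun i _ => by ring

lemma qpoch_q_sq (k : ℕ) : qpoch q (q ^ 2) k = oddProd q k :=
  prod_congr rfl fun i _ => by ring

lemma qpoch_sq_sq (k : ℕ) : qpoch (q ^ 2) (q ^ 2) k = evenProd q k :=
  prod_congr rfl fun i _ => by ring

lemma qpoch_sq (a : RatFunc ℚ) (k : ℕ) : qpoch a (q ^ 2) k = stepProd q a k :=
  prod_congr rfl fun i _ => by ring

lemma two_mul_choose_two_add_self (k : ℕ) : 2 * k.choose 2 + k = k ^ 2 := by
  induction k with
  | zero => rfl
  | succ k ih =>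
    rw [choose_two_succ]
    linarith

lemma qint_mul_eq_quadTerm_div (k : ℕ) :
    qint (3 * (k : ℤ) - 3) *
        (qpoch q (q ^ 2) k * (qpoch (q ^ (-3 : ℤ)) (q ^ 2) k) ^ 2 /
          ((qpoch q q k) ^ 2 * qpoch (q ^ 2) (q ^ 2) k)) *
        q ^ ((7 * (k : ℤ) - (k : ℤ) ^ 2) / 2) = quadTerm q (q⁻¹ ^ 3) k / (1 - q) := by
  have hq := q_ne_zero
  have h3 : q ^ (-3 : ℤ) = q⁻¹ ^ 3 := by
    rw [zpow_neg, inv_pow]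
    rfl
  have h1 : q ^ (3 * (k : ℤ) - 3) = q⁻¹ ^ 3 * q ^ (3 * k) := by
    rw [sub_eq_add_neg, zpow_add₀ hq, h3, mul_comm]
    norm_cast
  have h2 : q ^ ((7 * (k : ℤ) - (k : ℤ) ^ 2) / 2) = ((q⁻¹ ^ 3) ^ k * q ^ k.choose 2)⁻¹ := by
    have h4 : (7 * (k : ℤ) - (k : ℤ) ^ 2) / 2 = 3 * k - k.choose 2 := by
      have h5 : (2 * k.choose 2 + k : ℤ) = (k : ℤ) ^ 2 := mod_cast two_mul_choose_two_add_self k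
      omega
    rw [h4, zpow_sub₀ hq, mul_inv, ← pow_mul, inv_pow, inv_inv, div_eq_mul_inv]
    norm_cast
  rw [qint, h1, h2, h3, qpoch_q_sq, qpoch_sq_sq, qpoch_sq, qpoch_q, quadTerm]
  ring

lemma zpow_neg_half (m : ℕ) : q ^ (-((((2 * m + 1 : ℕ) : ℤ) + 3) / 2)) = (q ^ (m + 2))⁻¹ := by
  rw [show (((2 * m + 1 : ℕ) : ℤ) + 3) / 2 = ((m + 2 : ℕ) : ℤ) by push_cast; omega, zpow_neg,
    zpow_natCast]

lemma qint_natCast (n : ℕ) : qint n = (1 - q ^ n) / (1 - q) := by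
  rw [qint, zpow_natCast]

lemma sum_quadTerm_inv_cube (m : ℕ) :
    q ^ 2 * ∑ k ∈ range (2 * m + 1), quadTerm q (q⁻¹ ^ 3) k =
      ∑ k ∈ range (2 * m + 1), quadTerm q q k - shiftBoundary q q⁻¹ (2 * m) -
        q * shiftBoundary q (q⁻¹ ^ 3) (2 * m) := by
  have hq := q_ne_zero
  have h1 := sum_quadTerm_shift hq (inv_ne_zero hq) one_sub_q_pow_ne_zero (2 * m)
  have h3 := sum_quadTerm_shift hq (pow_ne_zero 3 (inv_ne_zero hq)) one_sub_q_pow_ne_zero (2 * m)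
  rw [show q⁻¹ * q ^ 2 = q by field_simp] at h1
  rw [show q⁻¹ ^ 3 * q ^ 2 = q⁻¹ by field_simp] at h3
  linear_combination -h1 - q * h3

/-- The three defects which make up the difference of the two sides of the congruence. -/
noncomputable def defect (m : ℕ) : RatFunc ℚ :=
  (∑ k ∈ range (2 * m + 1), quadTerm q q k - (1 - q ^ (2 * m + 1)) / q ^ m -
      (((2 * m + 1 : ℕ) : RatFunc ℚ) ^ 2 - 1) / 24 * (1 - q ^ (2 * m + 1)) ^ 3 / q ^ m) -
    (shiftBoundary q q⁻¹ (2 * m) -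
      q ^ 1 * (1 + q ^ 1) / (1 - q ^ 1) ^ 2 * (1 - q ^ (2 * m + 1)) ^ 3) -
    q ^ 1 * (shiftBoundary q (q⁻¹ ^ 3) (2 * m) -
      q ^ 1 * (1 + q ^ 3) / (1 - q ^ 3) ^ 2 * (1 - q ^ (2 * m + 1)) ^ 3)

lemma sum_sub_eq_defect_div (m : ℕ) :
    ∑ k ∈ range (2 * m + 1), quadTerm q (q⁻¹ ^ 3) k / (1 - q) -
      (qint (2 * m + 1 : ℕ) * q ^ (-((((2 * m + 1 : ℕ) : ℤ) + 3) / 2)) -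
        (1 + q) / q * (qint (2 * m + 1 : ℕ)) ^ 3 -
        (1 + q ^ 3) / (1 + q + q ^ 2) ^ 2 * (qint (2 * m + 1 : ℕ)) ^ 3 +
        (((2 * m + 1 : ℕ) : RatFunc ℚ) ^ 2 - 1) * (1 - q) ^ 2 / 24 * (qint (2 * m + 1 : ℕ)) ^ 3 *
          q ^ (-((((2 * m + 1 : ℕ) : ℤ) + 3) / 2))) =
    defect m / (q ^ 2 * (1 - q ^ 1)) := by
  have hq := q_ne_zero
  have h1 : 1 - q ≠ 0 := by simpa using one_sub_q_pow_ne_zero 1 one_pos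
  have h3 : 1 - q ^ 3 = (1 - q) * (1 + q + q ^ 2) := by ring
  have h3' : 1 + q + q ^ 2 ≠ 0 := right_ne_zero_of_mul (h3 ▸ one_sub_q_pow_ne_zero 3 three_pos)
  rw [zpow_neg_half, qint_natCast, ← sum_div, defect, h3, pow_one,
    ← mul_div_mul_left _ _ (pow_ne_zero 2 hq), sum_quadTerm_inv_cube]
  generalize ∑ k ∈ range (2 * m + 1), quadTerm q q k = s
  generalize shiftBoundary q q⁻¹ (2 * m) = b
  generalize shiftBoundary q (q⁻¹ ^ 3) (2 * m) = b'
  generalize 1 - q ^ (2 * m + 1) = e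
  field_simp
  ring

lemma hasLeading_defect {z : ℂ} {m : ℕ} (hz : IsPrimitiveRoot z (2 * m + 1)) (hm : 2 ≤ m) :
    HasLeading z (2 * m + 1) (defect m) 3 0 := by
  have h1 : 1 - z ^ 1 ≠ 0 := one_sub_pow_ne_zero_of_lt hz one_pos (by omega)
  have h3 : 1 - z ^ 3 ≠ 0 := one_sub_pow_ne_zero_of_lt hz three_pos (by omega)
  have hε := (HasLeading.one_sub_q_pow_self z (2 * m + 1)).pow 3
  have hq := HasValueAt.q_pow z 1
  have hB := (HasLeading.of_hasValueAt (2 * m + 1) ((hq.mul (HasValueAt.one_add_q_pow z 1)).div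
    ((HasValueAt.one_sub_q_pow z 1).pow 2) (pow_ne_zero 2 h1))).mul hε
  have hC := (HasLeading.of_hasValueAt (2 * m + 1) ((hq.mul (HasValueAt.one_add_q_pow z 3)).div
    ((HasValueAt.one_sub_q_pow z 3).pow 2) (pow_ne_zero 2 h3))).mul hε
  norm_num only [zero_add, mul_one] at hB hC
  have hb := (hasLeading_shiftBoundary_inv hz (by omega)).sub hB
  have hc := (HasLeading.of_hasValueAt (2 * m + 1) hq).mul
    ((hasLeading_shiftBoundary_inv_cube hz hm).sub hC)
  rw [zero_add] at hc
  have h := ((hasLeading_sum_quadTerm hz).sub hb).sub hc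
  simpa [defect] using h

lemma hasValueAt_defect_zero {z : ℂ} {d m t : ℕ} [NeZero d] (hd : Odd d) (hd1 : 1 < d)
    (hz : IsPrimitiveRoot z d) (hm1 : 1 ≤ m) (hm : 2 * m + 1 = d * t) :
    HasValueAt z (defect m) 0 := by
  have hz1 := hz.pow_eq_one
  have hdvd : d ∣ 2 * m + 1 := ⟨t, hm⟩
  have hε := hasOrder_one_sub_q_pow hz (k := 2 * m + 1) (by omega)
  rw [if_pos hdvd] at hε
  have hA : HasValueAt z (1 - q ^ (2 * m + 1)) 0 := hε.hasValueAt_zero hz1 (by simp)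
  have hqm := HasValueAt.q_pow z m
  have hqm0 : z ^ m ≠ 0 := pow_ne_zero _ (hz.ne_zero (by omega))
  have hX := fun k hk => ((((hasOrder_q_pow hz 1).mul (hasOrder_one_add_q_pow hd hz k)).div
    ((hasOrder_one_sub_q_pow hz (k := k) hk).pow 2)).mul (hε.pow 3)).hasValueAt_zero hz1
      (by split_ifs <;> norm_num)
  have hb := (hasValueAt_shiftBoundary_inv_zero hd hz hd1 hm).sub (hX 1 one_pos)
  obtain ⟨l, rfl⟩ : ∃ l, m = l + 1 := ⟨m - 1, by omega⟩
  have hc := (HasValueAt.q_pow z 1).mul ((hasValueAt_shiftBoundary_inv_cube_zero hd hz hd1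
    (N := 2 * l) (by omega)).sub (hX 3 three_pos))
  have ha := ((hasValueAt_sum_quadTerm_zero hd hz hm).sub (hA.div hqm hqm0)).sub
    (((HasValueAt.const z (((2 * (l + 1) + 1 : ℕ) ^ 2 - 1) / 24)).mul (hA.pow 3)).div hqm hqm0)
  have h := (ha.sub hb).sub hc
  simpa [defect, mul_add] using h

lemma mul_cyclotomic_pow_dvd {n : ℕ} (hn : 1 < n) {p : ℚ[X]} {k : ℕ}
    (hp : cyclotomic n ℚ ^ (k + 1) ∣ p)
    (h : ∀ d, d ∣ n → 1 < d → d < n → cyclotomic d ℚ ∣ p) :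
    qintPoly n * cyclotomic n ℚ ^ k ∣ p := by
  have hmem : n ∈ n.divisors.erase 1 := by simp; omega
  rw [qintPoly, ← prod_cyclotomic_eq_geom_sum (by omega), ← prod_erase_mul _ _ hmem, mul_assoc,
    ← pow_succ']
  refine IsCoprime.mul_dvd (IsCoprime.prod_left fun d hd => ?_) ?_ hp
  · exact (cyclotomic.isCoprime_rat (mem_erase.1 hd).1).pow_right
  · refine prod_dvd_of_coprime (fun a _ b _ hab => cyclotomic.isCoprime_rat hab) fun d hd => ?_
    simp only [mem_erase, Nat.mem_divisors] at hd
    have := Nat.le_of_dvd (by omega) hd.2.2.1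
    have := Nat.pos_of_dvd_of_pos hd.2.2.1 (by omega)
    exact h d hd.2.2.1 (by omega) (by omega)

end Assembly

theorem stmt_3 (n : ℕ) (hn : 3 < n) (hodd : Odd n) :
    ratCongr
      (∑ k ∈ Finset.range n,
        qint (3 * (k : ℤ) - 3) *
          (qpoch q (q ^ 2) k * (qpoch (q ^ (-3 : ℤ)) (q ^ 2) k) ^ 2 /
            ((qpoch q q k) ^ 2 * qpoch (q ^ 2) (q ^ 2) k)) *
          q ^ ((7 * (k : ℤ) - (k : ℤ) ^ 2) / 2))
      (qint n * q ^ (-(((n : ℤ) + 3) / 2)) - (1 + q) / q * (qint n) ^ 3 -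
        (1 + q ^ 3) / (1 + q + q ^ 2) ^ 2 * (qint n) ^ 3 +
        ((n : RatFunc ℚ) ^ 2 - 1) * (1 - q) ^ 2 / 24 * (qint n) ^ 3 * q ^ (-(((n : ℤ) + 3) / 2)))
      (qintPoly n * (Polynomial.cyclotomic n ℚ) ^ 3) := by
  obtain ⟨m, rfl⟩ := hodd
  simp_rw [ratCongr, qint_mul_eq_quadTerm_div]
  rw [sum_sub_eq_defect_div]
  have hden : ∀ {d : ℕ} {z : ℂ}, 1 < d → IsPrimitiveRoot z d →
      HasValueAt z (q ^ 2 * (1 - q ^ 1)) (z ^ 2 * (1 - z ^ 1)) ∧ z ^ 2 * (1 - z ^ 1) ≠ 0 :=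
    fun hd hz => ⟨(HasValueAt.q_pow _ 2).mul (HasValueAt.one_sub_q_pow _ 1),
      mul_ne_zero (pow_ne_zero 2 (hz.ne_zero (by omega)))
        (sub_ne_zero.2 (hz.pow_ne_one_of_pos_of_lt one_ne_zero hd).symm)⟩
  refine mul_cyclotomic_pow_dvd (by omega) ?_ fun d hd hd1 hdn => ?_
  · have hz := Complex.isPrimitiveRoot_exp (2 * m + 1) (by omega)
    obtain ⟨h1, h2⟩ := hden (by omega) hz
    refine cyclotomic_pow_dvd_num hz ?_
    simpa using (hasLeading_defect hz (by omega)).div (.of_hasValueAt _ h1) h2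
  · obtain ⟨t, ht⟩ := hd
    have hz := Complex.isPrimitiveRoot_exp d (by omega)
    obtain ⟨h1, h2⟩ := hden hd1 hz
    have : NeZero d := ⟨by omega⟩
    have hodd : Odd d := (Nat.odd_mul.1 (ht ▸ odd_two_mul_add_one m)).1
    rw [← pow_one (cyclotomic d ℚ)]
    refine cyclotomic_pow_dvd_num (k := 0) hz (.of_hasValueAt _ ?_)
    simpa using (hasValueAt_defect_zero hodd hd1 hz (by omega) ht).div h1 h2
end

section
/- For any prime p > 3, the following congruence of rational numbers holds: Σ_{k=0}^{p-1} (6k^4 / (16^k·(2k-1))) · C(2k,k)^3 ≡ p + 2p^3 (mod p^4), i.e., the difference of the two sides is a rational number whose numerator (in lowest terms) is divisible by p^4 and whose denominator is coprime to p. -/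
theorem sum_range_inv_sq_eq_zero {p : ℕ} [Fact p.Prime] (hp3 : 3 < p) :
    ∑ r ∈ Finset.range p, ((r : ZMod p)⁻¹) ^ 2 = 0 := by
  have h1 : ∑ r ∈ Finset.range p, ((r : ZMod p)⁻¹) ^ 2 = ∑ x : ZMod p, (x⁻¹) ^ 2 := by
    refine Finset.sum_bij (fun r _ => (r : ZMod p)) (by simp) ?_ ?_ (by simp)
    · intro a ha b hb hab
      rw [ZMod.natCast_eq_natCast_iff'] at hab
      rwa [Nat.mod_eq_of_lt (Finset.mem_range.1 ha), Nat.mod_eq_of_lt (Finset.mem_range.1 hb)] at hab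
    · intro b _
      exact ⟨b.val, Finset.mem_range.2 (ZMod.val_lt b), ZMod.natCast_zmod_val b⟩
  have h2 : ∑ x : ZMod p, (x⁻¹) ^ 2 = ∑ x : ZMod p, x ^ 2 :=
    Fintype.sum_bijective (fun x : ZMod p => x⁻¹) inv_involutive.bijective _ _ (fun _ => rfl)
  have hp5 : p ≠ 4 := by rintro rfl; exact absurd (Fact.out : Nat.Prime 4) (by decide)
  rw [h1, h2]
  exact FiniteField.sum_pow_lt_card_sub_one (ZMod p) 2 (by rw [ZMod.card]; omega)

theorem sum_range_half_inv_sq_eq_zero {l : ℕ} [Fact (2 * l + 1).Prime] (hp3 : 3 < 2 * l + 1) :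
    ∑ r ∈ Finset.range (l + 1), ((r : ZMod (2 * l + 1))⁻¹) ^ 2 = 0 := by
  have h := sum_range_inv_sq_eq_zero hp3
  have e : Finset.range (2 * l + 1) = Finset.range (l + 1 + l) := by congr 1; ring
  have h2 : ∑ r ∈ Finset.range l, (((l + 1 + r : ℕ) : ZMod (2 * l + 1))⁻¹) ^ 2 =
      ∑ r ∈ Finset.range (l + 1), ((r : ZMod (2 * l + 1))⁻¹) ^ 2 := by
    rw [Finset.sum_range_succ', ← Finset.sum_range_reflect]
    simp only [Nat.cast_zero, inv_zero, ne_eq, OfNat.ofNat_ne_zero, not_false_eq_true, zero_pow,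
      add_zero]
    refine Finset.sum_congr rfl fun r hr => ?_
    have hr' := Finset.mem_range.1 hr
    have hz : ((l + 1 + (l - 1 - r) : ℕ) : ZMod (2 * l + 1)) = -((r + 1 : ℕ) : ZMod (2 * l + 1)) := by
      rw [eq_neg_iff_add_eq_zero, ← Nat.cast_add, ZMod.natCast_eq_zero_iff]
      exact ⟨1, by omega⟩
    rw [hz, inv_neg, neg_sq]
  rw [e, Finset.sum_range_add, h2, ← two_mul] at h
  refine (mul_eq_zero.1 h).resolve_left fun h0 => ?_
  have h0' : ((2 : ℕ) : ZMod (2 * l + 1)) = 0 := by exact_mod_cast h0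
  rw [ZMod.natCast_eq_zero_iff] at h0'
  exact absurd (Nat.le_of_dvd two_pos h0') (by omega)

theorem exists_prod_add_mul_eq {p : ℕ} [Fact p.Prime] (q b : ℤ) (a : ℕ → ℤ) (n : ℕ)
    (ha : ∀ i < n, (a i : ZMod p) ≠ 0) :
    ∃ s t : ℤ, ∏ i ∈ Finset.range n, (a i + q * b) =
        ∏ i ∈ Finset.range n, a i + q * b * s + q ^ 2 * t ∧
      (s : ZMod p) = (∏ i ∈ Finset.range n, (a i : ZMod p)) *
        ∑ i ∈ Finset.range n, (a i : ZMod p)⁻¹ := by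
  induction n with
  | zero => exact ⟨0, 0, by simp, by simp⟩
  | succ n ih =>
    obtain ⟨s, t, h1, h2⟩ := ih fun i hi => ha i (by omega)
    refine ⟨s * a n + ∏ i ∈ Finset.range n, a i, t * (a n + q * b) + b ^ 2 * s, ?_, ?_⟩
    · rw [Finset.prod_range_succ, Finset.prod_range_succ, h1]; ring
    · have := ha n (by omega)
      rw [Finset.prod_range_succ, Finset.sum_range_succ]
      push_cast
      rw [h2]
      field_simp

theorem choose_mul_add_pred_modEq_one {p : ℕ} [hp : Fact p.Prime] (hp3 : 3 < p) (m : ℕ) :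
    (p : ℤ) ^ 3 ∣ ((p * m + (p - 1)).choose (p - 1) : ℤ) - 1 := by
  obtain ⟨c, rfl⟩ : ∃ c, p = c + 1 := ⟨p - 1, by omega⟩
  simp only [Nat.add_sub_cancel]
  set D : ℤ := ((((c + 1) * m + c).choose c : ℕ) : ℤ) with hD
  set P : ℤ := ((c + 1 : ℕ) : ℤ) with hP
  have hR : ∏ i ∈ Finset.range c, (P * m + 1 + i) = (c.factorial : ℤ) * D := by
    have := (Nat.ascFactorial_eq_prod_range ((c + 1) * m + 1) c).symm.trans
      (Nat.ascFactorial_eq_factorial_mul_choose ((c + 1) * m) c)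
    rw [hP, hD]
    exact_mod_cast this
  have hC : ∏ i ∈ Finset.range c, ((i : ℤ) + 1) = (c.factorial : ℤ) := by
    rw [← Finset.prod_range_add_one_eq_factorial]; push_cast; rfl
  have refl (x : ℤ) : (∏ i ∈ Finset.range c, (x + 1 + i)) ^ 2 =
      ∏ i ∈ Finset.range c, (((i : ℤ) + 1) * (P - 1 - i) + x * (x + P)) := by
    rw [sq]
    conv_lhs => arg 2; rw [← Finset.prod_range_reflect]
    rw [← Finset.prod_mul_distrib]
    refine Finset.prod_congr rfl fun i hi => ?_
    have hi' := Finset.mem_range.1 hi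
    have : ((c - 1 - i : ℕ) : ℤ) = P - 2 - i := by rw [hP]; push_cast; omega
    rw [this]; ring
  have hne : ∀ i < c, ((((i : ℤ) + 1) * (P - 1 - i) : ℤ) : ZMod (c + 1)) =
      -(((i + 1 : ℕ) : ZMod (c + 1))) ^ 2 := by
    intro i hi
    have : (P : ZMod (c + 1)) = 0 := by rw [hP, Int.cast_natCast, ZMod.natCast_self]
    push_cast
    rw [this]; ring
  have hne' : ∀ i < c, ((i + 1 : ℕ) : ZMod (c + 1)) ≠ 0 := by
    intro i hi h
    rw [ZMod.natCast_eq_zero_iff] at h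
    exact absurd (Nat.le_of_dvd (by omega) h) (by omega)
  obtain ⟨s, t, h1, h2⟩ := exists_prod_add_mul_eq (p := c + 1) (P ^ 2) ((m : ℤ) * (m + 1))
    (fun i => ((i : ℤ) + 1) * (P - 1 - i)) c (fun i hi => by
      rw [hne i hi]; exact neg_ne_zero.2 (pow_ne_zero _ (hne' i hi)))
  have hs : P ∣ s := by
    rw [hP, ← ZMod.intCast_zmod_eq_zero_iff_dvd, h2]
    convert mul_zero _
    have h0 := sum_range_inv_sq_eq_zero hp3
    rw [Finset.sum_range_succ', Nat.cast_zero, inv_zero, zero_pow two_ne_zero, add_zero] at h0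
    rw [← neg_eq_zero, ← Finset.sum_neg_distrib, ← h0]
    refine Finset.sum_congr rfl fun i hi => ?_
    rw [hne i (Finset.mem_range.1 hi), inv_neg, neg_neg, inv_pow]
  have e1 := refl (P * m)
  have e0 := refl 0
  rw [hR] at e1
  have e0' : ∏ i ∈ Finset.range c, ((0 : ℤ) + 1 + i) = (c.factorial : ℤ) := by
    rw [← hC]; exact Finset.prod_congr rfl fun i _ => by ring
  rw [e0'] at e0
  simp only [zero_mul, add_zero] at e0
  have e2 : ∏ i ∈ Finset.range c, (((i : ℤ) + 1) * (P - 1 - i) + P * m * (P * m + P)) =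
      ∏ i ∈ Finset.range c, (((i : ℤ) + 1) * (P - 1 - i) + P ^ 2 * ((m : ℤ) * (m + 1))) :=
    Finset.prod_congr rfl fun i _ => by ring
  rw [e2, h1, ← e0] at e1
  obtain ⟨s', rfl⟩ := hs
  have hdvd : P ^ 3 ∣ (c.factorial : ℤ) ^ 2 * (D + 1) * (D - 1) :=
    ⟨(m : ℤ) * (m + 1) * s' + P * t, by linear_combination e1⟩
  have hPp : Prime P := Nat.prime_iff_prime_int.1 hp.out
  have hlucas : D ≡ 1 [ZMOD P] := by
    have := Choose.choose_modEq_choose_mod_mul_choose_div_nat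
      (n := (c + 1) * m + c) (k := c) (p := c + 1)
    rw [Nat.mul_add_mod, Nat.mod_eq_of_lt (Nat.lt_succ_self c), Nat.choose_self,
      Nat.div_eq_of_lt (Nat.lt_succ_self c), Nat.choose_zero_right] at this
    rw [one_mul] at this
    rw [hP, hD]
    exact_mod_cast (Int.natCast_modEq_iff.2 this)
  refine (IsCoprime.pow_left ?_).dvd_of_dvd_mul_left hdvd
  refine IsCoprime.mul_right (IsCoprime.pow_right ?_) ?_
  · refine (hPp.coprime_iff_not_dvd).2 fun h => ?_
    have := (hp.out.dvd_factorial).1 (Int.natCast_dvd_natCast.1 h)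
    omega
  · refine (hPp.coprime_iff_not_dvd).2 fun h => ?_
    have h3 : P ∣ 2 := by
      have := dvd_sub h hlucas.symm.dvd
      simpa [add_sub_sub_cancel, show D + 1 - (D - 1) = 2 by ring] using this
    have := Int.le_of_dvd two_pos h3
    omega

theorem sum_centralBinom_mul_multichoose_sq_sub (x N : ℕ) :
    ∑ n ∈ Finset.range (N + 1), (n.centralBinom : ℤ) *
      ((3 * n + 2 * (x + 1 : ℕ)) * ((x + 1).multichoose n : ℤ) ^ 2 -
        (3 * n + 2 * x) * (x.multichoose n : ℤ) ^ 2) =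
    2 * (2 * N + 1) * N.centralBinom * ((x + 1).multichoose N : ℤ) ^ 2 := by
  induction N with
  | zero => simp; ring
  | succ N ih =>
    rw [Finset.sum_range_succ, ih]
    have hc : ((N : ℤ) + 1) * (N + 1).centralBinom = 2 * (2 * N + 1) * N.centralBinom := by
      exact_mod_cast Nat.succ_mul_centralBinom_succ N
    have ha : ((x + 1).multichoose (N + 1) : ℤ) =
        x.multichoose (N + 1) + (x + 1).multichoose N := by
      exact_mod_cast Nat.multichoose_succ_succ x N
    have hb : ((N : ℤ) + 1) * x.multichoose (N + 1) = x * (x + 1).multichoose N := by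
      rw [Nat.multichoose_eq, Nat.multichoose_eq]
      cases x with
      | zero => simp
      | succ y =>
        have := Nat.add_one_mul_choose_eq (y + N) N
        have h2 := Nat.choose_succ_right_eq (y + 1 + N) N
        rw [show y + 1 + (N + 1) - 1 = y + 1 + N by omega,
          show y + 1 + 1 + N - 1 = y + 1 + N by omega]
        rw [show y + 1 + N - N = y + 1 by omega] at h2
        push_cast
        zify at h2
        linarith
    rw [← hc, ha]
    push_cast
    generalize ((N + 1).centralBinom : ℤ) = C
    generalize (x.multichoose (N + 1) : ℤ) = b at *
    generalize ((x + 1).multichoose N : ℤ) = c at *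
    linear_combination (C * (-4 * b - 2 * c)) * hb

theorem sum_centralBinom_mul_multichoose_sq (X N : ℕ) :
    ∑ n ∈ Finset.range (N + 1), (n.centralBinom : ℤ) *
      ((3 * n + 2 * X) * (X.multichoose n : ℤ) ^ 2) =
    2 * (2 * N + 1) * N.centralBinom *
      ∑ x ∈ Finset.range X, ((x + 1).multichoose N : ℤ) ^ 2 := by
  induction X with
  | zero =>
    rw [Finset.sum_range_succ']
    simp
  | succ X ih =>
    rw [Finset.sum_range_succ (fun x => ((x + 1).multichoose N : ℤ) ^ 2),
      mul_add (2 * (2 * (N : ℤ) + 1) * N.centralBinom), ← ih,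
      ← sum_centralBinom_mul_multichoose_sq_sub, ← Finset.sum_add_distrib]
    exact Finset.sum_congr rfl fun n _ => by ring

theorem sum_range_choose_sq_eq_one {p : ℕ} [hp : Fact p.Prime] (hp3 : 3 < p) (m h : ℕ) (hh : h < p)
    (hS : ∑ r ∈ Finset.range (h + 1), ((r : ZMod p)⁻¹) ^ 2 = 0) :
    ((∑ r ∈ Finset.range (h + 1), ((p * m + r + (p - 1)).choose (p - 1)) ^ 2 : ℕ) :
      ZMod (p ^ 3)) = 1 := by
  have hdvd : ∀ j < h, p ∣ (p * m + (j + 1) + (p - 1)).choose (p - 1) ∧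
      (((p * m + (j + 1) + (p - 1)).choose (p - 1) / p : ℕ) : ZMod p) =
        (m + 1) * ((j + 1 : ℕ) : ZMod p)⁻¹ := by
    intro j hj
    have hj0 : ((j + 1 : ℕ) : ZMod p) ≠ 0 := by
      rw [Ne, ZMod.natCast_eq_zero_iff]
      exact fun h => absurd (Nat.le_of_dvd (by omega) h) (by omega)
    have h1 := Nat.choose_succ_right_eq (p * m + (j + 1) + (p - 1)) (p - 1)
    rw [Nat.sub_add_cancel hp.out.one_le, Nat.add_sub_cancel] at h1
    have hd : p ∣ (p * m + (j + 1) + (p - 1)).choose (p - 1) := by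
      refine (Nat.Coprime.dvd_of_dvd_mul_right ?_ (Dvd.intro_left _ h1))
      rw [hp.out.coprime_iff_not_dvd, ← ZMod.natCast_eq_zero_iff]
      simpa using hj0
    refine ⟨hd, ?_⟩
    obtain ⟨d, hd⟩ := hd
    have hl := Choose.choose_modEq_choose_mod_mul_choose_div_nat
      (n := p * m + (j + 1) + (p - 1)) (k := p) (p := p)
    rw [show p * m + (j + 1) + (p - 1) = j + p * (m + 1) by
        rw [mul_add, mul_one]; have := hp.out.one_le; omega, Nat.add_mul_mod_self_left,
      Nat.mod_eq_of_lt (show j < p by omega), Nat.mod_self, Nat.choose_zero_right, one_mul,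
      Nat.div_self hp.out.pos, Nat.choose_one_right, Nat.add_mul_div_left _ _ hp.out.pos,
      Nat.div_eq_of_lt (show j < p by omega), zero_add,
      show j + p * (m + 1) = p * m + (j + 1) + (p - 1) by
        rw [mul_add, mul_one]; have := hp.out.one_le; omega, ← ZMod.natCast_eq_natCast_iff] at hl
    rw [hd, Nat.mul_div_cancel_left _ hp.out.pos, eq_mul_inv_iff_mul_eq₀ hj0]
    rw [hd, mul_comm, mul_assoc] at h1
    have h2 := Nat.eq_of_mul_eq_mul_left hp.out.pos h1
    rw [h2] at hl
    push_cast at hl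
    simpa using hl
  have hsum : p ∣ ∑ j ∈ Finset.range h,
      ((p * m + (j + 1) + (p - 1)).choose (p - 1) / p) ^ 2 := by
    rw [← ZMod.natCast_eq_zero_iff]
    rw [Finset.sum_range_succ', Nat.cast_zero, inv_zero, zero_pow two_ne_zero, add_zero] at hS
    push_cast [Nat.cast_sum]
    rw [Finset.sum_congr rfl fun j hj => by rw [(hdvd j (Finset.mem_range.1 hj)).2, mul_pow],
      ← Finset.mul_sum, hS, mul_zero]
  rw [Finset.sum_range_succ', Nat.cast_add]
  have hz : ((∑ j ∈ Finset.range h, ((p * m + (j + 1) + (p - 1)).choose (p - 1)) ^ 2 : ℕ) :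
      ZMod (p ^ 3)) = 0 := by
    rw [ZMod.natCast_eq_zero_iff]
    obtain ⟨e, he⟩ := hsum
    refine ⟨e, ?_⟩
    rw [show p ^ 3 * e = p ^ 2 * (p * e) by ring, ← he, Finset.mul_sum]
    refine Finset.sum_congr rfl fun j hj => ?_
    rw [← mul_pow, Nat.mul_div_cancel' (hdvd j (Finset.mem_range.1 hj)).1]
  have h1 : (((p * m + 0 + (p - 1)).choose (p - 1) : ℕ) : ZMod (p ^ 3)) = 1 := by
    have := choose_mul_add_pred_modEq_one hp3 m
    rw [← sub_eq_zero]
    have h2 := (ZMod.intCast_zmod_eq_zero_iff_dvd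
      (((p * m + (p - 1)).choose (p - 1) : ℕ) - 1 : ℤ) (p ^ 3)).2 (by push_cast; exact this)
    push_cast at h2
    simpa using h2
  rw [hz, zero_add, Nat.cast_pow, h1, one_pow]

theorem sum_range_mul_add_choose_sq {p : ℕ} [hp : Fact p.Prime] (hp3 : 3 < p) (h M : ℕ) (hh : h < p)
    (hS : ∑ r ∈ Finset.range (h + 1), ((r : ZMod p)⁻¹) ^ 2 = 0) :
    ((∑ x ∈ Finset.range (p * M + (h + 1)), ((x + (p - 1)).choose (p - 1)) ^ 2 : ℕ) :
      ZMod (p ^ 3)) = M + 1 := by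
  have key : ((∑ x ∈ Finset.range (p * M), ((x + (p - 1)).choose (p - 1)) ^ 2 : ℕ) :
      ZMod (p ^ 3)) = M := by
    induction M with
    | zero => simp
    | succ M ih =>
      have h1 := sum_range_choose_sq_eq_one hp3 M (p - 1) (by omega)
        (by rw [Nat.sub_add_cancel hp.out.one_le]; exact sum_range_inv_sq_eq_zero hp3)
      rw [Nat.sub_add_cancel hp.out.one_le] at h1
      rw [mul_add, mul_one, Finset.sum_range_add, Nat.cast_add, ih, h1]
      push_cast; rfl
  rw [Finset.sum_range_add, Nat.cast_add, key, sum_range_choose_sq_eq_one hp3 M h hh hS]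

theorem isUnit_natCast_zmod_pow {p : ℕ} [hp : Fact p.Prime] {a : ℕ} (h0 : 0 < a) (ha : a < p)
    (n : ℕ) : IsUnit (a : ZMod (p ^ n)) := by
  rw [ZMod.isUnit_iff_coprime]
  exact (Nat.coprime_of_lt_prime h0.ne' ha hp.out).symm.pow_right n

theorem centralBinom_eq_four_pow_mul_multichoose {p : ℕ} [hp : Fact p.Prime] {k X : ℕ}
    (hX : 2 * (X : ZMod (p ^ k)) = 1) {n : ℕ} (hn : n < p) :
    (n.centralBinom : ZMod (p ^ k)) = 4 ^ n * X.multichoose n := by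
  induction n with
  | zero => simp
  | succ n ih =>
    have ih := ih (by omega)
    refine (isUnit_natCast_zmod_pow (Nat.succ_pos n) hn k).mul_left_cancel ?_
    have h1 : ((n + 1 : ℕ) : ZMod (p ^ k)) * (n + 1).centralBinom =
        2 * (2 * n + 1) * n.centralBinom := by
      exact_mod_cast congrArg (Nat.cast (R := ZMod (p ^ k))) (Nat.succ_mul_centralBinom_succ n)
    have h2 : (n + 1) * X.multichoose (n + 1) = (X + n) * X.multichoose n := by
      rw [Nat.multichoose_eq, Nat.multichoose_eq]
      cases X with
      | zero => cases n <;> simp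
      | succ y =>
        have := Nat.add_one_mul_choose_eq (y + n) n
        rw [show y + 1 + (n + 1) - 1 = y + n + 1 by omega, show y + 1 + n - 1 = y + n by omega]
        linarith
    have h3 : ((n + 1 : ℕ) : ZMod (p ^ k)) * X.multichoose (n + 1) =
        (X + n) * X.multichoose n := by
      exact_mod_cast congrArg (Nat.cast (R := ZMod (p ^ k))) h2
    rw [h1, ih]
    linear_combination (-(4 : ZMod (p ^ k)) ^ (n + 1)) * h3 -
      (2 * 4 ^ n * (X.multichoose n : ZMod (p ^ k))) * hX

theorem sum_three_mul_add_one_mul_centralBinom_cube {p : ℕ} [hp : Fact p.Prime] (hp3 : 3 < p) :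
    (p : ℤ) ^ 4 ∣ (∑ n ∈ Finset.range p, (3 * n + 1) * (n.centralBinom : ℤ) ^ 3 * 16 ^ (p - n)) -
      16 ^ p * p := by
  obtain ⟨l, hl⟩ := hp.out.odd_of_ne_two (by omega)
  obtain ⟨M, hM⟩ := (hp.out.odd_of_ne_two (by omega)).pow (n := 3)
  have hS : ∑ r ∈ Finset.range (l + 1), ((r : ZMod p)⁻¹) ^ 2 = 0 := by
    subst hl
    exact sum_range_half_inv_sq_eq_zero hp3
  have hD := sum_range_mul_add_choose_sq hp3 l M (by omega) hS
  set X := p * M + (l + 1) with hXdef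
  have h2X : 2 * X = p ^ 4 + 1 := by
    rw [hXdef, pow_succ, hM]; nlinarith
  have hX : 2 * (X : ZMod (p ^ 4)) = 1 := by
    have := congrArg (Nat.cast (R := ZMod (p ^ 4))) h2X
    rw [Nat.cast_add, ZMod.natCast_self] at this
    simpa using this
  have hu : ((p.centralBinom : ℕ) : ZMod (p ^ 3)) = 2 := by
    have h1 := choose_mul_add_pred_modEq_one hp3 1
    have h2 := (ZMod.intCast_zmod_eq_zero_iff_dvd
      (((p * 1 + (p - 1)).choose (p - 1) : ℕ) - 1 : ℤ) (p ^ 3)).2 (by push_cast; exact h1)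
    have h3 : p.centralBinom = 2 * (p * 1 + (p - 1)).choose (p - 1) := by
      obtain ⟨c, rfl⟩ : ∃ c, p = c + 1 := ⟨p - 1, by omega⟩
      rw [Nat.centralBinom_eq_two_mul_choose, show 2 * (c + 1) = 2 * c + 1 + 1 by ring,
        Nat.choose_succ_succ, Nat.choose_symm_half, Nat.add_sub_cancel,
        show (c + 1) * 1 + c = 2 * c + 1 by ring]
      ring
    rw [h3]
    push_cast at h2 ⊢
    linear_combination 2 * h2
  have hW : (p : ℤ) ^ 3 ∣ (p.centralBinom : ℤ) *
      (∑ x ∈ Finset.range X, ((x + (p - 1)).choose (p - 1)) ^ 2 : ℕ) - 1 := by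
    have hM' := congrArg (Nat.cast (R := ZMod (p ^ 3))) hM
    rw [ZMod.natCast_self] at hM'
    push_cast at hM'
    have : (((p.centralBinom : ℤ) *
      (∑ x ∈ Finset.range X, ((x + (p - 1)).choose (p - 1)) ^ 2 : ℕ) - 1 : ℤ) :
        ZMod (p ^ 3)) = 0 := by
      rw [Int.cast_sub, Int.cast_mul, Int.cast_natCast, Int.cast_natCast, hD, hu]
      push_cast
      linear_combination -hM'
    exact_mod_cast (ZMod.intCast_zmod_eq_zero_iff_dvd _ _).1 this
  have hsum := sum_centralBinom_mul_multichoose_sq X (p - 1)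
  rw [Nat.sub_add_cancel hp.out.one_le] at hsum
  have hp1 : 2 * (2 * ((p - 1 : ℕ) : ℤ) + 1) * (p - 1).centralBinom = p * p.centralBinom := by
    have := Nat.succ_mul_centralBinom_succ (p - 1)
    rw [Nat.sub_add_cancel hp.out.one_le] at this
    exact_mod_cast this.symm
  have hmc : ∑ x ∈ Finset.range X, ((x + 1).multichoose (p - 1) : ℤ) ^ 2 =
      (∑ x ∈ Finset.range X, ((x + (p - 1)).choose (p - 1)) ^ 2 : ℕ) := by
    push_cast
    refine Finset.sum_congr rfl fun x _ => ?_
    rw [Nat.multichoose_eq, show x + 1 + (p - 1) - 1 = x + (p - 1) by omega]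
  rw [hp1, hmc] at hsum
  have hT : (p : ℤ) ^ 4 ∣
      (∑ n ∈ Finset.range p, (3 * n + 1) * (n.centralBinom : ℤ) ^ 3 * 16 ^ (p - n)) -
      16 ^ p * ∑ n ∈ Finset.range p, (n.centralBinom : ℤ) *
        ((3 * n + 2 * X) * (X.multichoose n : ℤ) ^ 2) := by
    have : (((∑ n ∈ Finset.range p, (3 * n + 1) * (n.centralBinom : ℤ) ^ 3 * 16 ^ (p - n)) -
      16 ^ p * ∑ n ∈ Finset.range p, (n.centralBinom : ℤ) *
        ((3 * n + 2 * X) * (X.multichoose n : ℤ) ^ 2) : ℤ) : ZMod (p ^ 4)) = 0 := by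
      push_cast
      rw [sub_eq_zero, Finset.mul_sum]
      refine Finset.sum_congr rfl fun n hn => ?_
      have hn := Finset.mem_range.1 hn
      have h16 : (16 : ZMod (p ^ 4)) ^ p = 4 ^ n * 4 ^ n * 16 ^ (p - n) := by
        rw [← mul_pow, show (4 : ZMod (p ^ 4)) * 4 = 16 by norm_num, ← pow_add]
        congr 1; omega
      rw [h16, hX, centralBinom_eq_four_pow_mul_multichoose hX hn]
      ring
    exact_mod_cast (ZMod.intCast_zmod_eq_zero_iff_dvd _ _).1 this
  rw [hsum] at hT
  obtain ⟨a, ha⟩ := hT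
  obtain ⟨b, hb⟩ := hW
  exact ⟨a + 16 ^ p * b, by linear_combination ha + 16 ^ p * (p : ℤ) * hb⟩

theorem sum_range_eq_sum_add (N : ℕ) :
    ∑ k ∈ Finset.range N,
        6 * (k : ℚ) ^ 4 / (16 ^ k * (2 * (k : ℚ) - 1)) * ((2 * k).choose k : ℚ) ^ 3 =
      ∑ k ∈ Finset.range N, (3 * (k : ℚ) + 1) * (k.centralBinom : ℚ) ^ 3 / 16 ^ k +
        (N : ℚ) ^ 3 * (2 * N - 4) / (2 * N - 1) * (N.centralBinom : ℚ) ^ 3 / 16 ^ N := by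
  have hne (k : ℕ) : (2 * (k : ℚ) - 1) ≠ 0 := by
    intro h
    have h2 : ((2 * k : ℕ) : ℚ) = (1 : ℕ) := by push_cast; linarith
    have := Nat.cast_injective h2
    omega
  induction N with
  | zero => simp
  | succ N ih =>
    have hc : ((N + 1).centralBinom : ℚ) = 2 * (2 * N + 1) * N.centralBinom / (N + 1) := by
      rw [eq_div_iff (by positivity)]
      exact_mod_cast (mul_comm _ _).trans (Nat.succ_mul_centralBinom_succ N)
    have h1 := hne N
    rw [Finset.sum_range_succ, Finset.sum_range_succ, ih, ← Nat.centralBinom_eq_two_mul_choose, hc]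
    push_cast
    have h3 : (2 * (N : ℚ) + 1) ≠ 0 := by positivity
    rw [show 2 * ((N : ℚ) + 1) - 1 = 2 * N + 1 by ring, pow_succ]
    generalize (∑ k ∈ Finset.range N, (3 * (k : ℚ) + 1) * (k.centralBinom : ℚ) ^ 3 / 16 ^ k) = S
    have h4 : (N : ℚ) + 1 ≠ 0 := by positivity
    generalize hw : 2 * (N : ℚ) - 1 = w at h1 ⊢
    field_simp
    rw [← hw]
    ring

theorem dvd_num_and_not_dvd_den {p : ℕ} (hp : p.Prime) (n : ℕ) (x : ℚ) (D M : ℤ)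
    (hD : ¬ (p : ℤ) ∣ D) (h : (D : ℚ) * x = (p : ℚ) ^ n * M) :
    (p : ℤ) ^ n ∣ x.num ∧ ¬ (p : ℤ) ∣ (x.den : ℤ) := by
  have hx : D * x.num = (p : ℤ) ^ n * M * x.den := by
    have hd : (x.den : ℚ) ≠ 0 := by exact_mod_cast x.den_nz
    rw [← Rat.num_div_den x, mul_div_assoc', div_eq_iff hd] at h
    exact_mod_cast h
  have hpp : Prime (p : ℤ) := Nat.prime_iff_prime_int.1 hp
  refine ⟨?_, fun hden => hD ?_⟩
  · exact (IsCoprime.pow_left (hpp.coprime_iff_not_dvd.2 hD)).dvd_of_dvd_mul_left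
      ⟨M * x.den, by rw [hx]; ring⟩
  · have : (x.den : ℤ) ∣ D :=
      (Rat.isCoprime_num_den x).symm.dvd_of_dvd_mul_right ⟨p ^ n * M, by rw [hx]; ring⟩
    exact hden.trans this

theorem stmt_4 (p : ℕ) (hp : p.Prime) (hp3 : 3 < p) (x : ℚ)
    (hx : x = (∑ k ∈ Finset.range p,
        6 * (k : ℚ) ^ 4 / (16 ^ k * (2 * (k : ℚ) - 1)) * ((2 * k).choose k : ℚ) ^ 3) -
      ((p : ℚ) + 2 * (p : ℚ) ^ 3)) :
    (p : ℤ) ^ 4 ∣ x.num ∧ ¬ (p : ℤ) ∣ (x.den : ℤ) := by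
  have : Fact p.Prime := ⟨hp⟩
  obtain ⟨a, ha⟩ := sum_three_mul_add_one_mul_centralBinom_cube hp3
  have hpp : Prime (p : ℤ) := Nat.prime_iff_prime_int.1 hp
  obtain ⟨b, hb⟩ : (p : ℤ) ∣ (2 * p - 4) * (p.centralBinom : ℤ) ^ 3 -
      2 * 16 ^ p * (2 * p - 1) := by
    have hc : (p.centralBinom : ZMod p) = 2 := by
      have := Choose.choose_modEq_choose_mod_mul_choose_div_nat (n := 2 * p) (k := p) (p := p)
      rw [Nat.mul_mod_left, Nat.mod_self, Nat.mul_div_cancel _ hp.pos, Nat.div_self hp.pos,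
        ← ZMod.natCast_eq_natCast_iff, ← Nat.centralBinom_eq_two_mul_choose] at this
      simpa using this
    rw [← ZMod.intCast_zmod_eq_zero_iff_dvd]
    push_cast
    rw [hc, ZMod.pow_card, ZMod.natCast_self]
    ring
  have hT : (16 : ℚ) ^ p * ∑ k ∈ Finset.range p, (3 * (k : ℚ) + 1) * (k.centralBinom : ℚ) ^ 3 /
      16 ^ k = ((∑ n ∈ Finset.range p, (3 * n + 1) * (n.centralBinom : ℤ) ^ 3 * 16 ^ (p - n) : ℤ) :
        ℚ) := by
    push_cast
    rw [Finset.mul_sum]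
    refine Finset.sum_congr rfl fun k hk => ?_
    rw [pow_sub₀ _ (by norm_num) (Finset.mem_range.1 hk).le]
    ring
  refine dvd_num_and_not_dvd_den hp 4 x (16 ^ p * (2 * p - 1)) ((2 * p - 1) * a + b) ?_ ?_
  · intro h
    rcases hpp.dvd_or_dvd h with h | h
    · have h2 : p ∣ 2 ^ 4 := by exact_mod_cast hpp.dvd_of_dvd_pow h
      exact absurd (Nat.le_of_dvd two_pos (hp.dvd_of_dvd_pow h2)) (by omega)
    · have h1 : (p : ℤ) ∣ 1 := by
        simpa using dvd_sub (Dvd.intro_left 2 rfl : (p : ℤ) ∣ 2 * p) h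
      exact hpp.not_isUnit (isUnit_of_dvd_one h1)
  · have ha' := congrArg (Int.cast (R := ℚ)) ha
    have hb' := congrArg (Int.cast (R := ℚ)) hb
    rw [Int.cast_sub, ← hT] at ha'
    push_cast at ha' hb' ⊢
    have hne : (2 * (p : ℚ) - 1) ≠ 0 := by
      have : (3 : ℚ) < p := by exact_mod_cast hp3
      linarith
    have hG : (16 : ℚ) ^ p * (2 * p - 1) *
        ((p : ℚ) ^ 3 * (2 * p - 4) / (2 * p - 1) * (p.centralBinom : ℚ) ^ 3 / 16 ^ p) =
        (p : ℚ) ^ 3 * (2 * p - 4) * (p.centralBinom : ℚ) ^ 3 := by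
      field_simp
    rw [hx, sum_range_eq_sum_add]
    linear_combination (2 * (p : ℚ) - 1) * ha' + (p : ℚ) ^ 3 * hb' + hG
end

section
/- For any prime p > 3 and any integer r ≥ 2, the following congruence of rational numbers holds: Σ_{k=0}^{p^r-1} (6k^4 / (16^k·(2k-1))) · C(2k,k)^3 ≡ p^r (mod p^{r+3}), i.e., the difference of the two sides is a rational number whose numerator (in lowest terms) is divisible by p^{r+3} and whose denominator is coprime to p. -/
open Finset

theorem mul_multichoose_succ (Y n : ℕ) :
    Y * Nat.multichoose (Y + 1) n = (Y + n) * Nat.multichoose Y n := by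
  rw [Nat.multichoose_eq, Nat.multichoose_eq]
  rcases Nat.eq_zero_or_pos (Y + n) with h | h
  · obtain ⟨rfl, rfl⟩ : Y = 0 ∧ n = 0 := by omega
    simp
  · have h1 := Nat.choose_mul_succ_eq (Y + n - 1) n
    rw [show Y + n - 1 + 1 = Y + n by omega, Nat.add_sub_cancel] at h1
    rw [show Y + 1 + n - 1 = Y + n by omega]
    linarith

/-- The increment in `Y` of the deformed sum `∑ j < n, (3j + 2Y) C(2j,j) C(Y+j-1,j)²`
has a closed form. -/
theorem deformedSum_succ_sub (Y n : ℕ) :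
    ∑ j ∈ range n, (3 * (j : ℤ) + 2 * (Y + 1)) * j.centralBinom * (Nat.multichoose (Y + 1) j) ^ 2
      = ∑ j ∈ range n, (3 * (j : ℤ) + 2 * Y) * j.centralBinom * (Nat.multichoose Y j) ^ 2
        + n * n.centralBinom * ((Nat.multichoose (Y + 1) n : ℤ) - Nat.multichoose Y n) ^ 2 := by
  induction n with
  | zero => simp
  | succ n ih =>
    rw [sum_range_succ, sum_range_succ, ih]
    have h1 : ((n : ℤ) + 1) * (n + 1).centralBinom = 2 * (2 * n + 1) * n.centralBinom := by
      exact_mod_cast Nat.succ_mul_centralBinom_succ n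
    have h2 : (Y : ℤ) * Nat.multichoose (Y + 1) n = (Y + n) * Nat.multichoose Y n := by
      exact_mod_cast mul_multichoose_succ Y n
    rw [Nat.multichoose_succ_succ]
    push_cast
    linear_combination (2 * n.centralBinom * ((Nat.multichoose (Y + 1) n : ℤ) + Nat.multichoose Y n)) * h2 -
      (Nat.multichoose (Y + 1) n : ℤ) ^ 2 * h1

theorem deformedSum_eq (Y n : ℕ) :
    ∑ j ∈ range (n + 1), (3 * (j : ℤ) + 2 * Y) * j.centralBinom * (Nat.multichoose Y j) ^ 2
      = (n + 1 : ℕ) * (n + 1).centralBinom * ∑ y ∈ range Y, ((y + n).choose n : ℤ) ^ 2 := by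
  induction Y with
  | zero => simp [sum_range_succ']
  | succ Y ih =>
    have h := deformedSum_succ_sub Y (n + 1)
    rw [Nat.multichoose_succ_succ, Nat.multichoose_eq (Y + 1),
      show Y + 1 + n - 1 = Y + n by omega] at h
    push_cast at h ih ⊢
    rw [h, ih, sum_range_succ]
    ring

theorem choose_prime_pow_modEq {p : ℕ} (hp : p.Prime) (m r : ℕ) :
    m.choose (p ^ r) ≡ m / p ^ r [MOD p] := by
  have := Fact.mk hp
  induction r generalizing m with
  | zero => simp; rfl
  | succ r ih =>
    have h := Choose.choose_modEq_choose_mod_mul_choose_div_nat (n := m) (k := p ^ (r + 1)) (p := p)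
    rw [pow_succ, Nat.mul_mod_left, Nat.mul_div_cancel _ hp.pos, Nat.choose_zero_right,
      one_mul] at h
    rw [pow_succ]
    refine h.trans ((ih _).trans ?_)
    rw [Nat.div_div_eq_div_mul, mul_comm p]

/-- `y C(y+n-1,n-1) = n C(y+n-1,n)`, written without subtraction. -/
theorem mul_choose_add (y n : ℕ) :
    y * (y + n).choose n = (n + 1) * (y + n).choose (n + 1) := by
  have := Nat.choose_succ_right_eq (y + n) n
  rw [Nat.add_sub_cancel] at this
  linarith

theorem sum_inv_sq {p : ℕ} [Fact p.Prime] (hp3 : 3 < p) :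
    ∑ s ∈ range p, ((s : ZMod p) ^ 2)⁻¹ = 0 := by
  have h1 : ∑ x : ZMod p, x ^ 2 = 0 := by
    apply FiniteField.sum_pow_lt_card_sub_one
    rw [ZMod.card]; omega
  have h2 : ∑ x : ZMod p, (x ^ 2)⁻¹ = 0 := by
    rw [← h1]
    exact Fintype.sum_equiv (Equiv.inv (ZMod p)) _ _ (fun x => by simp)
  rw [← h2]
  refine Finset.sum_bij (fun s _ => (s : ZMod p)) (by simp) ?_ ?_ (by simp)
  · intro a ha b hb h
    rw [ZMod.natCast_eq_natCast_iff'] at h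
    rwa [Nat.mod_eq_of_lt (mem_range.1 ha), Nat.mod_eq_of_lt (mem_range.1 hb)] at h
  · intro x _
    exact ⟨x.val, mem_range.2 x.val_lt, by simp⟩

theorem sum_half_inv_sq {b : ℕ} [Fact (2 * b + 1).Prime] (hp3 : 3 < 2 * b + 1) :
    ∑ s ∈ range (b + 1), ((s : ZMod (2 * b + 1)) ^ 2)⁻¹ = 0 := by
  have h := sum_inv_sq hp3
  rw [show range (2 * b + 1) = range (b + 1 + b) by congr 1; omega, sum_range_add,
    ← sum_range_reflect] at h
  have h3 : ∑ j ∈ range b, (((b + 1 + j : ℕ) : ZMod (2 * b + 1)) ^ 2)⁻¹ =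
      ∑ j ∈ range b, (((b + 1 + (b - 1 - j) : ℕ) : ZMod (2 * b + 1)) ^ 2)⁻¹ :=
    (sum_range_reflect _ _).symm
  have h4 : ∑ j ∈ range b, (((b + 1 + (b - 1 - j) : ℕ) : ZMod (2 * b + 1)) ^ 2)⁻¹ =
      ∑ s ∈ range (b + 1), ((s : ZMod (2 * b + 1)) ^ 2)⁻¹ := by
    rw [sum_range_succ']
    simp only [Nat.cast_zero, ne_eq, OfNat.ofNat_ne_zero, not_false_eq_true, zero_pow, inv_zero,
      add_zero]
    refine sum_congr rfl fun j hj => ?_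
    have hj := mem_range.1 hj
    have : ((b + 1 + (b - 1 - j) : ℕ) : ZMod (2 * b + 1)) = -((j + 1 : ℕ) : ZMod (2 * b + 1)) := by
      rw [eq_neg_iff_add_eq_zero, ← Nat.cast_add, ZMod.natCast_eq_zero_iff]
      exact ⟨1, by omega⟩
    rw [this, neg_sq]
  rw [h3, h4, sum_range_reflect (fun s => ((s : ZMod (2 * b + 1)) ^ 2)⁻¹), ← two_mul] at h
  refine (mul_eq_zero.1 h).resolve_left fun h2 => ?_
  have := (ZMod.natCast_eq_zero_iff 2 (2 * b + 1)).1 (by exact_mod_cast h2)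
  exact absurd (Nat.le_of_dvd (by norm_num) this) (by omega)

theorem choose_add_eq_prod (y n : ℕ) :
    (y + n).choose n * ∏ i ∈ range n, (i + 1) = ∏ i ∈ range n, (y + (i + 1)) := by
  rw [prod_range_add_one_eq_factorial, mul_comm, ← Nat.ascFactorial_eq_factorial_mul_choose,
    Nat.ascFactorial_eq_prod_range]
  exact prod_congr rfl fun i _ => by ring

theorem natCast_dvd_prime_pow {p : ℕ} [Fact p.Prime] {k i : ℕ} (hi0 : i ≠ 0)
    (hi : i < p ^ (k + 1)) : (i : ℤ_[p]) ∣ (p : ℤ_[p]) ^ k := by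
  have hp : p.Prime := Fact.out
  obtain ⟨s, m, hm, rfl⟩ := Nat.exists_eq_pow_mul_and_not_dvd hi0 p hp.ne_one
  have hs : s ≤ k := by
    by_contra! h
    have h1 : p ^ (k + 1) ≤ p ^ s := Nat.pow_le_pow_right hp.pos h
    have h2 : p ^ s ≤ p ^ s * m := Nat.le_mul_of_pos_right _ (by
      rcases Nat.eq_zero_or_pos m with rfl | h
      · simp at hm
      · exact h)
    omega
  have hu : IsUnit (m : ℤ_[p]) := by
    by_contra h
    rw [PadicInt.not_isUnit_iff] at h
    have := (PadicInt.norm_int_lt_one_iff_dvd (p := p) (m : ℤ)).1 (by exact_mod_cast h)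
    exact hm (by exact_mod_cast this)
  push_cast
  exact (hu.mul_right_dvd).2 (pow_dvd_pow _ hs)

theorem prod_one_add_mul_sq {R ι : Type*} [CommRing R] (p v : R) (d : ι → R) (s : Finset ι) :
    p ^ 3 ∣ ∏ i ∈ s, (1 + v * (p ^ 2 * d i)) - (1 + v * p ^ 2 * ∑ i ∈ s, d i) := by
  classical
  induction s using Finset.induction_on with
  | empty => simp
  | insert a s ha ih =>
    obtain ⟨c, hc⟩ := ih
    rw [prod_insert ha, sum_insert ha]
    exact ⟨(1 + v * (p ^ 2 * d a)) * c + v ^ 2 * p * d a * ∑ i ∈ s, d i, by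
      linear_combination (1 + v * (p ^ 2 * d a)) * hc⟩

/-- With `n = p ^ (k + 1)`, the sum of the residues of `p^(2k) / (i (n - i))` over `0 < i < n`
vanishes: only the multiples of `p^k` contribute. -/
theorem sum_toZMod_eq_zero {p : ℕ} [Fact p.Prime] (hp3 : 3 < p) (k : ℕ) (a : ℕ → ℤ_[p])
    (ha : ∀ i, 0 < i → i < p ^ (k + 1) → (i : ℤ_[p]) * a i = (p : ℤ_[p]) ^ k) :
    ∑ i ∈ range (p ^ (k + 1) - 1), PadicInt.toZMod (a (i + 1) * a (p ^ (k + 1) - (i + 1))) = 0 := by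
  have hp : p.Prime := Fact.out
  have hpk : 0 < p ^ k := pow_pos hp.pos k
  have hp0 : (p : ℤ_[p]) ≠ 0 := by exact_mod_cast hp.ne_zero
  have key : ∀ w, 0 < w → w < p → PadicInt.toZMod (a (p ^ k * w)) = ((w : ZMod p))⁻¹ := by
    intro w hw hwp
    have h := ha (p ^ k * w) (by positivity)
      (by rw [pow_succ]; exact Nat.mul_lt_mul_of_pos_left hwp hpk)
    push_cast at h
    have h1 : (w : ℤ_[p]) * a (p ^ k * w) = 1 := by
      apply mul_left_cancel₀ (pow_ne_zero k hp0)
      linear_combination h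
    have h2 := congrArg PadicInt.toZMod h1
    rw [map_mul, map_natCast, map_one] at h2
    exact eq_inv_of_mul_eq_one_right h2
  have key0 : ∀ i, 0 < i → i < p ^ (k + 1) → ¬ p ^ k ∣ i → PadicInt.toZMod (a i) = 0 := by
    intro i hi0 hi hd
    have h := ha i hi0 hi
    rw [← RingHom.mem_ker, PadicInt.ker_toZMod, PadicInt.maximalIdeal_eq_span_p,
      Ideal.mem_span_singleton]
    by_contra hna
    apply hd
    have hu : IsUnit (a i) := by
      by_contra h
      rw [PadicInt.not_isUnit_iff, PadicInt.norm_lt_one_iff_dvd] at h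
      exact hna h
    have h3 : (p : ℤ_[p]) ^ k ∣ ((i : ℤ) : ℤ_[p]) := by
      rw [← hu.dvd_mul_right]
      exact ⟨1, by rw [mul_one]; exact_mod_cast h⟩
    rw [PadicInt.pow_p_dvd_int_iff] at h3
    exact_mod_cast h3
  have hn : 0 < p ^ (k + 1) := pow_pos hp.pos _
  have h1 : ∑ i ∈ range (p ^ (k + 1) - 1),
      PadicInt.toZMod (a (i + 1) * a (p ^ (k + 1) - (i + 1))) =
      ∑ i ∈ (Ico 1 (p ^ (k + 1))), PadicInt.toZMod (a i * a (p ^ (k + 1) - i)) := by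
    rw [sum_Ico_eq_sum_range]
    exact sum_congr rfl fun i _ => by rw [add_comm]
  have h2 : ∑ i ∈ (Ico 1 (p ^ (k + 1))), PadicInt.toZMod (a i * a (p ^ (k + 1) - i)) =
      ∑ w ∈ Ico 1 p, -((w : ZMod p) ^ 2)⁻¹ := by
    symm
    apply sum_of_injOn (fun w => p ^ k * w)
    · intro x _ y _ h
      exact Nat.eq_of_mul_eq_mul_left hpk h
    · intro w hw
      simp only [coe_Ico, Set.mem_Ico] at hw ⊢
      exact ⟨Nat.mul_pos hpk hw.1, by rw [pow_succ]; exact Nat.mul_lt_mul_of_pos_left hw.2 hpk⟩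
    · intro i hi hni
      rw [mem_Ico] at hi
      rw [map_mul, key0 i hi.1 hi.2, zero_mul]
      rintro ⟨w, rfl⟩
      refine hni ⟨w, ?_, rfl⟩
      rw [pow_succ] at hi
      simp only [coe_Ico, Set.mem_Ico]
      exact ⟨Nat.pos_of_mul_pos_left hi.1, Nat.lt_of_mul_lt_mul_left hi.2⟩
    · intro w hw
      rw [mem_Ico] at hw
      have h3 : p ^ (k + 1) - p ^ k * w = p ^ k * (p - w) := by rw [pow_succ, Nat.mul_sub]
      rw [h3, map_mul, key w hw.1 hw.2, key (p - w) (by omega) (by omega),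
        Nat.cast_sub hw.2.le, ZMod.natCast_self, zero_sub, inv_neg, sq, mul_inv]
      ring
  have h3 := sum_inv_sq hp3
  rw [range_eq_Ico, sum_eq_sum_Ico_succ_bot hp.pos] at h3
  rw [h1, h2, sum_neg_distrib]
  simpa using h3

theorem choose_mul_prime_pow_modEq {p : ℕ} (hp : p.Prime) (hp3 : 3 < p) (k u : ℕ) :
    (((p ^ (k + 1) * u + (p ^ (k + 1) - 1)).choose (p ^ (k + 1) - 1) : ℕ) : ZMod (p ^ 3)) = 1 := by
  have := Fact.mk hp
  set n := p ^ (k + 1) with hn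
  have hn0 : 0 < n := pow_pos hp.pos _
  set C := (n * u + (n - 1)).choose (n - 1) with hC
  have hex : ∀ i, ∃ a : ℤ_[p], 0 < i → i < n → (i : ℤ_[p]) * a = (p : ℤ_[p]) ^ k := by
    intro i
    by_cases h : 0 < i ∧ i < n
    · obtain ⟨a, ha⟩ := natCast_dvd_prime_pow (k := k) (p := p) h.1.ne' h.2
      exact ⟨a, fun _ _ => ha.symm⟩
    · exact ⟨0, fun h1 h2 => absurd ⟨h1, h2⟩ h⟩
  choose a ha using hex
  have hprod : (C : ℤ_[p]) = ∏ i ∈ range (n - 1), (1 + u * (p * a (i + 1))) := by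
    have h := congrArg (Nat.cast : ℕ → ℤ_[p]) (choose_add_eq_prod (n * u) (n - 1))
    rw [Nat.cast_mul, Nat.cast_prod, Nat.cast_prod] at h
    have h0 : (∏ i ∈ range (n - 1), ((i + 1 : ℕ) : ℤ_[p])) ≠ 0 :=
      prod_ne_zero_iff.2 fun i _ => by exact_mod_cast i.succ_ne_zero
    apply mul_right_cancel₀ h0
    rw [h, ← prod_mul_distrib]
    refine prod_congr rfl fun i hi => ?_
    have := ha (i + 1) (by omega) (by have := mem_range.1 hi; omega)
    rw [hn]
    push_cast at this ⊢
    linear_combination (-(u * p : ℤ_[p])) * this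
  have hrefl : (C : ℤ_[p]) = ∏ i ∈ range (n - 1), (1 + u * (p * a (n - (i + 1)))) := by
    rw [hprod, ← prod_range_reflect]
    refine prod_congr rfl fun i hi => ?_
    have := mem_range.1 hi
    rw [show n - 1 - 1 - i + 1 = n - (i + 1) by omega]
  have hsq : (C : ℤ_[p]) ^ 2 = ∏ i ∈ range (n - 1),
      (1 + (u + u ^ 2 : ℤ_[p]) * (p ^ 2 * (a (i + 1) * a (n - (i + 1))))) := by
    rw [sq]
    nth_rewrite 1 [hprod]
    rw [hrefl, ← prod_mul_distrib]
    refine prod_congr rfl fun i hi => ?_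
    have hi := mem_range.1 hi
    have h1 := ha (i + 1) (by omega) (by omega)
    have h2 := ha (n - (i + 1)) (by omega) (by omega)
    have hne : ((p : ℤ_[p]) ^ k) ≠ 0 := pow_ne_zero _ (by exact_mod_cast hp.ne_zero)
    have h3 : a (i + 1) + a (n - (i + 1)) = p * (a (i + 1) * a (n - (i + 1))) := by
      apply mul_left_cancel₀ hne
      have h4 : ((i + 1 : ℕ) : ℤ_[p]) + ((n - (i + 1) : ℕ) : ℤ_[p]) = p ^ k * p := by
        rw [← pow_succ, ← Nat.cast_pow, ← hn, ← Nat.cast_add]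
        congr 1
        omega
      linear_combination (-a (n - (i + 1))) * h1 - a (i + 1) * h2 + a (i + 1) * a (n - (i + 1)) * h4
    linear_combination (u * p : ℤ_[p]) * h3
  have hsum : (p : ℤ_[p]) ∣ ∑ i ∈ range (n - 1), a (i + 1) * a (n - (i + 1)) := by
    rw [← Ideal.mem_span_singleton, ← PadicInt.maximalIdeal_eq_span_p, ← PadicInt.ker_toZMod,
      RingHom.mem_ker, map_sum]
    exact sum_toZMod_eq_zero hp3 k a ha
  have hdvd : ((p : ℤ_[p]) ^ 3) ∣ (((C : ℤ) ^ 2 - 1 : ℤ) : ℤ_[p]) := by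
    have h := prod_one_add_mul_sq (p : ℤ_[p]) (u + u ^ 2) (fun i => a (i + 1) * a (n - (i + 1)))
      (range (n - 1))
    rw [← hsq] at h
    obtain ⟨c, hc⟩ := h
    obtain ⟨e, he⟩ := hsum
    refine ⟨c + (u + u ^ 2) * e, ?_⟩
    push_cast
    rw [he] at hc
    linear_combination hc
  rw [PadicInt.pow_p_dvd_int_iff] at hdvd
  have hC1 : (p : ℤ) ∣ (C : ℤ) - 1 := by
    have h : (p : ℤ_[p]) ^ 1 ∣ ((C - 1 : ℤ) : ℤ_[p]) := by
      push_cast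
      rw [hprod, pow_one, ← Ideal.mem_span_singleton, ← Ideal.Quotient.eq_zero_iff_mem, map_sub,
        map_prod, map_one, sub_eq_zero]
      refine prod_eq_one fun i _ => ?_
      rw [map_add, map_one, add_eq_left, Ideal.Quotient.eq_zero_iff_mem,
        Ideal.mem_span_singleton]
      exact ⟨u * a (i + 1), by ring⟩
    rw [PadicInt.pow_p_dvd_int_iff, pow_one] at h
    exact h
  have hcop : IsCoprime ((p : ℤ) ^ 3) ((C : ℤ) + 1) := by
    apply IsCoprime.pow_left
    rw [(Nat.prime_iff_prime_int.1 hp).irreducible.coprime_iff_not_dvd]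
    intro h
    have h2 : (p : ℤ) ∣ 2 := by
      have := dvd_sub h hC1
      rwa [show (C : ℤ) + 1 - (C - 1) = 2 by ring] at this
    have := Int.le_of_dvd (by norm_num) h2
    omega
  have hfin : ((p ^ 3 : ℕ) : ℤ) ∣ (C : ℤ) - 1 := by
    push_cast
    apply hcop.dvd_of_dvd_mul_right
    rwa [show ((C : ℤ) - 1) * (C + 1) = C ^ 2 - 1 by ring]
  rw [← ZMod.intCast_zmod_eq_zero_iff_dvd] at hfin
  push_cast at hfin
  exact sub_eq_zero.1 hfin

theorem sum_range_mul_add {M : Type*} [AddCommMonoid M] (f : ℕ → M) (q A d : ℕ) :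
    ∑ y ∈ range (q * A + d), f y =
      ∑ e ∈ range A, ∑ s ∈ range q, f (q * e + s) + ∑ s ∈ range d, f (q * A + s) := by
  rw [sum_range_add]
  congr 1
  induction A with
  | zero => simp
  | succ A ih => rw [Nat.mul_succ, sum_range_add, ih, sum_range_succ]

theorem prime_pow_dvd_of_pow_dvd_mul {p : ℕ} (hp : p.Prime) {m c : ℤ} {t : ℕ}
    (hm : ¬ (p : ℤ) ∣ m) (h : (p : ℤ) ^ t ∣ m * c) : (p : ℤ) ^ t ∣ c := by
  refine IsCoprime.dvd_of_dvd_mul_left (IsCoprime.pow_left ?_) h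
  rwa [(Nat.prime_iff_prime_int.1 hp).irreducible.coprime_iff_not_dvd]

theorem choose_sq_eq_zero {p : ℕ} (hp : p.Prime) {k y : ℕ} (hy : ¬ p ^ k ∣ y) :
    (((y + (p ^ (k + 1) - 1)).choose (p ^ (k + 1) - 1) : ℕ) : ZMod (p ^ 3)) ^ 2 = 0 := by
  have hn0 : 0 < p ^ (k + 1) := pow_pos hp.pos _
  have h := mul_choose_add y (p ^ (k + 1) - 1)
  rw [Nat.sub_add_cancel hn0] at h
  set c := (y + (p ^ (k + 1) - 1)).choose (p ^ (k + 1) - 1)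
  have hy0 : y ≠ 0 := by
    rintro rfl
    simp at hy
  obtain ⟨s, m, hm, rfl⟩ := Nat.exists_eq_pow_mul_and_not_dvd hy0 p hp.ne_one
  have hs : s < k := by
    by_contra! hks
    exact hy (dvd_mul_of_dvd_left (pow_dvd_pow _ hks) _)
  obtain ⟨t, rfl⟩ := Nat.exists_eq_add_of_lt hs
  rw [show s + t + 1 + 1 = s + (t + 2) by ring, pow_add p s, mul_assoc, mul_assoc] at h
  have h1 := Nat.eq_of_mul_eq_mul_left (pow_pos hp.pos s) h
  have h2 : p ^ (t + 2) ∣ c :=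
    ((hp.coprime_iff_not_dvd.2 hm).pow_left _).dvd_of_dvd_mul_left ⟨_, h1⟩
  rw [← Nat.cast_pow, ZMod.natCast_eq_zero_iff]
  calc p ^ 3 ∣ (p ^ (t + 2)) ^ 2 := by rw [← pow_mul]; exact pow_dvd_pow _ (by omega)
    _ ∣ c ^ 2 := pow_dvd_pow_of_dvd h2 2

theorem exists_choose_eq_mul {p : ℕ} [Fact p.Prime] (k e s : ℕ) (hs0 : 0 < s) (hs : s < p) :
    ∃ g : ℕ, (p ^ k * (p * e + s) + (p ^ (k + 1) - 1)).choose (p ^ (k + 1) - 1) = p * g ∧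
      (g : ZMod p) = (e + 1) * (s : ZMod p)⁻¹ := by
  have hp : p.Prime := Fact.out
  have hn0 : 0 < p ^ (k + 1) := pow_pos hp.pos _
  have hk0 : 0 < p ^ k := pow_pos hp.pos _
  have h := mul_choose_add (p ^ k * (p * e + s)) (p ^ (k + 1) - 1)
  rw [Nat.sub_add_cancel hn0] at h
  set c := (p ^ k * (p * e + s) + (p ^ (k + 1) - 1)).choose (p ^ (k + 1) - 1)
  rw [pow_succ, mul_assoc, mul_assoc] at h
  have h1 := Nat.eq_of_mul_eq_mul_left hk0 h
  have hsp : ¬ p ∣ s := fun hd => absurd (Nat.le_of_dvd hs0 hd) (by omega)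
  have hcop : Nat.Coprime p (p * e + s) := by
    rw [hp.coprime_iff_not_dvd, Nat.dvd_add_right (dvd_mul_right _ _)]
    exact hsp
  obtain ⟨g, hg⟩ := hcop.dvd_of_dvd_mul_left ⟨_, h1⟩
  refine ⟨g, hg, ?_⟩
  have hdiv : (p ^ k * (p * e + s) + (p ^ (k + 1) - 1)) / p ^ (k + 1) = e + 1 := by
    have h2 : p ^ k * s < p ^ (k + 1) := by
      rw [pow_succ]; exact Nat.mul_lt_mul_of_pos_left hs hk0
    have h3 : 0 < p ^ k * s := Nat.mul_pos hk0 hs0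
    rw [show p ^ k * (p * e + s) + (p ^ (k + 1) - 1) =
      (p ^ k * s - 1) + p ^ (k + 1) * (e + 1) by
        have : p ^ k * (p * e + s) = p ^ (k + 1) * e + p ^ k * s := by ring
        rw [this, mul_add]; omega, Nat.add_mul_div_left _ _ hn0, Nat.div_eq_of_lt (by omega),
      zero_add]
  have hl := choose_prime_pow_modEq hp (p ^ k * (p * e + s) + (p ^ (k + 1) - 1)) (k + 1)
  rw [hdiv, ← ZMod.natCast_eq_natCast_iff, pow_succ] at hl
  have h4 : (p * e + s) * g = (p ^ k * (p * e + s) + (p ^ k * p - 1)).choose (p ^ k * p) := by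
    apply Nat.eq_of_mul_eq_mul_left hp.pos
    rw [← h1, hg]
    ring
  rw [← h4] at hl
  push_cast at hl
  rw [ZMod.natCast_self, zero_mul, zero_add] at hl
  have hs' : (s : ZMod p) ≠ 0 := by rwa [Ne, ZMod.natCast_eq_zero_iff]
  rw [← hl]
  field_simp

theorem sum_choose_sq_row {p : ℕ} [Fact p.Prime] (hp3 : 3 < p) (k e : ℕ) {m : ℕ} (hm : m < p)
    (h0 : ∑ s ∈ range (m + 1), ((s : ZMod p) ^ 2)⁻¹ = 0) :
    ∑ s ∈ range (m + 1), (((p ^ k * (p * e + s) + (p ^ (k + 1) - 1)).choose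
      (p ^ (k + 1) - 1) : ℕ) : ZMod (p ^ 3)) ^ 2 = 1 := by
  have hp : p.Prime := Fact.out
  have hex : ∀ s, ∃ g : ℕ, s ∈ range m →
      (p ^ k * (p * e + (s + 1)) + (p ^ (k + 1) - 1)).choose (p ^ (k + 1) - 1) = p * g ∧
      (g : ZMod p) = (e + 1) * ((s + 1 : ℕ) : ZMod p)⁻¹ := by
    intro s
    by_cases hs : s ∈ range m
    · have := mem_range.1 hs
      obtain ⟨g, hg⟩ := exists_choose_eq_mul (p := p) k e (s + 1) (by omega) (by omega)
      exact ⟨g, fun _ => hg⟩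
    · exact ⟨0, fun h => absurd h hs⟩
  choose g hg using hex
  rw [sum_range_succ'] at h0 ⊢
  have h1 := choose_mul_prime_pow_modEq hp hp3 k e
  rw [add_zero, ← mul_assoc, ← pow_succ, h1, one_pow, add_eq_right]
  have h2 : ((∑ s ∈ range m, g s ^ 2 : ℕ) : ZMod p) = 0 := by
    push_cast
    rw [sum_congr rfl fun s hs => by rw [(hg s hs).2, mul_pow, inv_pow], ← mul_sum]
    simp only [Nat.cast_zero, ne_eq, OfNat.ofNat_ne_zero, not_false_eq_true, zero_pow, inv_zero,
      add_zero] at h0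
    rw [h0, mul_zero]
  rw [ZMod.natCast_eq_zero_iff] at h2
  rw [sum_congr rfl fun s hs => by rw [(hg s hs).1, ← Nat.cast_pow, mul_pow], ← Nat.cast_sum,
    ← mul_sum, ZMod.natCast_eq_zero_iff, pow_succ]
  exact mul_dvd_mul_left _ h2

theorem sum_choose_sq {p : ℕ} [Fact p.Prime] (hp3 : 3 < p) {k a b E : ℕ}
    (ha : p ^ k = 2 * a + 1) (hb : p = 2 * b + 1) :
    ∑ y ∈ range (p ^ k * (p * E + b) + (a + 1)), (((y + (p ^ (k + 1) - 1)).choose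
      (p ^ (k + 1) - 1) : ℕ) : ZMod (p ^ 3)) ^ 2 = E + 1 := by
  have hp : p.Prime := Fact.out
  have hblock : ∀ w d, d < p ^ k → ∑ s ∈ range (d + 1), (((p ^ k * w + s +
      (p ^ (k + 1) - 1)).choose (p ^ (k + 1) - 1) : ℕ) : ZMod (p ^ 3)) ^ 2 =
      (((p ^ k * w + (p ^ (k + 1) - 1)).choose (p ^ (k + 1) - 1) : ℕ) : ZMod (p ^ 3)) ^ 2 := by
    intro w d hd
    rw [sum_range_succ', add_zero, add_eq_right]
    refine sum_eq_zero fun s hs => choose_sq_eq_zero hp ?_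
    rw [Nat.dvd_add_right (dvd_mul_right _ _)]
    intro h
    have := Nat.le_of_dvd (by omega) h
    have := mem_range.1 hs
    omega
  have hhalf : ∑ s ∈ range (b + 1), ((s : ZMod p) ^ 2)⁻¹ = 0 := by
    subst hb
    exact sum_half_inv_sq hp3
  have hfull := sum_inv_sq hp3
  have hk0 : 0 < p ^ k := pow_pos hp.pos _
  have hblock' : ∀ w, ∑ s ∈ range (p ^ k), (((p ^ k * w + s +
      (p ^ (k + 1) - 1)).choose (p ^ (k + 1) - 1) : ℕ) : ZMod (p ^ 3)) ^ 2 =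
      (((p ^ k * w + (p ^ (k + 1) - 1)).choose (p ^ (k + 1) - 1) : ℕ) : ZMod (p ^ 3)) ^ 2 := by
    intro w
    rw [← hblock w (p ^ k - 1) (by omega), Nat.sub_add_cancel hk0]
  have hrow : ∀ e, ∑ s ∈ range p, (((p ^ k * (p * e + s) + (p ^ (k + 1) - 1)).choose
      (p ^ (k + 1) - 1) : ℕ) : ZMod (p ^ 3)) ^ 2 = 1 := by
    intro e
    have h := sum_choose_sq_row hp3 k e (m := p - 1) (by omega)
    rw [Nat.sub_add_cancel hp.pos] at h
    exact h hfull
  rw [sum_range_mul_add, hblock _ a (by omega), sum_congr rfl fun w _ => hblock' w,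
    ← sum_range_succ (fun w => (((p ^ k * w + (p ^ (k + 1) - 1)).choose
      (p ^ (k + 1) - 1) : ℕ) : ZMod (p ^ 3)) ^ 2), add_assoc, sum_range_mul_add,
    sum_congr rfl fun e _ => hrow e, sum_choose_sq_row hp3 k E (by omega) hhalf]
  simp

theorem centralBinom_prime_pow {p : ℕ} (hp : p.Prime) (hp3 : 3 < p) (k : ℕ) :
    ((p ^ (k + 1)).centralBinom : ZMod (p ^ 3)) = 2 := by
  have h := choose_mul_prime_pow_modEq hp hp3 k 1
  have hn0 : 0 < p ^ (k + 1) := pow_pos hp.pos _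
  obtain ⟨m, hm⟩ := Nat.exists_eq_add_one_of_ne_zero hn0.ne'
  rw [hm, mul_one, Nat.add_sub_cancel] at h
  have h2 : (m + 1).centralBinom = 2 * (m + 1 + m).choose m := by
    have h3 := mul_choose_add (m + 1) m
    have h4 := Nat.eq_of_mul_eq_mul_left (Nat.succ_pos m) h3
    rw [Nat.centralBinom_eq_two_mul_choose, show 2 * (m + 1) = m + 1 + m + 1 by ring,
      Nat.choose_succ_succ, ← h4, two_mul]
  rw [hm, h2, Nat.cast_mul, h]
  norm_num

theorem deformedSum_modEq {p : ℕ} [Fact p.Prime] (hp3 : 3 < p) {k D Y : ℕ} (hD : 3 ≤ D)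
    (hY : 2 * Y = 1 + p ^ (k + 1) * p ^ D) :
    (p : ℤ) ^ (k + 4) ∣ ∑ j ∈ range (p ^ (k + 1)),
      (3 * (j : ℤ) + 2 * Y) * j.centralBinom * (Nat.multichoose Y j) ^ 2 - p ^ (k + 1) := by
  have hp : p.Prime := Fact.out
  have hodd : Odd p := hp.odd_of_ne_two (by omega)
  obtain ⟨a, ha⟩ := hodd.pow (n := k)
  obtain ⟨E, hE⟩ := hodd.pow (n := D)
  obtain ⟨b, hb⟩ := hodd
  have hY' : Y = p ^ k * (p * E + b) + (a + 1) := by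
    have h1 : p ^ (k + 1) * p ^ D = 2 * (p ^ k * (p * E)) + p ^ k * p := by rw [hE]; ring
    have h2 : p ^ k * p = 2 * (p ^ k * b) + p ^ k := by
      linear_combination p ^ k * hb
    rw [mul_add]
    omega
  have hn0 : 0 < p ^ (k + 1) := pow_pos hp.pos _
  have hT := deformedSum_eq Y (p ^ (k + 1) - 1)
  rw [Nat.sub_add_cancel hn0] at hT
  have hA := sum_choose_sq hp3 (E := E) ha hb
  rw [← hY'] at hA
  have hC := centralBinom_prime_pow hp hp3 k
  have hpD : (2 * E + 1 : ZMod (p ^ 3)) = 0 := by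
    have : ((p ^ D : ℕ) : ZMod (p ^ 3)) = 0 := by
      rw [ZMod.natCast_eq_zero_iff]
      exact pow_dvd_pow _ hD
    rw [hE] at this
    exact_mod_cast this
  have hd : ((p ^ 3 : ℕ) : ℤ) ∣ (p ^ (k + 1)).centralBinom *
      ∑ y ∈ range Y, ((y + (p ^ (k + 1) - 1)).choose (p ^ (k + 1) - 1) : ℤ) ^ 2 - 1 := by
    rw [← ZMod.intCast_zmod_eq_zero_iff_dvd]
    simp only [Int.cast_sub, Int.cast_mul, Int.cast_natCast, Int.cast_sum, Int.cast_pow,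
      Int.cast_one]
    rw [hA, hC]
    linear_combination hpD
  obtain ⟨c, hc⟩ := hd
  refine ⟨c, ?_⟩
  rw [hT]
  push_cast at hc ⊢
  linear_combination (p : ℤ) ^ (k + 1) * hc

theorem succ_mul_multichoose_succ (Y j : ℕ) :
    (j + 1) * Nat.multichoose Y (j + 1) = (Y + j) * Nat.multichoose Y j := by
  rw [← mul_multichoose_succ, Nat.multichoose_eq Y, Nat.multichoose_eq (Y + 1)]
  have h := mul_choose_add Y j
  rw [show Y + 1 + j - 1 = Y + j by omega, h, show Y + (j + 1) - 1 = Y + j by omega]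

theorem factorial_mul_four_pow_mul_multichoose {t : ℤ} {Y : ℕ} (hY : 2 * (Y : ℤ) = 1 + t) (j : ℕ) :
    t ∣ j.factorial * (4 ^ j * Nat.multichoose Y j - j.centralBinom) := by
  induction j with
  | zero => simp
  | succ j ih =>
    obtain ⟨c, hc⟩ := ih
    have h1 : ((j : ℤ) + 1) * (j + 1).centralBinom = 2 * (2 * j + 1) * j.centralBinom := by
      exact_mod_cast Nat.succ_mul_centralBinom_succ j
    have h2 : ((j : ℤ) + 1) * Nat.multichoose Y (j + 1) = (Y + j) * Nat.multichoose Y j := by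
      exact_mod_cast succ_mul_multichoose_succ Y j
    refine ⟨2 * (2 * j + 1) * c + 2 * j.factorial * 4 ^ j * Nat.multichoose Y j, ?_⟩
    rw [Nat.factorial_succ]
    push_cast
    linear_combination (j.factorial * 4 ^ (j + 1) : ℤ) * h2 - (j.factorial : ℤ) * h1 +
      2 * (2 * j + 1) * hc + 2 * j.factorial * 4 ^ j * (Nat.multichoose Y j : ℤ) * hY

/-- `x` is `p ^ m` times a fraction whose denominator is prime to `p`. -/
def IsPadicMultiple (p m : ℕ) (x : ℚ) : Prop :=
  ∃ a b : ℤ, ¬ (p : ℤ) ∣ b ∧ x * b = p ^ m * a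

theorem IsPadicMultiple.add {p m : ℕ} (hp : p.Prime) {x y : ℚ} (hx : IsPadicMultiple p m x)
    (hy : IsPadicMultiple p m y) : IsPadicMultiple p m (x + y) := by
  obtain ⟨a, b, hb, h⟩ := hx
  obtain ⟨c, d, hd, h'⟩ := hy
  refine ⟨a * d + c * b, b * d, (Nat.prime_iff_prime_int.1 hp).not_dvd_mul hb hd, ?_⟩
  push_cast
  linear_combination (d : ℚ) * h + (b : ℚ) * h'

theorem IsPadicMultiple.sum {p m : ℕ} (hp : p.Prime) {ι : Type*} (s : Finset ι) (f : ι → ℚ)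
    (h : ∀ i ∈ s, IsPadicMultiple p m (f i)) : IsPadicMultiple p m (∑ i ∈ s, f i) := by
  refine sum_induction f (IsPadicMultiple p m) (fun _ _ hx hy => hx.add hp hy) ?_ h
  exact ⟨0, 1, (Nat.prime_iff_prime_int.1 hp).not_dvd_one, by simp⟩

theorem IsPadicMultiple.num_den {p m : ℕ} (hp : p.Prime) {x : ℚ} (hx : IsPadicMultiple p m x) :
    (p : ℤ) ^ m ∣ x.num ∧ ¬ (p : ℤ) ∣ (x.den : ℤ) := by
  obtain ⟨a, b, hb, h⟩ := hx
  have hb0 : (b : ℚ) ≠ 0 := by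
    rintro h0
    rw [Int.cast_eq_zero] at h0
    simp [h0] at hb
  constructor
  · apply prime_pow_dvd_of_pow_dvd_mul hp hb
    refine ⟨a * x.den, ?_⟩
    have hd : (x.den : ℚ) ≠ 0 := by exact_mod_cast x.den_ne_zero
    have hxd : x * x.den = x.num := Rat.mul_den_eq_num x
    have : (b : ℚ) * x.num = p ^ m * (a * x.den) := by
      linear_combination (x.den : ℚ) * h - (b : ℚ) * hxd
    exact_mod_cast this
  · intro hd
    have hx : x = ((p ^ m * a : ℤ) : ℚ) / b := by
      rw [eq_div_iff hb0, h]
      push_cast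
      ring
    have := Rat.den_dvd (p ^ m * a) b
    rw [Rat.divInt_eq_div, ← hx] at this
    exact hb (hd.trans this)

theorem sum_eq_sum_add_boundary (n : ℕ) :
    ∑ k ∈ range n, 6 * (k : ℚ) ^ 4 / (16 ^ k * (2 * (k : ℚ) - 1)) * (k.centralBinom : ℚ) ^ 3 =
      ∑ k ∈ range n, (3 * (k : ℚ) + 1) * (k.centralBinom : ℚ) ^ 3 / 16 ^ k +
        (n : ℚ) ^ 3 * (2 * n - 4) / (16 ^ n * (2 * n - 1)) * (n.centralBinom : ℚ) ^ 3 := by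
  have hne : ∀ n : ℕ, 2 * (n : ℚ) - 1 ≠ 0 := by
    intro n h
    have : ((2 * n : ℕ) : ℚ) = (1 : ℕ) := by push_cast; linarith
    have := Nat.cast_injective this
    omega
  induction n with
  | zero => simp
  | succ n ih =>
    rw [sum_range_succ, sum_range_succ, ih]
    have h1 : ((n : ℚ) + 1) * (n + 1).centralBinom = 2 * (2 * n + 1) * n.centralBinom := by
      exact_mod_cast Nat.succ_mul_centralBinom_succ n
    have h2 := hne n
    have h3 : 2 * (n : ℚ) + 1 ≠ 0 := by positivity
    have h4 : ((n + 1 : ℕ) : ℚ) ^ 3 * (2 * (n + 1 : ℕ) - 4) /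
        (16 ^ (n + 1) * (2 * (n + 1 : ℕ) - 1)) * ((n + 1).centralBinom : ℚ) ^ 3 =
        (2 * (2 * n + 1) * n.centralBinom) ^ 3 * (2 * (n : ℚ) - 2) /
          (16 ^ (n + 1) * (2 * n + 1)) := by
      rw [← h1]
      push_cast
      rw [show 2 * ((n : ℚ) + 1) - 1 = 2 * n + 1 by ring]
      ring
    rw [h4, pow_succ (16 : ℚ) n, add_assoc, add_assoc]
    congr 1
    field_simp
    linear_combination (64 * (n : ℚ) ^ 3 * (n.centralBinom : ℚ) ^ 3) * mul_inv_cancel₀ h2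

theorem isPadicMultiple_term_sub {p : ℕ} (hp : p.Prime) (hp3 : 3 < p) {m Y j L : ℕ}
    (hL : m + j.factorial ≤ L) (hY : 2 * (Y : ℤ) = 1 + p ^ L) :
    IsPadicMultiple p m ((3 * (j : ℚ) + 1) * (j.centralBinom : ℚ) ^ 3 / 16 ^ j -
      (3 * (j : ℚ) + 2 * Y) * j.centralBinom * (Nat.multichoose Y j) ^ 2) := by
  have h := factorial_mul_four_pow_mul_multichoose hY j
  have h2 : (p : ℤ) ^ m ∣ 4 ^ j * Nat.multichoose Y j - j.centralBinom := by
    obtain ⟨s, c, hc, hs⟩ := Nat.exists_eq_pow_mul_and_not_dvd j.factorial_ne_zero p hp.ne_one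
    have hsj : s ≤ j.factorial := by
      calc s ≤ p ^ s := (Nat.lt_pow_self hp.one_lt).le
        _ ≤ j.factorial := Nat.le_of_dvd j.factorial_pos ⟨c, hs⟩
    obtain ⟨d, rfl⟩ := Nat.exists_eq_add_of_le hL
    have h3 : (p : ℤ) ^ s * p ^ m ∣ p ^ s *
        (c * (4 ^ j * Nat.multichoose Y j - j.centralBinom)) := by
      rw [← mul_assoc, ← pow_add]
      have : ((j.factorial : ℕ) : ℤ) = p ^ s * c := by rw [hs]; push_cast; ring
      rw [this] at h
      exact (pow_dvd_pow _ (by omega)).trans h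
    have h4 := (mul_dvd_mul_iff_left (pow_ne_zero s (by exact_mod_cast hp.ne_zero))).1 h3
    exact prime_pow_dvd_of_pow_dvd_mul hp (by exact_mod_cast hc) h4
  obtain ⟨c, hc⟩ := h2
  obtain ⟨d, rfl⟩ := Nat.exists_eq_add_of_le (le_of_add_le_left hL)
  refine ⟨-(p ^ d * 16 ^ j * j.centralBinom * Nat.multichoose Y j ^ 2 +
    (3 * j + 1) * j.centralBinom * c * (4 ^ j * Nat.multichoose Y j + j.centralBinom)),
    16 ^ j, ?_, ?_⟩
  · intro hd
    have := (Nat.prime_iff_prime_int.1 hp).dvd_of_dvd_pow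
      (show (p : ℤ) ∣ 2 ^ (4 * j) by rwa [pow_mul])
    have := Int.le_of_dvd (by norm_num) this
    omega
  · have h16 : (16 : ℚ) ^ j = 4 ^ j * 4 ^ j := by rw [← mul_pow]; norm_num
    have hcq : (4 : ℚ) ^ j * Nat.multichoose Y j - j.centralBinom = p ^ m * c := by
      exact_mod_cast congrArg (Int.cast : ℤ → ℚ) hc
    have hYq : 2 * (Y : ℚ) = 1 + p ^ (m + d) := by exact_mod_cast congrArg (Int.cast : ℤ → ℚ) hY
    have h0 : (16 : ℚ) ^ j ≠ 0 := by positivity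
    push_cast
    rw [sub_mul, div_mul_cancel₀ _ h0, hYq, h16]
    linear_combination (-(3 * j + 1) * (j.centralBinom : ℚ) *
      (4 ^ j * Nat.multichoose Y j + j.centralBinom)) * hcq

theorem stmt_5 (p : ℕ) (hp : p.Prime) (hp3 : 3 < p) (r : ℕ) (hr : 2 ≤ r) (x : ℚ)
    (hx : x = (∑ k ∈ Finset.range (p ^ r),
        6 * (k : ℚ) ^ 4 / (16 ^ k * (2 * (k : ℚ) - 1)) * ((2 * k).choose k : ℚ) ^ 3) -
      (p : ℚ) ^ r) :
    (p : ℤ) ^ (r + 3) ∣ x.num ∧ ¬ (p : ℤ) ∣ (x.den : ℤ) := by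
  have := Fact.mk hp
  have hpz := Nat.prime_iff_prime_int.1 hp
  apply IsPadicMultiple.num_den hp
  simp only [← Nat.centralBinom_eq_two_mul_choose] at hx
  rw [sum_eq_sum_add_boundary] at hx
  obtain ⟨k, rfl⟩ := Nat.exists_eq_add_of_le' (le_of_add_le_right hr : 1 ≤ r)
  set D := 3 + (p ^ (k + 1)).factorial with hD
  obtain ⟨Y₀, hY₀⟩ := (hp.odd_of_ne_two (by omega)).pow (n := k + 1 + D)
  obtain ⟨Y, hY⟩ : ∃ Y, 2 * Y = 1 + p ^ (k + 1) * p ^ D := ⟨Y₀ + 1, by rw [← pow_add]; omega⟩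
  have hYz : 2 * (Y : ℤ) = 1 + p ^ (k + 1 + D) := by rw [pow_add]; exact_mod_cast hY
  have h1 := IsPadicMultiple.sum (m := k + 1 + 3) hp (range (p ^ (k + 1))) _ fun j hj =>
    isPadicMultiple_term_sub (j := j) (L := k + 1 + D) hp hp3 (by
      have := Nat.factorial_le (mem_range.1 hj).le
      omega) hYz
  have h2 : IsPadicMultiple p (k + 1 + 3) (∑ j ∈ range (p ^ (k + 1)),
      (3 * (j : ℚ) + 2 * Y) * j.centralBinom * (Nat.multichoose Y j) ^ 2 - p ^ (k + 1)) := by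
    obtain ⟨c, hc⟩ := deformedSum_modEq hp3 (by omega) hY
    refine ⟨c, 1, hpz.not_dvd_one, ?_⟩
    rw [Int.cast_one, mul_one]
    exact_mod_cast congrArg (Int.cast : ℤ → ℚ) hc
  have h3 : IsPadicMultiple p (k + 1 + 3) (((p ^ (k + 1) : ℕ) : ℚ) ^ 3 *
      (2 * (p ^ (k + 1) : ℕ) - 4) / (16 ^ (p ^ (k + 1)) * (2 * (p ^ (k + 1) : ℕ) - 1)) *
        ((p ^ (k + 1)).centralBinom : ℚ) ^ 3) := by
    obtain ⟨d, rfl⟩ : ∃ d, k = d + 1 := Nat.exists_eq_add_of_le' (by omega)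
    set n := p ^ (d + 1 + 1) with hn
    have hpn : (p : ℤ) ∣ n := by
      rw [hn, pow_succ]
      push_cast
      exact dvd_mul_left _ _
    have hb : ¬ (p : ℤ) ∣ 16 ^ n * (2 * n - 1) := by
      apply hpz.not_dvd_mul
      · intro hd
        have := hpz.dvd_of_dvd_pow (show (p : ℤ) ∣ 2 ^ (4 * n) by rwa [pow_mul])
        have := Int.le_of_dvd (by norm_num) this
        omega
      · rw [dvd_sub_right (hpn.mul_left 2)]
        exact hpz.not_dvd_one
    refine ⟨p ^ (2 * d + 1) * (2 * n - 4) * n.centralBinom ^ 3, _, hb, ?_⟩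
    have hb0 : ((16 ^ n * (2 * n - 1) : ℤ) : ℚ) ≠ 0 := by
      intro h
      rw [Int.cast_eq_zero] at h
      rw [h] at hb
      simp at hb
    have hnq : (n : ℚ) ^ 3 = p ^ (d + 1 + 1 + 3) * p ^ (2 * d + 1) := by
      rw [hn]
      push_cast
      ring
    push_cast at hb0 ⊢
    rw [hnq, div_mul_eq_mul_div, div_mul_cancel₀ _ hb0]
    ring
  have h4 := (h1.add hp h2).add hp h3
  rw [sum_sub_distrib] at h4
  convert h4 using 1
  rw [hx]
  ring
end
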